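/- arXiv:2509.12755 — 4 statements merged into one kernel-verified Lean document; each statement's English description precedes it below -/
import Mathlib

section
/- Let q be a power of a prime p. Let ν : 𝔽_q[x] → ℂ be a 1-bounded multiplicative aperiodic function, let m be a positive integer with m < p, let P : 𝔽_q[x] → 𝔽_q be a polynomial map of degree at most m, and let α be an additive character of 𝔽_q. Then (1/q^n)·∑_{g ∈ G_n} ν(g)·α(P(g)) → 0 as n → ∞. -/
open Polynomial Filter

/-- The polynomial with coefficient vector `c`, an element of `G_n` (degree < n). -/
noncomputable def polyOf {F : Type*} [Semiring F] {n : ℕ} (c : Fin n → F) : Polynomial F :=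
  ∑ i, Polynomial.C (c i) * Polynomial.X ^ (i : ℕ)

/-- Multiplicative function on `𝔽_q[x]`. -/
def IsMultFn {F : Type*} [CommSemiring F] (f : Polynomial F → ℂ) : Prop :=
  ∀ g h : Polynomial F, IsCoprime g h → f (g * h) = f g * f h

/-- Aperiodic function on `𝔽_q[x]`. -/
def IsAperiodicFn {F : Type*} [Field F] [Fintype F] (f : Polynomial F → ℂ) : Prop :=
  ∀ s : Polynomial F, s ≠ 0 → ∀ a : (Polynomial F ⧸ Ideal.span {s}) → ℂ,
    Tendsto (fun n : ℕ => (1 / (Fintype.card F : ℂ) ^ n) *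
        ∑ c : Fin n → F, f (polyOf c) *
          (starRingEnd ℂ) (a (Ideal.Quotient.mk (Ideal.span {s}) (polyOf c))))
      atTop (nhds 0)

/-- Difference operator `Δ_h P (g) = P (g + h) - P g`. -/
def Δop {A M : Type*} [Add A] [Sub M] (h : A) (P : A → M) : A → M := fun g => P (g + h) - P g

/-- `P` is a polynomial map of degree at most `m`:
all `(m+1)`-fold differences vanish identically. -/
def DegLE {A M : Type*} [Add A] [AddGroup M] (P : A → M) (m : ℕ) : Prop :=
  ∀ h : Fin (m + 1) → A, ∀ g : A, (List.ofFn h).foldr Δop P g = 0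

open scoped BigOperators ComplexConjugate

/-- A finite set which is an additive subgroup. -/
structure IsFinSub {U : Type*} [AddCommGroup U] (K : Finset U) : Prop where
  zero_mem : (0 : U) ∈ K
  sub_mem : ∀ a ∈ K, ∀ b ∈ K, a - b ∈ K

namespace IsFinSub

variable {U : Type*} [AddCommGroup U] {K : Finset U}

lemma neg_mem (hK : IsFinSub K) {a : U} (ha : a ∈ K) : -a ∈ K := by
  simpa using hK.sub_mem 0 hK.zero_mem a ha

lemma add_mem (hK : IsFinSub K) {a b : U} (ha : a ∈ K) (hb : b ∈ K) : a + b ∈ K := by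
  simpa using hK.sub_mem a ha (-b) (hK.neg_mem hb)

lemma nonempty (hK : IsFinSub K) : K.Nonempty := ⟨0, hK.zero_mem⟩

lemma expect_add_right {M : Type*} [AddCommMonoid M] [Module ℚ≥0 M] (hK : IsFinSub K) (f : U → M)
    {a : U} (ha : a ∈ K) : 𝔼 x ∈ K, f (x + a) = 𝔼 x ∈ K, f x :=
  Finset.expect_equiv (Equiv.addRight a)
    (fun i => ⟨fun h => hK.add_mem h ha, fun h => by
      simpa using hK.sub_mem _ h a ha⟩) (fun _ _ => rfl)

lemma prod {U' : Type*} [AddCommGroup U'] {K' : Finset U'} (hK : IsFinSub K)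
    (hK' : IsFinSub K') : IsFinSub (K ×ˢ K') :=
  ⟨by simp [hK.zero_mem, hK'.zero_mem], fun a ha b hb => by
    rw [Finset.mem_product] at *
    exact ⟨hK.sub_mem _ ha.1 _ hb.1, hK'.sub_mem _ ha.2 _ hb.2⟩⟩

lemma pi (hK : IsFinSub K) (m : ℕ) : IsFinSub (Fintype.piFinset fun _ : Fin m => K) :=
  ⟨by simp [hK.zero_mem], fun a ha b hb => by
    rw [Fintype.mem_piFinset] at *
    exact fun i => hK.sub_mem _ (ha i) _ (hb i)⟩

/-- The average over a finite subgroup of a function multiplicative on it is `0` or `1`. -/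
lemma expect_char (hK : IsFinSub K) (χ : U → ℂ) (hχ : ∀ a b, χ (a + b) = χ a * χ b) :
    ((∀ a ∈ K, χ a = 1) ∧ 𝔼 x ∈ K, χ x = 1) ∨ 𝔼 x ∈ K, χ x = 0 := by
  by_cases h : ∀ a ∈ K, χ a = 1
  · refine Or.inl ⟨h, ?_⟩
    rw [Finset.expect_congr rfl h, Finset.expect_const hK.nonempty]
  · right
    push Not at h
    obtain ⟨a, ha, hne⟩ := h
    have := hK.expect_add_right χ ha
    simp only [hχ, ← Finset.expect_mul] at this
    have h2 : (𝔼 x ∈ K, χ x) * (χ a - 1) = 0 := by linear_combination this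
    exact (mul_eq_zero.mp h2).resolve_right (sub_ne_zero.mpr hne)

end IsFinSub

lemma norm_expect_sq_le {ι : Type*} (s : Finset ι) (f : ι → ℂ) :
    ‖𝔼 i ∈ s, f i‖ ^ 2 ≤ 𝔼 i ∈ s, ‖f i‖ ^ 2 := by
  rcases s.eq_empty_or_nonempty with rfl | hs
  · simp
  have h := Finset.expect_mul_sq_le_sq_mul_sq s (fun i => ‖f i‖) (fun _ => (1 : ℝ))
  simp only [mul_one, one_pow, Finset.expect_const hs] at h
  refine le_trans ?_ h
  gcongr
  exact RCLike.norm_expect_le (K := ℂ)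

lemma expect_pow_le {ι : Type*} (s : Finset ι) (f : ι → ℝ) (hf : ∀ i ∈ s, 0 ≤ f i) (n : ℕ) :
    (𝔼 i ∈ s, f i) ^ (2 ^ n) ≤ 𝔼 i ∈ s, f i ^ (2 ^ n) := by
  rcases s.eq_empty_or_nonempty with rfl | hs
  · simp
  induction n generalizing f with
  | zero => simp
  | succ n ih =>
    have h := Finset.expect_mul_sq_le_sq_mul_sq s f (fun _ => (1 : ℝ))
    simp only [mul_one, one_pow, Finset.expect_const hs] at h
    calc (𝔼 i ∈ s, f i) ^ (2 ^ (n + 1)) = ((𝔼 i ∈ s, f i) ^ 2) ^ (2 ^ n) := by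
          rw [← pow_mul, pow_succ, mul_comm]
      _ ≤ (𝔼 i ∈ s, f i ^ 2) ^ (2 ^ n) := by gcongr
      _ ≤ 𝔼 i ∈ s, (f i ^ 2) ^ (2 ^ n) := ih _ fun i _ => sq_nonneg _
      _ = _ := by simp_rw [← pow_mul, pow_succ, mul_comm]

section Bias

variable {F : Type*} [Field F] (ψ : AddChar F ℂ)
variable {U U' : Type*} [AddCommGroup U] [AddCommGroup U'] {m : ℕ}

lemma MultilinearMap.map_add_single (T : MultilinearMap ℤ (fun _ : Fin m => U) F) (h : Fin m → U)
    (i : Fin m) (a : U) : T (h + Pi.single i a) = T h + T (Function.update h i a) := by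
  have : h + Pi.single i a = Function.update h i (h i + a) := by
    ext j
    rcases eq_or_ne j i with rfl | hj <;> simp [*]
  rw [this, T.map_update_add, Function.update_eq_self]

/-- The absolute value of the average of `ψ ∘ T` over the box `K ^ m`. -/
noncomputable def bias (K : Finset U) (T : MultilinearMap ℤ (fun _ : Fin m => U) F) : ℝ :=
  ‖𝔼 h ∈ Fintype.piFinset (fun _ : Fin m => K), ψ (T h)‖

lemma bias_nonneg (K : Finset U) (T : MultilinearMap ℤ (fun _ : Fin m => U) F) :
    0 ≤ bias ψ K T := norm_nonneg _

variable [Fintype F]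

lemma norm_expect_shift_le_update {K : Finset U'} (hK : IsFinSub K)
    (T : MultilinearMap ℤ (fun _ : Fin m => U') F) (T' : MultilinearMap ℤ (fun _ : Fin m => U) F)
    (L : Fin m → U' →ₗ[ℤ] U) (k : Fin m → U) (i : Fin m) :
    ‖𝔼 h ∈ Fintype.piFinset (fun _ : Fin m => K), ψ (T h + T' ((fun j => L j (h j)) + k))‖ ≤
    ‖𝔼 h ∈ Fintype.piFinset (fun _ : Fin m => K),
      ψ (T h + T' ((fun j => L j (h j)) + Function.update k i 0))‖ := by
  set B := Fintype.piFinset (fun _ : Fin m => K) with hB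
  have hBs : IsFinSub B := hK.pi m
  let χ : (Fin m → U') → U' → ℂ := fun h a =>
    ψ (T (Function.update h i a) + T' (Function.update ((fun j => L j (h j)) + k) i (L i a)))
  have hLs : ∀ (h : Fin m → U') (a : U'),
      (fun j => L j ((h + Pi.single i a : Fin m → U') j)) = (fun j => L j (h j)) + Pi.single i (L i a) := by
    intro h a
    ext j
    rcases eq_or_ne j i with rfl | hj <;> simp [*]
  have hχ : ∀ h, 𝔼 a ∈ K, χ h a = 1 ∧ (∀ a ∈ K, χ h a = 1) ∨ 𝔼 a ∈ K, χ h a = 0 := by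
    intro h
    have := hK.expect_char (χ h) (fun a b => by
      simp only [χ, map_add, MultilinearMap.map_update_add, ← AddChar.map_add_eq_mul]
      congr 1; abel)
    tauto
  have key : ∀ k' : Fin m → U, (∀ j, j ≠ i → k' j = k j) →
      𝔼 h ∈ B, ψ (T h + T' ((fun j => L j (h j)) + k')) =
      𝔼 h ∈ B, ψ (T h + T' ((fun j => L j (h j)) + k')) * 𝔼 a ∈ K, χ h a := by
    intro k' hk'
    have h1 : ∀ a ∈ K, 𝔼 h ∈ B, ψ (T h + T' ((fun j => L j (h j)) + k')) =
        𝔼 h ∈ B, ψ (T h + T' ((fun j => L j (h j)) + k')) * χ h a := by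
      intro a ha
      have hs : Pi.single i a ∈ B := by
        rw [hB, Fintype.mem_piFinset]
        intro j
        rcases eq_or_ne j i with rfl | hj <;> simp [*, hK.zero_mem]
      rw [← hBs.expect_add_right _ hs]
      refine Finset.expect_congr rfl fun h _ => ?_
      have hu : Function.update ((fun j => L j (h j)) + k') i (L i a) =
          Function.update ((fun j => L j (h j)) + k) i (L i a) := by
        ext j
        rcases eq_or_ne j i with rfl | hj <;> simp [*]
      rw [hLs, add_right_comm, MultilinearMap.map_add_single, MultilinearMap.map_add_single, hu,
        ← AddChar.map_add_eq_mul]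
      congr 1; abel
    calc _ = 𝔼 a ∈ K, 𝔼 h ∈ B, ψ (T h + T' ((fun j => L j (h j)) + k')) := by
          rw [Finset.expect_const hK.nonempty]
      _ = 𝔼 a ∈ K, 𝔼 h ∈ B, ψ (T h + T' ((fun j => L j (h j)) + k')) * χ h a :=
          Finset.expect_congr rfl h1
      _ = _ := by
          rw [Finset.expect_comm]
          simp_rw [Finset.mul_expect]
  have hnonneg : ∀ h, (𝔼 a ∈ K, χ h a) = ((‖𝔼 a ∈ K, χ h a‖ : ℝ) : ℂ) := by
    intro h
    rcases hχ h with h1 | h1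
    · simp [h1.1]
    · simp [h1]
  have hright : 𝔼 h ∈ B, ψ (T h + T' ((fun j => L j (h j)) + Function.update k i 0)) =
      ((𝔼 h ∈ B, ‖𝔼 a ∈ K, χ h a‖ : ℝ) : ℂ) := by
    rw [key _ (fun j hj => by simp [hj])]
    rw [show ((𝔼 h ∈ B, ‖𝔼 a ∈ K, χ h a‖ : ℝ) : ℂ) = 𝔼 h ∈ B, ((‖𝔼 a ∈ K, χ h a‖ : ℝ) : ℂ) from
      RCLike.ofReal_expect (K := ℂ) _ _]
    refine Finset.expect_congr rfl fun h hh => ?_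
    rw [← hnonneg]
    rcases hχ h with h1 | h1
    · have hhi : h i ∈ K := (Fintype.mem_piFinset.mp hh) i
      have h2 := h1.2 (h i) hhi
      have hu : Function.update ((fun j => L j (h j)) + k) i (L i (h i)) =
          (fun j => L j (h j)) + Function.update k i 0 := by
        ext j
        rcases eq_or_ne j i with rfl | hj <;> simp [*]
      simp only [χ, Function.update_eq_self, hu] at h2
      rw [h2, one_mul]
    · rw [h1, mul_zero]
  rw [hright, key k (fun _ _ => rfl), Complex.norm_real, Real.norm_of_nonneg
    (Finset.expect_nonneg fun _ _ => norm_nonneg _)]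
  refine (RCLike.norm_expect_le (K := ℂ)).trans (Finset.expect_le_expect fun h _ => ?_)
  rw [norm_mul, AddChar.norm_apply, one_mul]

lemma norm_expect_shift_le {K : Finset U'} (hK : IsFinSub K)
    (T : MultilinearMap ℤ (fun _ : Fin m => U') F) (T' : MultilinearMap ℤ (fun _ : Fin m => U) F)
    (L : Fin m → U' →ₗ[ℤ] U) (k : Fin m → U) :
    ‖𝔼 h ∈ Fintype.piFinset (fun _ : Fin m => K), ψ (T h + T' ((fun j => L j (h j)) + k))‖ ≤
    bias ψ K (T + T'.compLinearMap L) := by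
  have : ∀ s : Finset (Fin m),
      ‖𝔼 h ∈ Fintype.piFinset (fun _ : Fin m => K), ψ (T h + T' ((fun j => L j (h j)) + k))‖ ≤
      ‖𝔼 h ∈ Fintype.piFinset (fun _ : Fin m => K),
        ψ (T h + T' ((fun j => L j (h j)) + s.piecewise 0 k))‖ := by
    intro s
    induction s using Finset.induction_on with
    | empty => simp
    | insert i s hi ih =>
      refine ih.trans ((norm_expect_shift_le_update ψ hK T T' L _ i).trans_eq ?_)
      rw [Finset.piecewise_insert]
      rfl
  refine (this Finset.univ).trans_eq ?_
  simp [bias]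

lemma bias_mul_bias_le {K : Finset U} (hK : IsFinSub K)
    (T T' : MultilinearMap ℤ (fun _ : Fin m => U) F) :
    bias ψ K T * bias ψ K T' ≤ bias ψ K (T + T') := by
  have hB := hK.pi m
  set B := Fintype.piFinset (fun _ : Fin m => K) with hBdef
  have : (𝔼 h ∈ B, ψ (T h)) * (𝔼 h ∈ B, ψ (T' h)) =
      𝔼 k ∈ B, 𝔼 h ∈ B, ψ (T h + T' ((fun j => LinearMap.id (R := ℤ) (h j)) + k)) := by
    rw [Finset.expect_mul_expect, Finset.expect_comm]
    rw [Finset.expect_comm]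
    conv_rhs => rw [Finset.expect_comm]
    refine Finset.expect_congr rfl fun h hh => ?_
    rw [← hB.expect_add_right _ hh]
    refine Finset.expect_congr rfl fun k _ => ?_
    rw [← AddChar.map_add_eq_mul, add_comm k h]
    rfl
  rw [bias, bias, ← norm_mul, this]
  refine (RCLike.norm_expect_le (K := ℂ)).trans (Finset.expect_le hB.nonempty fun k _ => ?_)
  exact norm_expect_shift_le ψ hK T T' (fun _ => LinearMap.id) k

lemma bias_le_bias_compLinearMap {K : Finset U} (hK : IsFinSub K) {K' : Finset U'}
    (hK' : IsFinSub K') (T : MultilinearMap ℤ (fun _ : Fin m => U) F)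
    (L : Fin m → U' →ₗ[ℤ] U) (hL : ∀ i, ∀ x ∈ K', L i x ∈ K) :
    bias ψ K T ≤ bias ψ K' (T.compLinearMap L) := by
  have hB := hK.pi m
  have hB' := hK'.pi m
  set B := Fintype.piFinset (fun _ : Fin m => K) with hBdef
  set B' := Fintype.piFinset (fun _ : Fin m => K') with hBdef'
  have : 𝔼 h ∈ B, ψ (T h) = 𝔼 h ∈ B, 𝔼 k ∈ B',
      ψ ((0 : MultilinearMap ℤ (fun _ : Fin m => U') F) k + T ((fun j => L j (k j)) + h)) := by
    rw [Finset.expect_comm]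
    rw [← Finset.expect_const hB'.nonempty (𝔼 h ∈ B, ψ (T h))]
    refine Finset.expect_congr rfl fun k hk => ?_
    have hk' : (fun j => L j (k j)) ∈ B := by
      rw [hBdef, Fintype.mem_piFinset]
      exact fun i => hL i _ (Fintype.mem_piFinset.mp hk i)
    rw [← hB.expect_add_right _ hk']
    simp [add_comm]
  rw [bias, this]
  refine (RCLike.norm_expect_le (K := ℂ)).trans (Finset.expect_le hB.nonempty fun k _ => ?_)
  simpa using norm_expect_shift_le ψ hK' 0 T L k

lemma bias_neg (K : Finset U) (T : MultilinearMap ℤ (fun _ : Fin m => U) F) :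
    bias ψ K (-T) = bias ψ K T := by
  unfold bias
  rw [← RCLike.norm_conj (K := ℂ) (𝔼 h ∈ Fintype.piFinset (fun _ : Fin m => K), ψ (T h))]
  congr 1
  simp only [Finset.expect_eq_sum_div_card, map_div₀, map_sum, map_natCast, neg_apply,
    AddChar.map_neg_eq_conj]

end Bias

section Differences

variable {F : Type*} [Field F] {U U' : Type*} [AddCommGroup U] [AddCommGroup U'] {m n : ℕ}

/-- The iterated difference of `R` along `k`. -/
def diffs (k : Fin m → U) (R : U → F) : U → F := (List.ofFn k).foldr Δop R

lemma diffs_cons (a : U) (k : Fin m → U) (R : U → F) :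
    diffs (Fin.cons a k) R = Δop a (diffs k R) := by
  simp [diffs, List.ofFn_succ]

lemma Δop_comm (a b : U) (R : U → F) : Δop a (Δop b R) = Δop b (Δop a R) := by
  ext u
  simp only [Δop, add_right_comm u a b]
  ring

instance : LeftCommutative (Δop : U → (U → F) → U → F) := ⟨Δop_comm⟩

lemma diffs_comp_perm (k : Fin m → U) (σ : Equiv.Perm (Fin m)) (R : U → F) :
    diffs (k ∘ σ) R = diffs k R :=
  (Equiv.Perm.ofFn_comp_perm σ k).foldr_eq R

lemma diffs_Δop (k : Fin m → U) (a : U) (R : U → F) :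
    diffs k (Δop a R) = Δop a (diffs k R) := by
  unfold diffs
  induction List.ofFn k with
  | nil => rfl
  | cons b l ih => rw [List.foldr_cons, ih, Δop_comm, List.foldr_cons]

/-- The iterated difference along `k` as an additive map. -/
def diffsHom (k : Fin m → U) : (U → F) →+ (U → F) :=
  AddMonoidHom.mk' (diffs k) fun R R' => by
    unfold diffs
    induction List.ofFn k with
    | nil => rfl
    | cons b l ih =>
      rw [List.foldr_cons, ih, List.foldr_cons, List.foldr_cons]
      ext u
      simp only [Δop, Pi.add_apply]
      ring

lemma diffsHom_apply (k : Fin m → U) (R : U → F) : diffsHom k R = diffs k R := rfl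

lemma diffs_comp (k : Fin m → U') (L : U' →+ U) (R : U → F) (u : U') :
    diffs k (fun x => R (L x)) u = diffs (fun i => L (k i)) R (L u) := by
  have : List.ofFn (fun i => L (k i)) = (List.ofFn k).map L := by
    simp [List.map_ofFn, Function.comp_def]
  unfold diffs
  rw [this]
  induction List.ofFn k generalizing u with
  | nil => rfl
  | cons b l ih => simp only [List.foldr_cons, List.map_cons, Δop, ih, map_add]

/-- `R` is a polynomial map of degree less than `n`. -/
def DegLT (n : ℕ) (R : U → F) : Prop := ∀ k : Fin n → U, ∀ u, diffs k R u = 0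

lemma degLT_succ_iff {R : U → F} : DegLT (n + 1) R ↔ ∀ a, DegLT n (Δop a R) := by
  constructor
  · intro h a k u
    rw [diffs_Δop, ← diffs_cons]
    exact h _ u
  · intro h k u
    rw [← Fin.cons_self_tail k, diffs_cons, ← diffs_Δop]
    exact h _ _ u

lemma DegLT.of_eq_zero : DegLT n (fun _ : U => (0 : F)) := fun k u =>
  congrFun (map_zero (diffsHom k)) u

lemma DegLT.succ {R : U → F} (h : DegLT n R) : DegLT (n + 1) R := by
  intro k u
  rw [← Fin.cons_self_tail k, diffs_cons, Δop, h, h, sub_zero]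

lemma DegLT.mono {R : U → F} (h : DegLT n R) (hmn : n ≤ m) : DegLT m R := by
  induction hmn with
  | refl => exact h
  | step _ ih => exact ih.succ

lemma DegLT.add {R R' : U → F} (h : DegLT n R) (h' : DegLT n R') :
    DegLT n (fun u => R u + R' u) := by
  intro k u
  have : diffs k (fun u => R u + R' u) = diffs k R + diffs k R' := map_add (diffsHom k) R R'
  rw [this, Pi.add_apply, h, h', add_zero]

lemma DegLT.neg {R : U → F} (h : DegLT n R) : DegLT n (fun u => -R u) := by
  intro k u
  have : diffs k (fun u => -R u) = -diffs k R := map_neg (diffsHom k) R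
  rw [this, Pi.neg_apply, h, neg_zero]

lemma DegLT.sub {R R' : U → F} (h : DegLT n R) (h' : DegLT n R') :
    DegLT n (fun u => R u - R' u) := by
  simpa only [sub_eq_add_neg] using h.add h'.neg

lemma DegLT.sum {ι : Type*} {s : Finset ι} {R : ι → U → F} (h : ∀ i ∈ s, DegLT n (R i)) :
    DegLT n (fun u => ∑ i ∈ s, R i u) := by
  classical
  induction s using Finset.induction_on with
  | empty => simpa using DegLT.of_eq_zero
  | insert i s hi ih =>
    simp only [Finset.sum_insert hi]
    exact (h i (by simp)).add (ih fun j hj => h j (by simp [hj]))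

lemma DegLT.comp {R : U → F} (h : DegLT n R) (L : U' →+ U) : DegLT n (fun x => R (L x)) :=
  fun k u => by rw [diffs_comp, h]

lemma DegLT.diffs_eq {R : U → F} (h : DegLT (m + 1) R) (k : Fin m → U) (u : U) :
    diffs k R u = diffs k R 0 := by
  have := h (Fin.cons u k) 0
  rw [diffs_cons, Δop, zero_add, sub_eq_zero] at this
  exact this

lemma diffs_update (k : Fin (m + 1) → U) (i : Fin (m + 1)) (a : U) (R : U → F) :
    diffs (Function.update k i a) R = Δop a (diffs (Fin.tail (k ∘ Equiv.swap 0 i)) R) := by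
  rw [← diffs_comp_perm _ (Equiv.swap 0 i), ← diffs_cons]
  congr 1
  rw [Function.update_comp_equiv]
  simp only [Equiv.symm_swap, Equiv.swap_apply_right]
  rw [← Fin.cons_self_tail (Function.update _ _ _)]
  simp

/-- The leading form of a polynomial map of degree at most `m`. -/
def leading (R : U → F) (h : DegLT (m + 1) R) : MultilinearMap ℤ (fun _ : Fin m => U) F :=
  have hadd : ∀ (k : Fin m → U) (i : Fin m) (a b : U),
      diffs (Function.update k i (a + b)) R 0 =
        diffs (Function.update k i a) R 0 + diffs (Function.update k i b) R 0 := by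
    intro k i a b
    cases m with
    | zero => exact i.elim0
    | succ m =>
      simp only [diffs_update]
      set D := diffs (Fin.tail (k ∘ Equiv.swap 0 i)) R with hD
      have h1 := h.diffs_eq (Function.update k i b) a
      simp only [diffs_update, ← hD, Δop, zero_add] at h1 ⊢
      linear_combination h1
  { toFun := fun k => diffs k R 0
    map_update_add' := by
      intro inst k i a b
      have : inst = instDecidableEqFin m := Subsingleton.elim _ _
      subst this
      exact hadd k i a b
    map_update_smul' := by
      intro inst k i c a
      have : inst = instDecidableEqFin m := Subsingleton.elim _ _
      subst this
      exact map_zsmul (AddMonoidHom.mk' (fun a => diffs (Function.update k i a) R 0)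
        (hadd k i)) c a }

lemma leading_apply {R : U → F} (h : DegLT (m + 1) R) (k : Fin m → U) (u : U) :
    leading R h k = diffs k R u := (h.diffs_eq k u).symm

lemma leading_comp {R : U → F} (h : DegLT (m + 1) R) (L : U' →+ U) :
    leading (fun x => R (L x)) (h.comp L) =
      (leading R h).compLinearMap (fun _ => L.toIntLinearMap) := by
  ext k
  rw [leading_apply _ _ 0, diffs_comp, MultilinearMap.compLinearMap_apply, leading_apply h _ (L 0)]
  rfl

lemma leading_sub {R R' : U → F} (h : DegLT (m + 1) R) (h' : DegLT (m + 1) R') :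
    leading (fun x => R x - R' x) (h.sub h') = leading R h - leading R' h' := by
  ext k
  rw [leading_apply _ _ 0, sub_apply, leading_apply h _ 0, leading_apply h' _ 0]
  exact congrFun (map_sub (diffsHom k) R R') 0

lemma leading_diag {R : U → F} (h : DegLT (m + 1) R) (u : U) :
    leading R h (fun _ => u) =
      ∑ s ∈ Finset.range (m + 1), ((-1 : ℤ) ^ (m - s) * m.choose s) • R (s • u) := by
  have : diffs (fun _ : Fin m => u) R = (fwdDiff u)^[m] R := by
    unfold diffs
    rw [List.ofFn_const]
    clear h
    induction m with
    | zero => rfl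
    | succ m ih => rw [List.replicate_succ, List.foldr_cons, ih, Function.iterate_succ_apply']; rfl
  rw [leading_apply h _ 0, this, fwdDiff_iter_eq_sum_shift]
  simp

/-- Up to lower degree, a polynomial map is a multiple of its leading form on the diagonal. -/
lemma degLT_sub_leading {R : U → F} (h : DegLT (m + 1) R) {c : ℤ}
    (hc : (c : F) * (m.factorial : F) = 1) :
    DegLT m (fun u => R u - (c • leading R h) (fun _ => u)) := by
  intro k v
  have hdiag : (fun u => (c • leading R h) (fun _ => u)) =
      c • ∑ s ∈ Finset.range (m + 1), ((-1 : ℤ) ^ (m - s) * m.choose s) •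
        (fun u => R (nsmulAddMonoidHom s u)) := by
    ext u
    simp [leading_diag]
  have hs : ∀ s : ℕ, diffs k (fun u => R (nsmulAddMonoidHom s u)) v =
      ((s : ℤ) ^ m) • leading R h k := by
    intro s
    rw [diffs_comp, ← leading_apply h]
    have := (leading R h).map_smul_univ (fun _ => (s : ℤ)) k
    simpa using this
  have hfac : ∑ s ∈ Finset.range (m + 1), ((-1 : ℤ) ^ (m - s) * m.choose s) * (s : ℤ) ^ m =
      m.factorial := by
    have h1 := congrFun (fwdDiff_iter_eq_factorial (R := ℤ) (n := m)) 0
    rw [fwdDiff_iter_eq_sum_shift] at h1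
    simpa using h1
  have hsub : diffs k (fun u => R u - (c • leading R h) (fun _ => u)) =
      diffs k R - diffs k (fun u => (c • leading R h) (fun _ => u)) :=
    map_sub (diffsHom k) R _
  rw [hsub, Pi.sub_apply, hdiag, ← diffsHom_apply, ← diffsHom_apply, map_zsmul, map_sum]
  simp only [map_zsmul, diffsHom_apply, Pi.smul_apply, Finset.sum_apply, hs, smul_smul]
  rw [← Finset.sum_smul, hfac, ← leading_apply h, zsmul_eq_mul]
  rw [zsmul_eq_mul, Int.cast_natCast]
  linear_combination (-leading R h k) * hc

lemma degLT_piecewise (T : MultilinearMap ℤ (fun _ : Fin m => U) F) (a : U' →+ (Fin m → U))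
    (n : ℕ) (s : Finset (Fin m)) (hs : s.card < n) (k : Fin m → U) :
    DegLT n (fun u => T (s.piecewise (a u) k)) := by
  induction n generalizing s k with
  | zero => simp at hs
  | succ n ih =>
    rw [degLT_succ_iff]
    intro h
    have : Δop h (fun u => T (s.piecewise (a u) k)) = fun u =>
        ∑ t ∈ s.ssubsets, T (t.piecewise (a u) (s.piecewise (a h) k)) := by
      ext u
      have h1 := T.map_piecewise_add (a u) (s.piecewise (a h) k) s
      have h2 : s.piecewise (a u + s.piecewise (a h) k) (s.piecewise (a h) k) =
          s.piecewise (a (u + h)) k := by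
        ext i
        by_cases hi : i ∈ s <;> simp [hi]
      have h3 : s.piecewise (a u) (s.piecewise (a h) k) = s.piecewise (a u) k := by
        ext i
        by_cases hi : i ∈ s <;> simp [hi]
      rw [h2, ← Finset.insert_erase (Finset.mem_powerset_self s), Finset.sum_insert (by simp), h3]
        at h1
      simp only [Δop, h1, Finset.ssubsets]
      ring
    rw [this]
    refine DegLT.sum fun t ht => ih t ?_ _
    have := Finset.card_lt_card (Finset.mem_ssubsets.mp ht)
    omega

lemma degLT_sub_shift (T : MultilinearMap ℤ (fun _ : Fin m => U) F) (a : U' →+ (Fin m → U))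
    (k : Fin m → U) : DegLT m (fun u => T (a u) - T (a u + k)) := by
  have : (fun u => T (a u) - T (a u + k)) = fun u =>
      -∑ s ∈ (Finset.univ : Finset (Finset (Fin m))).erase Finset.univ,
        T (s.piecewise (a u) k) := by
    ext u
    rw [T.map_add_univ, ← Finset.add_sum_erase _ _ (Finset.mem_univ Finset.univ)]
    simp
  rw [this]
  refine (DegLT.sum fun s hs => degLT_piecewise T a m s ?_ k).neg
  have := Finset.card_lt_card (Finset.ssubset_univ_iff.mpr (Finset.ne_of_mem_erase hs))
  simpa using this

end Differences

lemma expect_piFinset_succ {U M : Type*} [AddCommMonoid M] [Module ℚ≥0 M] (m : ℕ) (K : Finset U)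
    (f : (Fin (m + 1) → U) → M) :
    𝔼 k ∈ Fintype.piFinset (fun _ : Fin (m + 1) => K), f k =
      𝔼 a ∈ K, 𝔼 k ∈ Fintype.piFinset (fun _ : Fin m => K), f (Fin.cons a k) := by
  rw [← Finset.expect_product' K _ (fun a k => f (Fin.cons a k))]
  refine (Finset.expect_equiv (Fin.consEquiv fun _ : Fin (m + 1) => U) (fun i => ?_)
    (fun _ _ => rfl)).symm
  simp [Fin.consEquiv, Fintype.mem_piFinset, Fin.forall_fin_succ]

section VanDerCorput

variable {F : Type*} [Field F] [Fintype F] (ψ : AddChar F ℂ) {U : Type*} [AddCommGroup U]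

lemma norm_expect_sq_eq {K : Finset U} (hK : IsFinSub K) (R : U → F) :
    ((‖𝔼 u ∈ K, ψ (R u)‖ ^ 2 : ℝ) : ℂ) = 𝔼 a ∈ K, 𝔼 u ∈ K, ψ (Δop a R u) := by
  have : ((‖𝔼 u ∈ K, ψ (R u)‖ ^ 2 : ℝ) : ℂ) =
      (𝔼 u ∈ K, ψ (R u)) * conj (𝔼 u ∈ K, ψ (R u)) := by
    rw [Complex.mul_conj, Complex.normSq_eq_norm_sq]
  have hc : conj (𝔼 u ∈ K, ψ (R u)) = 𝔼 u ∈ K, ψ (-R u) := by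
    simp only [Finset.expect_eq_sum_div_card, map_div₀, map_sum, map_natCast,
      AddChar.map_neg_eq_conj]
  rw [this, hc, Finset.expect_mul_expect, Finset.expect_comm]
  conv_rhs => rw [Finset.expect_comm]
  refine Finset.expect_congr rfl fun u hu => ?_
  rw [← hK.expect_add_right _ hu]
  refine Finset.expect_congr rfl fun a _ => ?_
  rw [← AddChar.map_add_eq_mul, Δop, sub_eq_add_neg, add_comm a u]

lemma norm_expect_pow_le {K : Finset U} (hK : IsFinSub K) (m : ℕ) (R : U → F) :
    ‖𝔼 u ∈ K, ψ (R u)‖ ^ 2 ^ (m + 1) ≤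
      (𝔼 k ∈ Fintype.piFinset (fun _ : Fin (m + 1) => K), 𝔼 u ∈ K, ψ (diffs k R u)).re := by
  have hre : ∀ f : U → ℂ, (𝔼 a ∈ K, f a).re = 𝔼 a ∈ K, (f a).re := by
    intro f
    simp [Finset.expect_eq_sum_div_card, ← Complex.ofReal_natCast, Complex.div_ofReal_re]
  induction m generalizing R with
  | zero =>
    have h1 := congrArg Complex.re (norm_expect_sq_eq ψ hK R)
    rw [Complex.ofReal_re] at h1
    rw [expect_piFinset_succ]
    simp only [Fintype.piFinset_of_isEmpty, Finset.univ_unique, Finset.expect_singleton, diffs_cons]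
    simpa [diffs] using h1.le
  | succ m ih =>
    rw [expect_piFinset_succ, hre, pow_succ, mul_comm, pow_mul]
    have h1 : ‖𝔼 u ∈ K, ψ (R u)‖ ^ 2 ≤ 𝔼 a ∈ K, ‖𝔼 u ∈ K, ψ (Δop a R u)‖ := by
      have h2 := congrArg norm (norm_expect_sq_eq ψ hK R)
      rw [Complex.norm_real, Real.norm_of_nonneg (sq_nonneg _)] at h2
      rw [h2]
      exact RCLike.norm_expect_le (K := ℂ)
    calc _ ≤ (𝔼 a ∈ K, ‖𝔼 u ∈ K, ψ (Δop a R u)‖) ^ 2 ^ (m + 1) := by gcongr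
      _ ≤ 𝔼 a ∈ K, ‖𝔼 u ∈ K, ψ (Δop a R u)‖ ^ 2 ^ (m + 1) :=
          expect_pow_le _ _ (fun _ _ => norm_nonneg _) _
      _ ≤ _ := Finset.expect_le_expect fun a _ => by
          refine (ih (Δop a R)).trans_eq ?_
          simp only [diffs_cons, diffs_Δop]

lemma norm_expect_pow_le_bias {K : Finset U} (hK : IsFinSub K) {m : ℕ} (hm : m ≠ 0) {R : U → F}
    (h : DegLT (m + 1) R) : ‖𝔼 u ∈ K, ψ (R u)‖ ^ 2 ^ m ≤ bias ψ K (leading R h) := by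
  obtain ⟨m, rfl⟩ := Nat.exists_eq_succ_of_ne_zero hm
  refine (norm_expect_pow_le ψ hK m R).trans ((Complex.re_le_norm _).trans_eq ?_)
  rw [bias]
  congr 1
  refine Finset.expect_congr rfl fun k _ => ?_
  rw [Finset.expect_congr rfl fun u _ => by rw [← leading_apply h k u],
    Finset.expect_const hK.nonempty]

end VanDerCorput

/-- An increasing sequence of finite subgroups. -/
structure Filtr (U : Type*) [AddCommGroup U] where
  /-- The `n`-th finite subgroup. -/
  carrier : ℕ → Finset U
  isFinSub : ∀ n, IsFinSub (carrier n)
  mono : Monotone carrier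

namespace Filtr

variable {U U' : Type*} [AddCommGroup U] [AddCommGroup U']

instance : CoeFun (Filtr U) (fun _ => ℕ → Finset U) := ⟨carrier⟩

/-- The product filtration. -/
def prod (𝓤 : Filtr U) (𝓤' : Filtr U') : Filtr (U × U') where
  carrier n := 𝓤 n ×ˢ 𝓤' n
  isFinSub n := (𝓤.isFinSub n).prod (𝓤'.isFinSub n)
  mono _ _ h := Finset.product_subset_product (𝓤.mono h) (𝓤'.mono h)

/-- The power filtration. -/
def pi (𝓤 : Filtr U) (m : ℕ) : Filtr (Fin m → U) where
  carrier n := Fintype.piFinset fun _ => 𝓤 n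
  isFinSub n := (𝓤.isFinSub n).pi m
  mono _ _ h := Fintype.piFinset_subset _ _ fun _ => 𝓤.mono h

end Filtr

section Biased

variable {F : Type*} [Field F] (ψ : AddChar F ℂ)
variable {U U' : Type*} [AddCommGroup U] [AddCommGroup U'] {m : ℕ}

/-- The form `T` has bias bounded below along the filtration. -/
def Biased (𝓤 : Filtr U) (T : MultilinearMap ℤ (fun _ : Fin m => U) F) : Prop :=
  ∃ δ : ℝ, 0 < δ ∧ ∀ n, δ ≤ bias ψ (𝓤 n) T

lemma Biased.zero (𝓤 : Filtr U) :
    Biased ψ 𝓤 (0 : MultilinearMap ℤ (fun _ : Fin m => U) F) := by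
  refine ⟨1, one_pos, fun n => ?_⟩
  simp [bias, Finset.expect_const ((𝓤.isFinSub n).pi m).nonempty]

variable [Fintype F] {ψ} {𝓤 : Filtr U} {T T' : MultilinearMap ℤ (fun _ : Fin m => U) F}

lemma Biased.add (h : Biased ψ 𝓤 T) (h' : Biased ψ 𝓤 T') : Biased ψ 𝓤 (T + T') := by
  obtain ⟨δ, hδ, h⟩ := h
  obtain ⟨δ', hδ', h'⟩ := h'
  exact ⟨δ * δ', mul_pos hδ hδ', fun n =>
    (mul_le_mul (h n) (h' n) hδ'.le (bias_nonneg ψ _ _)).trans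
      (bias_mul_bias_le ψ (𝓤.isFinSub n) T T')⟩

lemma Biased.neg (h : Biased ψ 𝓤 T) : Biased ψ 𝓤 (-T) := by
  obtain ⟨δ, hδ, h⟩ := h
  exact ⟨δ, hδ, fun n => (h n).trans_eq (bias_neg ψ _ T).symm⟩

variable (ψ 𝓤) in
/-- The subgroup of biased forms. -/
def biasedSubgroup : AddSubgroup (MultilinearMap ℤ (fun _ : Fin m => U) F) where
  carrier := {T | Biased ψ 𝓤 T}
  zero_mem' := Biased.zero ψ 𝓤
  add_mem' := Biased.add
  neg_mem' := Biased.neg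

lemma mem_biasedSubgroup : T ∈ biasedSubgroup ψ 𝓤 ↔ Biased ψ 𝓤 T := Iff.rfl

lemma Biased.compLinearMap (h : Biased ψ 𝓤 T) {𝓤' : Filtr U'} (L : Fin m → U' →ₗ[ℤ] U)
    (d : ℕ) (hL : ∀ i n, ∀ x ∈ 𝓤' n, L i x ∈ 𝓤 (n + d)) : Biased ψ 𝓤' (T.compLinearMap L) := by
  obtain ⟨δ, hδ, h⟩ := h
  exact ⟨δ, hδ, fun n => (h (n + d)).trans (bias_le_bias_compLinearMap ψ (𝓤.isFinSub _)
    (𝓤'.isFinSub n) T L (fun i => hL i n))⟩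

variable (ψ 𝓤 T) in
lemma bias_antitone : Antitone fun n => bias ψ (𝓤 n) T := fun _ _ hij =>
  bias_le_bias_compLinearMap ψ (𝓤.isFinSub _) (𝓤.isFinSub _) T (fun _ => LinearMap.id)
    (fun _ _ hx => 𝓤.mono hij hx)

lemma tendsto_bias_of_not_biased (h : ¬ Biased ψ 𝓤 T) :
    Tendsto (fun n => bias ψ (𝓤 n) T) atTop (nhds 0) := by
  rw [Metric.tendsto_atTop]
  intro ε hε
  simp only [Biased, not_exists, not_and, not_forall, not_le] at h
  obtain ⟨n, hn⟩ := h ε hε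
  refine ⟨n, fun k hk => ?_⟩
  rw [Real.dist_eq, sub_zero, abs_of_nonneg (bias_nonneg ψ _ _)]
  exact (bias_antitone ψ 𝓤 T hk).trans_lt hn

lemma tendsto_expect_of_not_biased (hm : m ≠ 0) {R : U → F} (h : DegLT (m + 1) R)
    (hb : ¬ Biased ψ 𝓤 (leading R h)) :
    Tendsto (fun n => ‖𝔼 u ∈ 𝓤 n, ψ (R u)‖) atTop (nhds 0) := by
  have h1 : Tendsto (fun n => ‖𝔼 u ∈ 𝓤 n, ψ (R u)‖ ^ 2 ^ m) atTop (nhds 0) :=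
    squeeze_zero (fun _ => by positivity)
      (fun n => norm_expect_pow_le_bias ψ (𝓤.isFinSub n) hm h) (tendsto_bias_of_not_biased hb)
  rw [Metric.tendsto_atTop] at h1 ⊢
  intro ε hε
  obtain ⟨N, hN⟩ := h1 (ε ^ 2 ^ m) (by positivity)
  refine ⟨N, fun n hn => ?_⟩
  have := hN n hn
  rw [Real.dist_eq, sub_zero, abs_of_nonneg (by positivity)] at this ⊢
  exact lt_of_pow_lt_pow_left₀ _ hε.le this

lemma expect_norm_sub_sq {ι : Type*} {s : Finset ι} (hs : s.Nonempty) (f : ι → ℂ) :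
    𝔼 i ∈ s, ‖f i - 𝔼 j ∈ s, f j‖ ^ 2 = 𝔼 i ∈ s, ‖f i‖ ^ 2 - ‖𝔼 j ∈ s, f j‖ ^ 2 := by
  set B := 𝔼 j ∈ s, f j with hB
  have h1 : ∀ i, ‖f i - B‖ ^ 2 = ‖f i‖ ^ 2 + ‖B‖ ^ 2 - 2 * (f i * conj B).re := by
    intro i
    simp only [← Complex.normSq_eq_norm_sq, Complex.normSq_sub]
  have h2 : 𝔼 i ∈ s, (f i * conj B).re = ‖B‖ ^ 2 := by
    have : (𝔼 i ∈ s, f i * conj B).re = ‖B‖ ^ 2 := by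
      rw [← Finset.expect_mul, ← hB, Complex.mul_conj, Complex.normSq_eq_norm_sq, Complex.ofReal_re]
    rw [← this]
    simp [Finset.expect_eq_sum_div_card, ← Complex.ofReal_natCast, Complex.div_ofReal_re]
  simp only [h1, Finset.expect_sub_distrib, Finset.expect_add_distrib, ← Finset.mul_expect, h2,
    Finset.expect_const hs]
  ring

/-- A biased phase can be replaced by its multiplicative derivatives. -/
lemma tendsto_expect_of_biased {X : Type*} [AddCommGroup X] (𝓧 : Filtr X) (hT : Biased ψ 𝓤 T)
    (φ : X → Fin m → U)
    (hφ : ∀ n, ∀ f : (Fin m → U) → ℝ, 𝔼 x ∈ 𝓧 n, f (φ x) = 𝔼 k ∈ 𝓤.pi m n, f k)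
    (b : X → ℂ) (hb : ∀ x, ‖b x‖ ≤ 1)
    (h : ∀ k, Tendsto (fun n => 𝔼 x ∈ 𝓧 n, b x * ψ (T (φ x) - T (φ x + k))) atTop (nhds 0)) :
    Tendsto (fun n => 𝔼 x ∈ 𝓧 n, b x * ψ (T (φ x))) atTop (nhds 0) := by
  obtain ⟨δ, hδ, hT⟩ := hT
  have hlim : ∃ l, Tendsto (fun n => bias ψ (𝓤 n) T ^ 2) atTop (nhds l) :=
    ⟨_, (tendsto_atTop_ciInf (bias_antitone ψ 𝓤 T) ⟨0, by
      rintro _ ⟨n, rfl⟩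
      exact bias_nonneg ψ _ _⟩).pow 2⟩
  obtain ⟨l, hl⟩ := hlim
  rw [Metric.tendsto_atTop]
  intro ε hε
  obtain ⟨n, hn⟩ := (Metric.tendsto_atTop.mp hl) ((δ * ε / 2) ^ 2 / 2) (by positivity)
  let fn : (Fin m → U) → ℂ := fun x => 𝔼 k ∈ 𝓤.pi m n, ψ (T (x + k))
  have hfn : ∀ x, ‖fn x‖ ≤ bias ψ (𝓤 n) T := by
    intro x
    have := norm_expect_shift_le ψ (𝓤.isFinSub n) 0 T (fun _ => LinearMap.id) x
    simpa [fn, Filtr.pi, add_comm] using this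
  have hfirst : Tendsto (fun N => 𝔼 x ∈ 𝓧 N, b x * ψ (T (φ x)) * conj (fn (φ x))) atTop
      (nhds 0) := by
    have h1 : (fun N => 𝔼 x ∈ 𝓧 N, b x * ψ (T (φ x)) * conj (fn (φ x))) = fun N =>
        𝔼 k ∈ 𝓤.pi m n, 𝔼 x ∈ 𝓧 N, b x * ψ (T (φ x) - T (φ x + k)) := by
      ext N
      rw [Finset.expect_comm]
      refine Finset.expect_congr rfl fun x _ => ?_
      have : conj (fn (φ x)) = 𝔼 k ∈ 𝓤.pi m n, ψ (-T (φ x + k)) := by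
        simp only [fn, Finset.expect_eq_sum_div_card, map_div₀, map_sum, map_natCast,
          AddChar.map_neg_eq_conj]
      rw [this, Finset.mul_expect]
      refine Finset.expect_congr rfl fun k _ => ?_
      rw [mul_assoc, ← AddChar.map_add_eq_mul, sub_eq_add_neg]
    rw [h1]
    have := (tendsto_finsetSum (𝓤.pi m n) fun k _ => h k).div_const (((𝓤.pi m n).card : ℕ) : ℂ)
    simpa [Finset.expect_eq_sum_div_card (s := 𝓤.pi m n)] using this
  obtain ⟨N₀, hN₀⟩ := (Metric.tendsto_atTop.mp hfirst) (δ * ε / 2) (by positivity)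
  refine ⟨max n N₀, fun N hN => ?_⟩
  have hNn : n ≤ N := (le_max_left _ _).trans hN
  rw [dist_zero_right]
  have hfirstN := hN₀ N ((le_max_right _ _).trans hN)
  rw [dist_zero_right] at hfirstN
  set B := 𝔼 k ∈ 𝓤.pi m N, ψ (T k) with hB
  have hBnorm : ‖B‖ = bias ψ (𝓤 N) T := rfl
  have hfnB : 𝔼 x ∈ 𝓤.pi m N, fn x = B := by
    rw [Finset.expect_comm, ← Finset.expect_const ((𝓤.pi m).isFinSub n).nonempty B]
    exact Finset.expect_congr rfl fun k hk =>
      ((𝓤.pi m).isFinSub N).expect_add_right (fun x => ψ (T x)) ((𝓤.pi m).mono hNn hk)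
  have hvar : 𝔼 x ∈ 𝓤.pi m N, ‖fn x - B‖ ^ 2 ≤ (δ * ε / 2) ^ 2 := by
    have h1 := expect_norm_sub_sq ((𝓤.pi m).isFinSub N).nonempty fn
    rw [hfnB] at h1
    rw [h1, hBnorm]
    have h2 : 𝔼 x ∈ 𝓤.pi m N, ‖fn x‖ ^ 2 ≤ bias ψ (𝓤 n) T ^ 2 :=
      Finset.expect_le ((𝓤.pi m).isFinSub N).nonempty fun x _ => by gcongr; exact hfn x
    have h3 := hn n le_rfl
    have h4 := hn N hNn
    rw [Real.dist_eq, abs_lt] at h3 h4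
    linarith
  have hsecond : ‖𝔼 x ∈ 𝓧 N, b x * ψ (T (φ x)) * conj (B - fn (φ x))‖ ≤ δ * ε / 2 := by
    refine (sq_le_sq₀ (norm_nonneg _) (by positivity)).mp ?_
    refine (norm_expect_sq_le _ _).trans (le_trans ?_ hvar)
    rw [← hφ N (fun x => ‖fn x - B‖ ^ 2)]
    refine Finset.expect_le_expect fun x _ => ?_
    gcongr
    rw [norm_mul, norm_mul, AddChar.norm_apply, mul_one, RCLike.norm_conj, norm_sub_rev]
    exact mul_le_of_le_one_left (norm_nonneg _) (hb x)
  have hsplit : (𝔼 x ∈ 𝓧 N, b x * ψ (T (φ x))) * conj B =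
      𝔼 x ∈ 𝓧 N, b x * ψ (T (φ x)) * conj (fn (φ x)) +
      𝔼 x ∈ 𝓧 N, b x * ψ (T (φ x)) * conj (B - fn (φ x)) := by
    rw [Finset.expect_mul, ← Finset.expect_add_distrib]
    refine Finset.expect_congr rfl fun x _ => ?_
    rw [map_sub]
    ring
  have h1 := congrArg norm hsplit
  rw [norm_mul, RCLike.norm_conj, hBnorm] at h1
  have h2 : ‖𝔼 x ∈ 𝓧 N, b x * ψ (T (φ x))‖ * δ < ε * δ := by
    calc _ ≤ ‖𝔼 x ∈ 𝓧 N, b x * ψ (T (φ x))‖ * bias ψ (𝓤 N) T := by gcongr; exact hT N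
      _ < δ * ε / 2 + δ * ε / 2 := by
        rw [h1]
        exact (norm_add_le _ _).trans_lt (by linarith)
      _ = ε * δ := by ring
  exact lt_of_mul_lt_mul_right h2 hδ.le

end Biased

section PolyBall

variable {F : Type*} [Field F]

lemma coeff_polyOf {n : ℕ} (c : Fin n → F) (i : Fin n) : (polyOf c).coeff i = c i := by
  simp [polyOf, Polynomial.finsetSum_coeff, Fin.val_inj]

lemma polyOf_injective (n : ℕ) : Function.Injective (polyOf : (Fin n → F) → F[X]) := by
  intro c c' h
  ext i
  rw [← coeff_polyOf c, h, coeff_polyOf]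

lemma degree_polyOf_lt {n : ℕ} (c : Fin n → F) : (polyOf c).degree < n := by
  refine (Polynomial.degree_lt_iff_coeff_zero _ _).mpr fun k hk => ?_
  simp only [polyOf, Polynomial.finsetSum_coeff, Polynomial.coeff_C_mul_X_pow]
  exact Finset.sum_eq_zero fun i _ => if_neg (by omega)

variable (F) [Fintype F]

open Classical in
/-- The polynomials of degree less than `n`. -/
noncomputable def polyBall (n : ℕ) : Finset F[X] := (Finset.univ : Finset (Fin n → F)).image polyOf

variable {F}

lemma mem_polyBall {n : ℕ} {g : F[X]} : g ∈ polyBall F n ↔ g.degree < n := by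
  classical
  simp only [polyBall, Finset.mem_image, Finset.mem_univ, true_and]
  constructor
  · rintro ⟨c, rfl⟩
    exact degree_polyOf_lt c
  · intro h
    refine ⟨fun i => g.coeff i, ?_⟩
    ext k
    by_cases hk : k < n
    · exact coeff_polyOf _ ⟨k, hk⟩
    · rw [Polynomial.coeff_eq_zero_of_degree_lt (h.trans_le (by exact_mod_cast not_lt.mp hk)),
        Polynomial.coeff_eq_zero_of_degree_lt
          ((degree_polyOf_lt _).trans_le (by exact_mod_cast not_lt.mp hk))]

lemma card_polyBall (n : ℕ) : (polyBall F n).card = Fintype.card F ^ n := by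
  classical
  rw [polyBall, Finset.card_image_of_injective _ (polyOf_injective n)]
  simp

lemma sum_polyOf {M : Type*} [AddCommMonoid M] (n : ℕ) (f : F[X] → M) :
    ∑ c : Fin n → F, f (polyOf c) = ∑ g ∈ polyBall F n, f g := by
  classical
  rw [polyBall, Finset.sum_image (fun _ _ _ _ h => polyOf_injective n h)]

lemma isFinSub_polyBall (n : ℕ) : IsFinSub (polyBall F n) :=
  ⟨by simp [mem_polyBall], fun a ha b hb => by
    rw [mem_polyBall] at *
    exact (Polynomial.degree_sub_le a b).trans_lt (max_lt ha hb)⟩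

lemma polyBall_mono : Monotone (polyBall F) := fun _ _ h g hg => by
  rw [mem_polyBall] at *
  exact hg.trans_le (by exact_mod_cast h)

variable (F) in
/-- The filtration of polynomials by degree. -/
noncomputable def polyFiltr : Filtr F[X] := ⟨polyBall F, isFinSub_polyBall, polyBall_mono⟩

lemma mem_polyFiltr {n : ℕ} {g : F[X]} : g ∈ polyFiltr F n ↔ g.degree < n := mem_polyBall

lemma mul_mem_polyBall {p g : F[X]} (hp : p.Monic) {n : ℕ} :
    p * g ∈ polyBall F (n + p.natDegree) ↔ g ∈ polyBall F n := by
  rw [mem_polyBall, mem_polyBall]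
  rcases eq_or_ne g 0 with rfl | hg
  · simp
  rw [Polynomial.degree_eq_natDegree (mul_ne_zero hp.ne_zero hg),
    Polynomial.degree_eq_natDegree hg, hp.natDegree_mul' hg]
  norm_cast
  omega

open Classical in
lemma expect_dvd {𝕜 : Type*} [RCLike 𝕜] {p : F[X]} (hp : p.Monic) (n : ℕ) (f : F[X] → 𝕜) :
    𝔼 g ∈ polyBall F (n + p.natDegree), (if p ∣ g then f g else 0) =
      ((Fintype.card F : 𝕜) ^ p.natDegree)⁻¹ * 𝔼 g ∈ polyBall F n, f (p * g) := by
  have himg : (polyBall F (n + p.natDegree)).filter (p ∣ ·) = (polyBall F n).image (p * ·) := by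
    ext g
    simp only [Finset.mem_filter, Finset.mem_image]
    constructor
    · rintro ⟨h, k, rfl⟩
      exact ⟨k, (mul_mem_polyBall hp).mp h, rfl⟩
    · rintro ⟨k, hk, rfl⟩
      exact ⟨(mul_mem_polyBall hp).mpr hk, dvd_mul_right _ _⟩
  have hq : (Fintype.card F : 𝕜) ≠ 0 := by simp
  rw [Finset.expect_eq_sum_div_card, Finset.expect_eq_sum_div_card, ← Finset.sum_filter, himg,
    Finset.sum_image (fun _ _ _ _ h => mul_left_cancel₀ hp.ne_zero h), card_polyBall, card_polyBall]
  push_cast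
  rw [pow_add]
  field_simp

open Classical in
lemma expect_ind {p : F[X]} (hp : p.Monic) {n : ℕ} (hn : p.natDegree ≤ n) :
    𝔼 g ∈ polyBall F n, (if p ∣ g then (1 : ℝ) else 0) =
      ((Fintype.card F : ℝ) ^ p.natDegree)⁻¹ := by
  obtain ⟨k, rfl⟩ := Nat.exists_eq_add_of_le' hn
  rw [expect_dvd hp, Finset.expect_const (isFinSub_polyBall k).nonempty, mul_one]

end PolyBall

section Slots

variable {F : Type*} [Field F] {U : Type*} [AddCommGroup U] {m : ℕ}

lemma expect_update {M : Type*} [AddCommMonoid M] [Module ℚ≥0 M] {K : Finset U} (hK : IsFinSub K)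
    (i : Fin m) (f : (Fin m → U) → M) :
    𝔼 h ∈ Fintype.piFinset (fun _ : Fin m => K), f h =
      𝔼 h ∈ Fintype.piFinset (fun _ : Fin m => K), 𝔼 a ∈ K, f (Function.update h i a) := by
  set B := Fintype.piFinset (fun _ : Fin m => K) with hB
  have h1 : ∀ a ∈ K, 𝔼 h ∈ B, f (h + Pi.single i a) = 𝔼 h ∈ B, f h := fun a ha =>
    (hK.pi m).expect_add_right f (Fintype.mem_piFinset.mpr fun j => by
      rcases eq_or_ne j i with rfl | hj <;> simp [*, hK.zero_mem])
  rw [← Finset.expect_const hK.nonempty (𝔼 h ∈ B, f h), ← Finset.expect_congr rfl h1,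
    Finset.expect_comm]
  refine Finset.expect_congr rfl fun h hh => ?_
  conv_rhs => rw [← hK.expect_add_right _ (Fintype.mem_piFinset.mp hh i)]
  refine Finset.expect_congr rfl fun a _ => ?_
  congr 1
  ext j
  rcases eq_or_ne j i with rfl | hj <;> simp [*, add_comm]

lemma compLinearMap_update_apply (T : MultilinearMap ℤ (fun _ : Fin m => U) F) (i : Fin m)
    (L : U →ₗ[ℤ] U) (h : Fin m → U) :
    T.compLinearMap (Function.update (fun _ => LinearMap.id) i L) h =
      T (Function.update h i (L (h i))) := by
  rw [MultilinearMap.compLinearMap_apply]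
  congr 1
  ext j
  rcases eq_or_ne j i with rfl | hj <;> simp [*]

variable (ψ : AddChar F ℂ)

/-- A form which vanishes when the `i`-th argument lies in a set of density `ε` has bias
at least `ε`. -/
lemma le_bias_of_vanish {K : Finset U} (hK : IsFinSub K)
    (T : MultilinearMap ℤ (fun _ : Fin m => U) F) {i j : Fin m} (hij : i ≠ j)
    (S : U → Prop) [DecidablePred S] (hS : ∀ h, S (h i) → T h = 0) :
    𝔼 a ∈ K, (if S a then (1 : ℝ) else 0) ≤ bias ψ K T := by
  have h1 : ∀ h, ∃ v : ℝ, (𝔼 a ∈ K, ψ (T (Function.update h j a))) = v ∧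
      (if S (h i) then (1 : ℝ) else 0) ≤ v := by
    intro h
    by_cases hSh : S (h i)
    · refine ⟨1, ?_, by simp [hSh]⟩
      rw [Finset.expect_congr rfl (g := fun _ => (1 : ℂ)) fun a _ => ?_,
        Finset.expect_const hK.nonempty, Complex.ofReal_one]
      rw [hS _ (by simpa [hij] using hSh), AddChar.map_zero_eq_one]
    · simp only [hSh, if_false]
      rcases hK.expect_char (fun a => ψ (T (Function.update h j a))) (fun a b => by
        rw [MultilinearMap.map_update_add, AddChar.map_add_eq_mul]) with h2 | h2
      · exact ⟨1, by simpa using h2.2, zero_le_one⟩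
      · exact ⟨0, by simpa using h2, le_rfl⟩
  choose v hv hle using h1
  have h2 : 𝔼 h ∈ Fintype.piFinset (fun _ : Fin m => K), ψ (T h) =
      ((𝔼 h ∈ Fintype.piFinset (fun _ : Fin m => K), v h : ℝ) : ℂ) := by
    rw [expect_update hK j]
    simp only [hv]
    exact (RCLike.ofReal_expect (K := ℂ) _ _).symm
  rw [bias, h2, Complex.norm_real]
  refine le_trans ?_ (le_abs_self _)
  refine le_trans (le_of_eq ?_) (Finset.expect_le_expect fun h _ => hle h)
  rw [expect_update hK i]
  simp [Finset.expect_const (hK.pi m).nonempty]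

end Slots

section Multiplication

variable {F : Type*} [Field F]

/-- Multiplication by a polynomial as an additive map. -/
noncomputable def mulMap (f : F[X]) : F[X] →ₗ[ℤ] F[X] := LinearMap.mulLeft ℤ f

lemma mulMap_apply (f g : F[X]) : mulMap f g = f * g := rfl

variable [Fintype F] {ψ : AddChar F ℂ} {m : ℕ}

lemma mulMap_mem_polyFiltr (f : F[X]) (n : ℕ) {g : F[X]} (hg : g ∈ polyFiltr F n) :
    mulMap f g ∈ polyFiltr F (n + f.natDegree) := by
  rw [mem_polyFiltr] at *
  rw [mulMap_apply, Polynomial.degree_mul, add_comm]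
  rcases eq_or_ne f 0 with rfl | hf
  · simp
  rw [Polynomial.degree_eq_natDegree hf]
  push_cast
  exact WithBot.add_lt_add_right (by simp) hg

lemma biased_of_mulMap {T : MultilinearMap ℤ (fun _ : Fin m => F[X]) F} {i j : Fin m}
    (hij : i ≠ j) {r : F[X]} (hr : r.Monic)
    (h : Biased ψ (polyFiltr F)
      (T.compLinearMap (Function.update (fun _ => LinearMap.id) i (mulMap r)))) :
    Biased ψ (polyFiltr F) T := by
  classical
  let D : F[X] →ₗ[ℤ] F[X] := (AddMonoidHom.mk' (fun f => f /ₘ r) fun a b => by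
    refine mul_left_cancel₀ hr.ne_zero ?_
    have h1 := Polynomial.modByMonic_add_div a r
    have h2 := Polynomial.modByMonic_add_div b r
    have h3 := Polynomial.modByMonic_add_div (a + b) r
    rw [Polynomial.add_modByMonic] at h3
    linear_combination h3 - h1 - h2).toIntLinearMap
  let M : F[X] →ₗ[ℤ] F[X] := (r.modByMonicHom).toAddMonoidHom.toIntLinearMap
  have hD : ∀ f, D f = f /ₘ r := fun _ => rfl
  have hM : ∀ f, M f = f %ₘ r := fun _ => rfl
  have hsplit : T = (T.compLinearMap (Function.update (fun _ => LinearMap.id) i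
      (mulMap r))).compLinearMap (Function.update (fun _ => LinearMap.id) i D) +
      T.compLinearMap (Function.update (fun _ => LinearMap.id) i M) := by
    ext h
    rw [add_apply, compLinearMap_update_apply, compLinearMap_update_apply,
      compLinearMap_update_apply, Function.update_idem, ← MultilinearMap.map_update_add]
    simp only [Function.update_self, mulMap_apply, hD, hM]
    rw [add_comm, Polynomial.modByMonic_add_div, Function.update_eq_self]
  rw [hsplit]
  refine Biased.add (h.compLinearMap _ 0 fun k n x hx => ?_) ?_
  · rcases eq_or_ne k i with rfl | hk
    · rw [Function.update_self, hD, mem_polyFiltr]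
      exact (Polynomial.degree_divByMonic_le _ _).trans_lt (mem_polyFiltr.mp hx)
    · rwa [Function.update_of_ne hk]
  · have hq : (0 : ℝ) < Fintype.card F := by exact_mod_cast Fintype.card_pos
    refine ⟨((Fintype.card F : ℝ) ^ r.natDegree)⁻¹, by positivity, fun n => ?_⟩
    refine le_trans ?_ (bias_antitone ψ _ _ (Nat.le_add_right n r.natDegree))
    refine le_trans (le_of_eq ?_) (le_bias_of_vanish ψ ((polyFiltr F).isFinSub _) _ hij (r ∣ ·) ?_)
    · exact (expect_ind hr (Nat.le_add_left _ n)).symm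
    · intro h hh
      rw [compLinearMap_update_apply, hM, (Polynomial.modByMonic_eq_zero_iff_dvd hr).mpr hh,
        MultilinearMap.map_update_zero]

end Multiplication

section Pigeonhole

variable {F : Type*} [Field F] [Fintype F] {Q : Type*} [AddCommGroup Q] {m : ℕ}

/-- The subgroup generated by the values of `θ` at polynomials of degree less than `n`. -/
def spanBall (θ : MultilinearMap ℤ (fun _ : Fin m => F[X]) Q) (n : ℕ) : AddSubgroup Q :=
  AddSubgroup.closure (θ '' {f | ∀ i, f i ∈ polyBall F n})

lemma spanBall_mono (θ : MultilinearMap ℤ (fun _ : Fin m => F[X]) Q) : Monotone (spanBall θ) :=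
  fun _ _ h => AddSubgroup.closure_mono (Set.image_mono fun _ hf i => polyBall_mono h (hf i))

lemma spanBall_finite (θ : MultilinearMap ℤ (fun _ : Fin m => F[X]) Q)
    (hQ : ∀ x : Q, ringChar F • x = 0) (n : ℕ) : Finite (spanBall θ n) := by
  have hfin : (θ '' {f | ∀ i, f i ∈ polyBall F n}).Finite := by
    refine Set.Finite.image _ ?_
    refine (Fintype.piFinset fun _ : Fin m => polyBall F n).finite_toSet.subset fun f hf => ?_
    simpa using hf
  have : AddGroup.FG (spanBall θ n) := by
    rw [AddGroup.fg_iff_addSubgroup_fg]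
    exact (AddSubgroup.fg_iff _).mpr ⟨_, rfl, hfin⟩
  have hp : 0 < ringChar F := (CharP.char_is_prime_or_zero F (ringChar F)).elim
    (fun h => h.pos) (fun h => absurd h (CharP.ringChar_ne_zero_of_finite F))
  refine AddCommGroup.finite_of_fg_isAddTorsion _ fun x => ?_
  exact isOfFinAddOrder_iff_nsmul_eq_zero.mpr ⟨ringChar F, hp, Subtype.ext (hQ x)⟩

lemma exists_partial_fractions {ι : Type*} [Fintype ι] [DecidableEq ι] {π : ι → F[X]}
    (hπ : ∀ j, (π j).Monic) (hcop : Pairwise fun i j => IsCoprime (π i) (π j)) {d : ℕ}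
    (hd : ∀ j, (π j).natDegree = d) {f : F[X]} (hf : f ∈ polyBall F (Fintype.card ι * d)) :
    ∃ r : ι → F[X], (∀ j, r j ∈ polyBall F d) ∧
      f = ∑ j, r j * ∏ k ∈ Finset.univ.erase j, π k := by
  obtain ⟨c, r, hr, hfr⟩ := Polynomial.eq_quo_mul_prod_add_sum_rem_mul_prod (s := Finset.univ) f
    (fun i _ => hπ i) (fun i _ j _ hij => hcop hij)
  have hdeg : ∀ j, (π j).degree = d := fun j => by
    rw [Polynomial.degree_eq_natDegree (hπ j).ne_zero, hd]
  have hr' : ∀ j, r j ∈ polyBall F d := fun j => by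
    rw [mem_polyBall, ← hdeg j]
    exact hr j (Finset.mem_univ j)
  refine ⟨r, hr', ?_⟩
  have hsum : ∑ j, r j * ∏ k ∈ Finset.univ.erase j, π k ∈ polyBall F (Fintype.card ι * d) := by
    rw [mem_polyBall]
    refine (Polynomial.degree_sum_le _ _).trans_lt ?_
    refine (Finset.sup_lt_iff (by exact WithBot.bot_lt_coe _)).mpr fun j _ => ?_
    have h1 : (∏ k ∈ Finset.univ.erase j, π k).Monic :=
      Polynomial.monic_prod_of_monic _ _ fun k _ => hπ k
    have h2 := (mul_mem_polyBall h1).mpr (hr' j)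
    rw [mul_comm, Polynomial.natDegree_prod_of_monic _ _ fun k _ => hπ k, mem_polyBall] at h2
    refine h2.trans_le ?_
    simp only [hd, Finset.sum_const, smul_eq_mul, Finset.card_erase_of_mem (Finset.mem_univ j),
      Finset.card_univ]
    have : 0 < Fintype.card ι := Fintype.card_pos_iff.mpr ⟨j⟩
    obtain ⟨n, hn⟩ := Nat.exists_eq_succ_of_ne_zero this.ne'
    rw [hn]
    norm_cast
    simp only [Nat.succ_eq_add_one, Nat.add_sub_cancel]
    exact le_of_eq (by ring)
  have hmon : (∏ j, π j).Monic := Polynomial.monic_prod_of_monic _ _ fun k _ => hπ k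
  have hc : c * ∏ j, π j ∈ polyBall F (0 + (∏ j, π j).natDegree) := by
    have : c * ∏ j, π j = f - ∑ j, r j * ∏ k ∈ Finset.univ.erase j, π k := by
      linear_combination -hfr
    rw [this, Polynomial.natDegree_prod_of_monic _ _ fun k _ => hπ k]
    simpa [hd] using (isFinSub_polyBall _).sub_mem _ hf _ hsum
  rw [mul_comm, mul_mem_polyBall hmon, mem_polyBall] at hc
  have hc0 : c = 0 := by simpa using hc
  rw [hfr, hc0, zero_mul, zero_add]

variable {θ : MultilinearMap ℤ (fun _ : Fin m => F[X]) Q} {u : (Fin m → F[X]) → Q →+ Q}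

lemma exists_pow_eq_of_equivalent (hQ : ∀ x : Q, ringChar F • x = 0)
    (hu : ∀ f g, u g (θ f) = θ (f * g)) {π : Fin (m + 1) → F[X]} (hπ : ∀ j, (π j).Monic)
    (hirr : ∀ j, Irreducible (π j)) (hinj : Function.Injective π) {d : ℕ}
    (hd : ∀ j, (π j).natDegree = d) (hθ : ∀ j, θ (fun _ => π j) = θ (fun _ => π 0)) (i : Fin m) :
    ∃ a b : ℕ, b < a ∧ θ (Function.update 1 i (X ^ a)) = θ (Function.update 1 i (X ^ b)) := by
  have hd0 : 0 < d := by
    rw [← hd 0]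
    exact (hirr 0).natDegree_pos
  have hcop : Pairwise fun i j => IsCoprime (π i) (π j) := by
    intro j k hjk
    refine ((hirr j).isCoprime_or_dvd (π k)).resolve_right fun hdvd => hjk (hinj ?_)
    exact eq_of_monic_of_associated (hπ j) (hπ k) ((hirr j).associated_of_dvd (hirr k) hdvd)
  have hstep : spanBall θ ((m + 1) * d) ≤ (spanBall θ (m * d)).map (u fun _ => π 0) := by
    rw [spanBall, AddSubgroup.closure_le]
    rintro _ ⟨f, hf, rfl⟩
    have hpf := fun i => exists_partial_fractions hπ hcop hd (f := f i) (by simpa using hf i)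
    choose r hr hfr using hpf
    have hfe : f = fun i => ∑ j, r i j * ∏ k ∈ Finset.univ.erase j, π k := funext hfr
    rw [hfe, MultilinearMap.map_sum]
    refine AddSubgroup.sum_mem _ fun J _ => ?_
    obtain ⟨j, hj⟩ : ∃ j, ∀ i, J i ≠ j := by
      by_contra! hcon
      have := Fintype.card_le_of_surjective J hcon
      simp at this
    refine ⟨θ fun i => r i (J i) * ∏ k ∈ (Finset.univ.erase (J i)).erase j, π k,
      AddSubgroup.subset_closure ⟨_, fun i => ?_, rfl⟩, ?_⟩
    · have h1 : (∏ k ∈ (Finset.univ.erase (J i)).erase j, π k).Monic :=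
        Polynomial.monic_prod_of_monic _ _ fun k _ => hπ k
      have h2 := (mul_mem_polyBall h1).mpr (hr i (J i))
      rw [mul_comm, Polynomial.natDegree_prod_of_monic _ _ fun k _ => hπ k] at h2
      refine polyBall_mono ?_ h2
      have hmem : j ∈ Finset.univ.erase (J i) := by simp [(hj i).symm]
      simp only [hd, Finset.sum_const, smul_eq_mul, Finset.card_erase_of_mem hmem,
        Finset.card_erase_of_mem (Finset.mem_univ (J i)), Finset.card_univ, Fintype.card_fin]
      obtain ⟨n, rfl⟩ := Nat.exists_eq_succ_of_ne_zero (Fin.pos i).ne'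
      simp only [Nat.succ_eq_add_one, Nat.add_sub_cancel]
      exact le_of_eq (by ring)
    · set f' : Fin m → F[X] := fun i => r i (J i) * ∏ k ∈ (Finset.univ.erase (J i)).erase j, π k
      have h1 : θ (f' * fun _ => π 0) = θ ((fun _ => π j) * f') := by
        rw [mul_comm f', ← hu, ← hu, hθ j]
      rw [hu, h1]
      congr 1
      ext1 i
      have hmem : j ∈ Finset.univ.erase (J i) := by simp [(hj i).symm]
      simp only [Pi.mul_apply, f', ← Finset.mul_prod_erase _ _ hmem]
      ring
  have hfin := spanBall_finite θ hQ
  have heq : spanBall θ (m * d) = spanBall θ ((m + 1) * d) := by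
    have := hfin ((m + 1) * d)
    have := hfin (m * d)
    refine AddSubgroup.eq_of_le_of_card_ge (spanBall_mono θ (by gcongr; omega)) ?_
    have h1 : Finite ((spanBall θ (m * d)).map (u fun _ => π 0)) :=
      Set.Finite.image _ (Set.toFinite (spanBall θ (m * d) : Set Q))
    refine (AddSubgroup.card_le_of_le hstep).trans ?_
    exact Set.ncard_image_le (Set.toFinite (spanBall θ (m * d) : Set Q))
  have hX : ∀ x ∈ spanBall θ (m * d), u (Function.update 1 i X) x ∈ spanBall θ (m * d) := by
    intro x hx
    have hle : spanBall θ (m * d) ≤ (spanBall θ (m * d)).comap (u (Function.update 1 i X)) := by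
      conv_lhs => rw [spanBall]
      rw [AddSubgroup.closure_le]
      rintro _ ⟨f, hf, rfl⟩
      simp only [AddSubgroup.coe_comap, Set.mem_preimage, SetLike.mem_coe, hu]
      rw [heq]
      refine AddSubgroup.subset_closure ⟨_, fun k => ?_, rfl⟩
      have hle : m * d + 1 ≤ (m + 1) * d := by rw [add_mul]; omega
      refine polyBall_mono hle ?_
      rcases eq_or_ne k i with rfl | hk
      · have := (mul_mem_polyBall (Polynomial.monic_X (R := F))).mpr (hf k)
        simpa [mul_comm] using this
      · simpa [hk] using polyBall_mono (Nat.le_succ _) (hf k)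
    exact hle hx
  have hpow : ∀ a : ℕ, θ (Function.update 1 i (X ^ a)) ∈ spanBall θ (m * d) := by
    intro a
    induction a with
    | zero =>
      refine AddSubgroup.subset_closure ⟨_, fun k => ?_, rfl⟩
      have hmd : 0 < m * d := Nat.mul_pos (Fin.pos i) hd0
      have h1 : (Function.update 1 i (X ^ 0) : Fin m → F[X]) k = 1 := by
        rcases eq_or_ne k i with rfl | hk <;> simp [*]
      rw [h1, mem_polyBall, Polynomial.degree_one]
      exact_mod_cast hmd
    | succ a ih =>
      have h1 := hX _ ih
      rw [hu] at h1
      convert! h1 using 2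
      ext1 k
      rcases eq_or_ne k i with rfl | hk <;> simp [*, pow_succ]
  have := hfin (m * d)
  obtain ⟨a, b, hab, he⟩ := Finite.exists_ne_map_eq_of_infinite
    (fun a : ℕ => (⟨_, hpow a⟩ : spanBall θ (m * d)))
  have he' := congrArg Subtype.val he
  rcases lt_or_gt_of_ne hab with h | h
  · exact ⟨b, a, h, he'.symm⟩
  · exact ⟨a, b, h, he'⟩

end Pigeonhole

section Scaling

variable {F : Type*} [Field F] {m : ℕ}

/-- The form `T` with its arguments multiplied by the polynomials `f i`. -/
noncomputable def scaled (T : MultilinearMap ℤ (fun _ : Fin m => F[X]) F) (f : Fin m → F[X]) :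
    MultilinearMap ℤ (fun _ : Fin m => F[X]) F := T.compLinearMap fun i => mulMap (f i)

lemma scaled_apply (T : MultilinearMap ℤ (fun _ : Fin m => F[X]) F) (f h : Fin m → F[X]) :
    scaled T f h = T (f * h) := rfl

lemma scaled_scaled (T : MultilinearMap ℤ (fun _ : Fin m => F[X]) F) (f g : Fin m → F[X]) :
    scaled (scaled T f) g = scaled T (f * g) := by
  ext h
  simp only [scaled_apply, mul_assoc]

lemma scaled_update_add (T : MultilinearMap ℤ (fun _ : Fin m => F[X]) F) (f : Fin m → F[X])
    (i : Fin m) (a b : F[X]) : scaled T (Function.update f i (a + b)) =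
      scaled T (Function.update f i a) + scaled T (Function.update f i b) := by
  ext h
  have hup : ∀ c, Function.update f i c * h = Function.update (f * h) i (c * h i) := by
    intro c
    ext1 j
    rcases eq_or_ne j i with rfl | hj <;> simp [*]
  simp only [scaled_apply, add_apply, hup, add_mul, MultilinearMap.map_update_add]

lemma scaled_update_one (T : MultilinearMap ℤ (fun _ : Fin m => F[X]) F) (i : Fin m) (a : F[X]) :
    scaled T (Function.update 1 i a) =
      T.compLinearMap (Function.update (fun _ => LinearMap.id) i (mulMap a)) := by
  ext h
  rw [compLinearMap_update_apply, scaled_apply]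
  congr 1
  ext1 j
  rcases eq_or_ne j i with rfl | hj <;> simp [*, mulMap_apply]

variable [Fintype F] {ψ : AddChar F ℂ}

lemma Biased.scaled {T : MultilinearMap ℤ (fun _ : Fin m => F[X]) F}
    (h : Biased ψ (polyFiltr F) T) (f : Fin m → F[X]) :
    Biased ψ (polyFiltr F) (scaled T f) :=
  h.compLinearMap _ (∑ i, (f i).natDegree) fun i n _ hx =>
    (polyFiltr F).mono (Nat.add_le_add_left
      (Finset.single_le_sum (f := fun i => (f i).natDegree) (fun _ _ => Nat.zero_le _)
        (Finset.mem_univ i)) n) (mulMap_mem_polyFiltr (f i) n hx)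

variable (ψ) in
/-- The classes of the scalings of `T` modulo biased forms. -/
noncomputable def scaledClass (T : MultilinearMap ℤ (fun _ : Fin m => F[X]) F) :
    MultilinearMap ℤ (fun _ : Fin m => F[X])
      (MultilinearMap ℤ (fun _ : Fin m => F[X]) F ⧸ biasedSubgroup ψ (polyFiltr F)) where
  toFun f := QuotientAddGroup.mk (scaled T f)
  map_update_add' := by
    intro inst f i a b
    have : inst = instDecidableEqFin m := Subsingleton.elim _ _
    subst this
    rw [scaled_update_add, QuotientAddGroup.mk_add]
  map_update_smul' := by
    intro inst f i c a
    have : inst = instDecidableEqFin m := Subsingleton.elim _ _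
    subst this
    exact map_zsmul (AddMonoidHom.mk' (fun a => (QuotientAddGroup.mk
      (scaled T (Function.update f i a)) :
        MultilinearMap ℤ (fun _ : Fin m => F[X]) F ⧸ biasedSubgroup ψ (polyFiltr F)))
      (fun a b => by rw [scaled_update_add, QuotientAddGroup.mk_add])) c a

lemma scaledClass_eq_iff {T : MultilinearMap ℤ (fun _ : Fin m => F[X]) F} {f g : Fin m → F[X]} :
    scaledClass ψ T f = scaledClass ψ T g ↔
      Biased ψ (polyFiltr F) (scaled T f - scaled T g) := by
  rw [← mem_biasedSubgroup]
  exact (QuotientAddGroup.eq_iff_sub_mem)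

lemma card_le_of_equivalent {T : MultilinearMap ℤ (fun _ : Fin m => F[X]) F} {i j : Fin m}
    (hij : i ≠ j) (hT : ¬ Biased ψ (polyFiltr F) T) {d : ℕ} (S : Finset F[X]) (p₀ : F[X])
    (hS : ∀ p ∈ S, p.Monic ∧ Irreducible p ∧ p.natDegree = d ∧
      Biased ψ (polyFiltr F) (scaled T (fun _ => p) - scaled T fun _ => p₀)) : S.card ≤ m := by
  by_contra! hcard
  obtain ⟨S', hS'S, hS'⟩ := Finset.exists_subset_card_eq (Nat.succ_le_of_lt hcard)
  let e : Fin (m + 1) ≃ S' := (Finset.equivFinOfCardEq hS').symm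
  let π : Fin (m + 1) → F[X] := fun k => e k
  have hπ : ∀ k, π k ∈ S := fun k => hS'S (e k).2
  let u : (Fin m → F[X]) →
      (MultilinearMap ℤ (fun _ : Fin m => F[X]) F ⧸ biasedSubgroup ψ (polyFiltr F)) →+
      (MultilinearMap ℤ (fun _ : Fin m => F[X]) F ⧸ biasedSubgroup ψ (polyFiltr F)) :=
    fun g => QuotientAddGroup.map _ _
      (AddMonoidHom.mk' (fun T => scaled T g) fun T T' => by ext; rfl)
      (fun T hT => Biased.scaled hT g)
  obtain ⟨a, b, hab, he⟩ := exists_pow_eq_of_equivalent (θ := scaledClass ψ T) (u := u) (π := π)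
    (d := d) (fun x => by
      obtain ⟨T', rfl⟩ := QuotientAddGroup.mk_surjective x
      rw [← QuotientAddGroup.mk_nsmul]
      have : ringChar F • T' = 0 := by
        ext h
        simp [nsmul_eq_mul]
      rw [this, QuotientAddGroup.mk_zero])
    (fun f g => by
      change QuotientAddGroup.mk (scaled (scaled T f) g) = QuotientAddGroup.mk (scaled T (f * g))
      rw [scaled_scaled])
    (fun k => (hS _ (hπ k)).1) (fun k => (hS _ (hπ k)).2.1)
    (Subtype.val_injective.comp e.injective) (fun k => (hS _ (hπ k)).2.2.1)
    (fun k => by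
      rw [scaledClass_eq_iff.mpr (hS _ (hπ k)).2.2.2, scaledClass_eq_iff.mpr (hS _ (hπ 0)).2.2.2])
    i
  rw [scaledClass_eq_iff] at he
  have hmonic : (X ^ a - X ^ b : F[X]).Monic :=
    Polynomial.monic_X_pow_sub (by rw [Polynomial.degree_X_pow]; exact_mod_cast (by omega))
  refine hT (biased_of_mulMap hij hmonic ?_)
  rw [← scaled_update_one]
  convert! he using 1
  rw [eq_sub_iff_add_eq, ← scaled_update_add, sub_add_cancel]

end Scaling

section Primes

variable (F : Type*) [Field F] [Fintype F]

open Classical in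
/-- The monic irreducible polynomials of degree at most `D`. -/
noncomputable def primesLE (D : ℕ) : Finset F[X] :=
  (polyBall F (D + 1)).filter fun p => p.Monic ∧ Irreducible p

/-- The sum of the reciprocals of the norms of the primes of degree at most `D`. -/
noncomputable def primeMass (D : ℕ) : ℝ :=
  ∑ p ∈ primesLE F D, ((Fintype.card F : ℝ) ^ p.natDegree)⁻¹

variable {F}

open Classical in
lemma mem_primesLE {D : ℕ} {p : F[X]} :
    p ∈ primesLE F D ↔ p.natDegree ≤ D ∧ p.Monic ∧ Irreducible p := by
  rw [primesLE, Finset.mem_filter, mem_polyBall]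
  refine and_congr_left fun h => ?_
  rw [Polynomial.degree_eq_natDegree h.1.ne_zero]
  norm_cast
  omega

lemma sum_primesLE {M : Type*} [AddCommMonoid M] (D : ℕ) (f : F[X] → M) :
    ∑ p ∈ primesLE F D, f p =
      ∑ d ∈ Finset.Icc 1 D, ∑ p ∈ primesLE F D with p.natDegree = d, f p :=
  (Finset.sum_fiberwise_of_maps_to (fun p hp => by
    rw [mem_primesLE] at hp
    exact Finset.mem_Icc.mpr ⟨hp.2.2.natDegree_pos, hp.1⟩) f).symm

lemma card_primes_le (D d : ℕ) :
    ((primesLE F D).filter fun p => p.natDegree = d).card ≤ Fintype.card F ^ d := by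
  rw [← card_polyBall]
  refine Finset.card_le_card_of_injOn (fun p => p - X ^ d) (fun p hp => ?_) (fun p _ p' _ h => ?_)
  · simp only [Finset.coe_filter, Set.mem_ofPred_eq, mem_primesLE] at hp
    obtain ⟨⟨_, hm, _⟩, hd⟩ := hp
    simp only [Finset.mem_coe, mem_polyBall]
    have hdeg : p.degree = d := by rw [Polynomial.degree_eq_natDegree hm.ne_zero, hd]
    rw [← hdeg]
    refine Polynomial.degree_sub_lt_left ?_ hm.ne_zero ?_
    · rw [hdeg, Polynomial.degree_X_pow]
    · rw [hm.leadingCoeff, (Polynomial.monic_X_pow d).leadingCoeff]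
  · exact sub_left_injective h

lemma two_le_card : (2 : ℝ) ≤ Fintype.card F := by
  exact_mod_cast Fintype.one_lt_card (α := F)

end Primes

section Katai

variable {F : Type*} [Field F] [Fintype F]

open Classical in
lemma turan_kubilius {D N : ℕ} (hN : 2 * D ≤ N) :
    𝔼 g ∈ polyBall F N, (∑ p ∈ primesLE F D, (if p ∣ g then (1 : ℝ) else 0) - primeMass F D) ^ 2 ≤
      primeMass F D := by
  set P := primesLE F D
  set A := primeMass F D with hA
  set w : F[X] → ℝ := fun p => ((Fintype.card F : ℝ) ^ p.natDegree)⁻¹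
  have hw : ∀ p, 0 ≤ w p := fun p => by positivity
  have h1 : 𝔼 g ∈ polyBall F N, ∑ p ∈ P, (if p ∣ g then (1 : ℝ) else 0) = A := by
    rw [Finset.expect_sum_comm]
    refine Finset.sum_congr rfl fun p hp => ?_
    obtain ⟨hd, hm, _⟩ := mem_primesLE.mp hp
    exact expect_ind hm (by omega)
  have h2 : 𝔼 g ∈ polyBall F N, (∑ p ∈ P, (if p ∣ g then (1 : ℝ) else 0)) ^ 2 ≤ A ^ 2 + A := by
    have h3 : ∀ p ∈ P, ∀ p' ∈ P, 𝔼 g ∈ polyBall F N,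
        (if p ∣ g then (1 : ℝ) else 0) * (if p' ∣ g then (1 : ℝ) else 0) ≤
          w p * w p' + if p = p' then w p else 0 := by
      intro p hp p' hp'
      obtain ⟨hd, hm, hi⟩ := mem_primesLE.mp hp
      obtain ⟨hd', hm', hi'⟩ := mem_primesLE.mp hp'
      by_cases hpp : p = p'
      · subst hpp
        have h4 := expect_ind hm (n := N) (by omega)
        simp only [if_true, ite_mul, one_mul, zero_mul]
        have h5 : 𝔼 g ∈ polyBall F N, (if p ∣ g then if p ∣ g then (1 : ℝ) else 0 else 0) = w p := by
          exact Eq.trans (Finset.expect_congr rfl fun g _ => by split_ifs <;> rfl) h4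
        rw [h5]
        nlinarith [hw p]
      · have hcop : IsCoprime p p' := (hi.isCoprime_or_dvd p').resolve_right fun hdvd => hpp
          (eq_of_monic_of_associated hm hm' (hi.associated_of_dvd hi' hdvd))
        have h4 := expect_ind (hm.mul hm') (n := N) (by
          rw [hm.natDegree_mul hm']; omega)
        rw [hm.natDegree_mul hm', pow_add, mul_inv] at h4
        rw [if_neg hpp, add_zero, ← h4]
        refine le_of_eq (Finset.expect_congr rfl fun g _ => ?_)
        have : p * p' ∣ g ↔ p ∣ g ∧ p' ∣ g :=
          ⟨fun h => ⟨dvd_of_mul_right_dvd h, dvd_of_mul_left_dvd h⟩,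
            fun h => hcop.mul_dvd h.1 h.2⟩
        simp only [this]
        split_ifs <;> simp_all
    calc _ = ∑ p ∈ P, ∑ p' ∈ P, 𝔼 g ∈ polyBall F N,
          (if p ∣ g then (1 : ℝ) else 0) * (if p' ∣ g then (1 : ℝ) else 0) := by
          simp only [sq, Finset.sum_mul_sum, Finset.expect_sum_comm]
      _ ≤ ∑ p ∈ P, ∑ p' ∈ P, (w p * w p' + if p = p' then w p else 0) :=
          Finset.sum_le_sum fun p hp => Finset.sum_le_sum fun p' hp' => h3 p hp p' hp'
      _ = A ^ 2 + A := by
          simp only [Finset.sum_add_distrib, ← Finset.sum_mul_sum, ← sq, Finset.sum_ite_eq,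
            Finset.sum_ite_mem, Finset.inter_self]
          rfl
  have hexp : ∀ g, (∑ p ∈ P, (if p ∣ g then (1 : ℝ) else 0) - A) ^ 2 =
      (∑ p ∈ P, (if p ∣ g then (1 : ℝ) else 0)) ^ 2 -
        (2 * A) * (∑ p ∈ P, (if p ∣ g then (1 : ℝ) else 0)) + A ^ 2 := fun g => by ring
  simp only [hexp, Finset.expect_add_distrib, Finset.expect_sub_distrib, ← Finset.mul_expect]
  rw [h1, Finset.expect_const (isFinSub_polyBall N).nonempty]
  linarith

lemma norm_expect_mul_sum_sq_le {ι κ : Type*} (s : Finset ι) (S : Finset κ) (a : ι → ℂ)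
    (ha : ∀ i, ‖a i‖ ≤ 1) (c : κ → ℂ) (hc : ∀ k, ‖c k‖ ≤ 1) (f : κ → ι → ℂ) :
    ‖𝔼 i ∈ s, a i * ∑ k ∈ S, c k * f k i‖ ^ 2 ≤
      ∑ k ∈ S, ∑ l ∈ S, ‖𝔼 i ∈ s, f k i * conj (f l i)‖ := by
  have h1 : 𝔼 i ∈ s, ‖∑ k ∈ S, c k * f k i‖ ^ 2 =
      (∑ k ∈ S, ∑ l ∈ S, c k * conj (c l) * 𝔼 i ∈ s, f k i * conj (f l i)).re := by
    have h2 : ((𝔼 i ∈ s, ‖∑ k ∈ S, c k * f k i‖ ^ 2 : ℝ) : ℂ) =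
        ∑ k ∈ S, ∑ l ∈ S, c k * conj (c l) * 𝔼 i ∈ s, f k i * conj (f l i) := by
      refine (RCLike.ofReal_expect (K := ℂ) _ _).trans ?_
      simp only [Finset.mul_expect, ← Finset.expect_sum_comm]
      refine Finset.expect_congr rfl fun i _ => ?_
      have h3 : ((‖∑ k ∈ S, c k * f k i‖ ^ 2 : ℝ) : ℂ) =
          (∑ k ∈ S, c k * f k i) * conj (∑ k ∈ S, c k * f k i) := by
        rw [Complex.mul_conj, Complex.normSq_eq_norm_sq]
      refine Eq.trans h3 ?_
      rw [map_sum, Finset.sum_mul_sum]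
      refine Finset.sum_congr rfl fun k _ => Finset.sum_congr rfl fun l _ => ?_
      rw [map_mul]
      ring
    rw [← h2, Complex.ofReal_re]
  calc _ ≤ 𝔼 i ∈ s, ‖a i * ∑ k ∈ S, c k * f k i‖ ^ 2 := norm_expect_sq_le _ _
    _ ≤ 𝔼 i ∈ s, ‖∑ k ∈ S, c k * f k i‖ ^ 2 := Finset.expect_le_expect fun i _ => by
        gcongr
        rw [norm_mul]
        exact mul_le_of_le_one_left (norm_nonneg _) (ha i)
    _ ≤ _ := by
        rw [h1]
        refine (Complex.re_le_norm _).trans ((norm_sum_le _ _).trans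
          (Finset.sum_le_sum fun k _ => (norm_sum_le _ _).trans
            (Finset.sum_le_sum fun l _ => ?_)))
        rw [norm_mul, norm_mul, RCLike.norm_conj]
        exact mul_le_of_le_one_left (norm_nonneg _)
          (mul_le_one₀ (hc k) (norm_nonneg _) (hc l))

open Classical in
lemma norm_expect_mul_sub_le {ν : F[X] → ℂ} (hν : IsMultFn ν) (hνb : ∀ g, ‖ν g‖ ≤ 1)
    {f : F[X] → ℂ} (hf : ∀ g, ‖f g‖ ≤ 1) {p : F[X]} (hm : p.Monic) (hp : Irreducible p) {n : ℕ}
    (hn : p.natDegree ≤ n) :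
    ‖𝔼 g ∈ polyBall F n, ν (p * g) * f g - 𝔼 g ∈ polyBall F n, ν p * ν g * f g‖ ≤
      2 * ((Fintype.card F : ℝ) ^ p.natDegree)⁻¹ := by
  rw [← expect_ind hm hn, Finset.mul_expect, ← Finset.expect_sub_distrib]
  refine (RCLike.norm_expect_le (K := ℂ)).trans (Finset.expect_le_expect fun g _ => ?_)
  rw [← sub_mul, norm_mul]
  refine (mul_le_of_le_one_right (norm_nonneg _) (hf g)).trans ?_
  split_ifs with h
  · refine (norm_sub_le _ _).trans ?_
    rw [norm_mul]
    have := mul_le_one₀ (hνb p) (norm_nonneg _) (hνb g)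
    linarith [hνb (p * g)]
  · rw [hν p g ((hp.isCoprime_or_dvd g).resolve_right h)]
    simp

lemma sum_inv_sq_primesLE_le (D : ℕ) :
    ∑ p ∈ primesLE F D, ((Fintype.card F : ℝ) ^ p.natDegree)⁻¹ *
      ((Fintype.card F : ℝ) ^ p.natDegree)⁻¹ ≤ 1 := by
  have hq := two_le_card (F := F)
  rw [sum_primesLE]
  calc _ ≤ ∑ d ∈ Finset.Icc 1 D, ((1 : ℝ) / 2) ^ d := Finset.sum_le_sum fun d _ => by
        calc _ = ∑ p ∈ primesLE F D with p.natDegree = d, ((Fintype.card F : ℝ) ^ d)⁻¹ *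
              ((Fintype.card F : ℝ) ^ d)⁻¹ := Finset.sum_congr rfl fun p hp => by
                rw [(Finset.mem_filter.mp hp).2]
          _ ≤ ((Fintype.card F : ℝ) ^ d) * (((Fintype.card F : ℝ) ^ d)⁻¹ *
              ((Fintype.card F : ℝ) ^ d)⁻¹) := by
                rw [Finset.sum_const, nsmul_eq_mul]
                gcongr
                exact_mod_cast card_primes_le D d
          _ = ((Fintype.card F : ℝ) ^ d)⁻¹ := by field_simp
          _ ≤ _ := by
                rw [one_div, inv_pow]
                gcongr
    _ = 1 - (1 / 2) ^ D := by
        induction D with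
        | zero => simp
        | succ D ih =>
          rw [Finset.sum_Icc_succ_top (by omega), ih]
          ring
    _ ≤ 1 := by simp

/-- A finite form of Kátai's orthogonality criterion. -/
lemma primeMass_mul_norm_expect_le {ν : F[X] → ℂ} (hν : IsMultFn ν) (hνb : ∀ g, ‖ν g‖ ≤ 1)
    {f : F[X] → ℂ} (hf : ∀ g, ‖f g‖ ≤ 1) {D N : ℕ} (hN : 2 * D ≤ N) :
    primeMass F D * ‖𝔼 g ∈ polyBall F N, ν g * f g‖ ≤ √(primeMass F D) + 2 +
      ∑ d ∈ Finset.Icc 1 D, ((Fintype.card F : ℝ) ^ d)⁻¹ *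
        √(∑ p ∈ primesLE F D with p.natDegree = d, ∑ p' ∈ primesLE F D with p'.natDegree = d,
          ‖𝔼 g ∈ polyBall F (N - d), f (p * g) * conj (f (p' * g))‖) := by
  classical
  set A := primeMass F D with hA
  have hA0 : 0 ≤ A := Finset.sum_nonneg fun p _ => by positivity
  set w : F[X] → ℝ := fun p => ((Fintype.card F : ℝ) ^ p.natDegree)⁻¹ with hw
  set ω : F[X] → ℝ := fun g => ∑ p ∈ primesLE F D, (if p ∣ g then (1 : ℝ) else 0) with hω
  have hsplit : (A : ℂ) * 𝔼 g ∈ polyBall F N, ν g * f g =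
      𝔼 g ∈ polyBall F N, ν g * f g * ((A - ω g : ℝ) : ℂ) +
      𝔼 g ∈ polyBall F N, ν g * f g * (ω g : ℂ) := by
    rw [Finset.mul_expect, ← Finset.expect_add_distrib]
    refine Finset.expect_congr rfl fun g _ => ?_
    push_cast
    ring
  have hfirst : ‖𝔼 g ∈ polyBall F N, ν g * f g * ((A - ω g : ℝ) : ℂ)‖ ≤ √A := by
    refine Real.le_sqrt_of_sq_le ((norm_expect_sq_le _ _).trans
      (le_trans (Finset.expect_le_expect fun g _ => ?_) (turan_kubilius hN)))
    rw [norm_mul, norm_mul, Complex.norm_real, mul_pow, Real.norm_eq_abs, abs_sub_comm, sq_abs]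
    refine mul_le_of_le_one_left (sq_nonneg _) (pow_le_one₀ (by positivity) ?_)
    exact mul_le_one₀ (hνb g) (norm_nonneg _) (hf g)
  have hsecond : 𝔼 g ∈ polyBall F N, ν g * f g * (ω g : ℂ) =
      ∑ p ∈ primesLE F D, (w p : ℂ) * 𝔼 g ∈ polyBall F (N - p.natDegree), ν (p * g) * f (p * g) := by
    simp only [hω, Complex.ofReal_sum, Finset.mul_sum]
    rw [Finset.expect_sum_comm]
    refine Finset.sum_congr rfl fun p hp => ?_
    obtain ⟨hd, hm, _⟩ := mem_primesLE.mp hp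
    have h1 := expect_dvd hm (N - p.natDegree) (fun g => ν g * f g)
    rw [Nat.sub_add_cancel (by omega)] at h1
    simp only [hw]
    push_cast
    rw [← h1]
    refine Finset.expect_congr rfl fun g _ => ?_
    split_ifs <;> simp
  have herr : ‖∑ p ∈ primesLE F D, (w p : ℂ) *
        𝔼 g ∈ polyBall F (N - p.natDegree), ν (p * g) * f (p * g) -
      ∑ p ∈ primesLE F D, (w p : ℂ) *
        𝔼 g ∈ polyBall F (N - p.natDegree), ν p * ν g * f (p * g)‖ ≤ 2 := by
    rw [← Finset.sum_sub_distrib]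
    calc _ ≤ ∑ p ∈ primesLE F D, 2 * (w p * w p) := by
          refine (norm_sum_le _ _).trans (Finset.sum_le_sum fun p hp => ?_)
          obtain ⟨hd, hm, hi⟩ := mem_primesLE.mp hp
          have h1 := norm_expect_mul_sub_le hν hνb (f := fun g => f (p * g)) (fun g => hf _) hm hi
            (n := N - p.natDegree) (by omega)
          have hw0 : 0 ≤ w p := by positivity
          rw [← mul_sub, norm_mul, Complex.norm_real, Real.norm_of_nonneg hw0]
          calc _ ≤ w p * (2 * w p) := by gcongr
            _ = _ := by ring
      _ ≤ 2 := by
          rw [← Finset.mul_sum]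
          linarith [sum_inv_sq_primesLE_le (F := F) D]
  have hmain : ‖∑ p ∈ primesLE F D, (w p : ℂ) *
        𝔼 g ∈ polyBall F (N - p.natDegree), ν p * ν g * f (p * g)‖ ≤
      ∑ d ∈ Finset.Icc 1 D, ((Fintype.card F : ℝ) ^ d)⁻¹ *
        √(∑ p ∈ primesLE F D with p.natDegree = d, ∑ p' ∈ primesLE F D with p'.natDegree = d,
          ‖𝔼 g ∈ polyBall F (N - d), f (p * g) * conj (f (p' * g))‖) := by
    rw [sum_primesLE]
    refine (norm_sum_le _ _).trans (Finset.sum_le_sum fun d _ => ?_)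
    have h1 : ∑ p ∈ primesLE F D with p.natDegree = d, (w p : ℂ) *
        𝔼 g ∈ polyBall F (N - p.natDegree), ν p * ν g * f (p * g) =
        ((((Fintype.card F : ℝ) ^ d)⁻¹ : ℝ) : ℂ) * 𝔼 g ∈ polyBall F (N - d),
          ν g * ∑ p ∈ primesLE F D with p.natDegree = d, ν p * f (p * g) := by
      simp only [Finset.mul_sum]
      rw [Finset.expect_sum_comm, Finset.mul_sum]
      refine Finset.sum_congr rfl fun p hp => ?_
      rw [← (Finset.mem_filter.mp hp).2]
      congr 1
      exact Finset.expect_congr rfl fun g _ => by ring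
    rw [h1, norm_mul, Complex.norm_real, Real.norm_of_nonneg (by positivity)]
    gcongr
    exact Real.le_sqrt_of_sq_le (norm_expect_mul_sum_sq_le _ _ ν hνb ν hνb fun p g => f (p * g))
  have hnorm := congrArg norm hsplit
  rw [norm_mul, Complex.norm_real, Real.norm_of_nonneg hA0] at hnorm
  rw [hnorm]
  refine (norm_add_le _ _).trans ?_
  rw [hsecond, ← sub_add_cancel (∑ p ∈ primesLE F D, (w p : ℂ) *
        𝔼 g ∈ polyBall F (N - p.natDegree), ν (p * g) * f (p * g))
      (∑ p ∈ primesLE F D, (w p : ℂ) *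
        𝔼 g ∈ polyBall F (N - p.natDegree), ν p * ν g * f (p * g))]
  rw [add_assoc]
  exact add_le_add hfirst ((norm_add_le _ _).trans (add_le_add herr hmain))

end Katai

section PrimeMass

variable {F : Type*} [Field F] [Fintype F]

open Classical in
lemma card_smooth_le (D N : ℕ) :
    ((polyBall F N).filter fun g => g ≠ 0 ∧ ∀ p, p.Monic → Irreducible p → p ∣ g →
      p.natDegree ≤ D).card ≤ Fintype.card F * (N + 1) ^ (primesLE F D).card := by
  have hcard : (Finset.univ : Finset (F × (primesLE F D → Fin (N + 1)))).card =
      Fintype.card F * (N + 1) ^ (primesLE F D).card := by simp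
  rw [← hcard]
  refine Finset.card_le_card_of_injOn (fun g => (g.leadingCoeff, fun p =>
    Fin.ofNat (N + 1) ((UniqueFactorizationMonoid.normalizedFactors g).count (p : F[X]))))
    (fun _ _ => Finset.mem_coe.mpr (Finset.mem_univ _)) ?_
  intro g hg g' hg' h
  simp only [Finset.coe_filter, Set.mem_ofPred_eq, mem_polyBall] at hg hg'
  simp only [Prod.mk.injEq, funext_iff] at h
  have hcount : ∀ g : F[X], g ≠ 0 → g.degree < N → ∀ p : primesLE F D,
      (UniqueFactorizationMonoid.normalizedFactors g).count (p : F[X]) < N + 1 := by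
    intro g hg0 hgN p
    obtain ⟨_, hm, hi⟩ := mem_primesLE.mp p.2
    have h1 : (p : F[X]) ^ (UniqueFactorizationMonoid.normalizedFactors g).count (p : F[X]) ∣ g := by
      refine dvd_trans ?_ (UniqueFactorizationMonoid.prod_normalizedFactors hg0).dvd
      rw [← Multiset.prod_replicate]
      exact Multiset.prod_dvd_prod_of_le (Multiset.le_count_iff_replicate_le.mp le_rfl)
    have h2 := Polynomial.natDegree_le_of_dvd h1 hg0
    rw [hm.natDegree_pow] at h2
    rw [Polynomial.degree_eq_natDegree hg0] at hgN
    have h3 : g.natDegree < N := by exact_mod_cast hgN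
    have h4 := Nat.le_mul_of_pos_right
      ((UniqueFactorizationMonoid.normalizedFactors g).count (p : F[X])) hi.natDegree_pos
    omega
  have hmem : ∀ g : F[X], g ≠ 0 → (∀ p, p.Monic → Irreducible p → p ∣ g → p.natDegree ≤ D) →
      ∀ p ∈ UniqueFactorizationMonoid.normalizedFactors g, p ∈ primesLE F D := by
    intro g hg0 hgs p hp
    have hm : p.Monic := by
      have h1 := UniqueFactorizationMonoid.normalize_normalized_factor p hp
      rw [← h1]
      exact Polynomial.monic_normalize
        (UniqueFactorizationMonoid.irreducible_of_normalized_factor p hp).ne_zero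
    have hi := UniqueFactorizationMonoid.irreducible_of_normalized_factor p hp
    exact mem_primesLE.mpr
      ⟨hgs p hm hi (UniqueFactorizationMonoid.dvd_of_mem_normalizedFactors hp), hm, hi⟩
  have hnf : UniqueFactorizationMonoid.normalizedFactors g =
      UniqueFactorizationMonoid.normalizedFactors g' := by
    ext p
    by_cases hp : p ∈ primesLE F D
    · have h1 := congrArg Fin.val (h.2 ⟨p, hp⟩)
      simp only [Fin.ofNat, Nat.mod_eq_of_lt (hcount g hg.2.1 hg.1 ⟨p, hp⟩),
        Nat.mod_eq_of_lt (hcount g' hg'.2.1 hg'.1 ⟨p, hp⟩)] at h1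
      exact h1
    · rw [Multiset.count_eq_zero_of_notMem fun h => hp (hmem g hg.2.1 hg.2.2 p h),
        Multiset.count_eq_zero_of_notMem fun h => hp (hmem g' hg'.2.1 hg'.2.2 p h)]
  rw [← Polynomial.leadingCoeff_mul_prod_normalizedFactors g,
    ← Polynomial.leadingCoeff_mul_prod_normalizedFactors g', hnf, h.1]

open Classical in
lemma card_pow_le_of_primeMass {D N : ℕ} (h : primeMass F N - primeMass F D ≤ 1 / 2)
    (hDN : D ≤ N) :
    (Fintype.card F : ℝ) ^ N ≤ 2 * (1 + Fintype.card F * (N + 1) ^ (primesLE F D).card) := by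
  have hsub : primesLE F D ⊆ primesLE F N := fun p hp => by
    rw [mem_primesLE] at *
    exact ⟨hp.1.trans hDN, hp.2⟩
  set Sm := (polyBall F N).filter fun g => g ≠ 0 ∧ ∀ p, p.Monic → Irreducible p → p ∣ g →
    p.natDegree ≤ D with hSm
  have hcover : polyBall F N ⊆ ({0} ∪ Sm) ∪ (primesLE F N \ primesLE F D).biUnion
      fun p => (polyBall F N).filter (p ∣ ·) := by
    intro g hg
    by_cases hg0 : g = 0
    · simp [hg0]
    by_cases hs : g ∈ Sm
    · simp [hs]
    refine Finset.mem_union_right _ ?_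
    simp only [hSm, Finset.mem_filter, hg, hg0, ne_eq, not_false_eq_true, true_and,
      not_forall, not_le] at hs
    obtain ⟨p, hm, hi, hdvd, hd⟩ := hs
    simp only [Finset.mem_biUnion, Finset.mem_sdiff, mem_primesLE, Finset.mem_filter]
    refine ⟨p, ⟨⟨?_, hm, hi⟩, fun h => by omega⟩, hg, hdvd⟩
    have h1 := Polynomial.natDegree_le_of_dvd hdvd hg0
    rw [mem_polyBall, Polynomial.degree_eq_natDegree hg0] at hg
    have h2 : g.natDegree < N := by exact_mod_cast hg
    omega
  have hq : (0 : ℝ) < (Fintype.card F : ℝ) ^ N := by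
    have := two_le_card (F := F)
    positivity
  have hp : ∀ p ∈ primesLE F N \ primesLE F D, (((polyBall F N).filter (p ∣ ·)).card : ℝ) =
      (Fintype.card F : ℝ) ^ N * ((Fintype.card F : ℝ) ^ p.natDegree)⁻¹ := by
    intro p hp
    obtain ⟨hd, hm, _⟩ := mem_primesLE.mp (Finset.mem_sdiff.mp hp).1
    rw [← expect_ind hm hd, Finset.expect_eq_sum_div_card, card_polyBall, Finset.sum_boole]
    push_cast
    field_simp
  have hsum : ∑ p ∈ primesLE F N \ primesLE F D, (((polyBall F N).filter (p ∣ ·)).card : ℝ) ≤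
      (Fintype.card F : ℝ) ^ N / 2 := by
    rw [Finset.sum_congr rfl hp, ← Finset.mul_sum]
    have h1 := Finset.sum_sdiff (f := fun p : F[X] => ((Fintype.card F : ℝ) ^ p.natDegree)⁻¹) hsub
    have h2 : ∑ p ∈ primesLE F N \ primesLE F D, ((Fintype.card F : ℝ) ^ p.natDegree)⁻¹ ≤ 1 / 2 := by
      unfold primeMass at h
      linarith
    calc _ ≤ (Fintype.card F : ℝ) ^ N * (1 / 2) := by gcongr
      _ = _ := by ring
  have hcard : (Fintype.card F : ℝ) ^ N ≤ 1 + Sm.card +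
      ∑ p ∈ primesLE F N \ primesLE F D, (((polyBall F N).filter (p ∣ ·)).card : ℝ) := by
    have h1 := (Finset.card_le_card hcover).trans ((Finset.card_union_le _ _).trans
      (add_le_add (Finset.card_union_le _ _) Finset.card_biUnion_le))
    rw [card_polyBall, Finset.card_singleton] at h1
    exact_mod_cast h1
  have hSmc : (Sm.card : ℝ) ≤ Fintype.card F * (N + 1) ^ (primesLE F D).card := by
    exact_mod_cast card_smooth_le D N
  linarith

variable (F) in
lemma exists_le_primeMass (C : ℝ) : ∃ D, C ≤ primeMass F D := by
  by_contra! hcon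
  have hbdd : BddAbove (Set.range (primeMass F)) := ⟨C, by rintro _ ⟨D, rfl⟩; exact (hcon D).le⟩
  obtain ⟨D, hD⟩ := exists_lt_of_lt_ciSup (show (⨆ D, primeMass F D) - 1 / 2 < ⨆ D, primeMass F D by
    linarith)
  have hq := two_le_card (F := F)
  have hlim := (tendsto_pow_const_div_const_pow_of_one_lt (primesLE F D).card
    (show (1 : ℝ) < Fintype.card F by linarith)).const_mul (4 * (Fintype.card F : ℝ) ^ 2)
  rw [mul_zero] at hlim
  have hev := (hlim.eventually (gt_mem_nhds zero_lt_one)).and (eventually_gt_atTop D)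
  obtain ⟨n, hn, hnD⟩ := hev.exists
  obtain ⟨N, rfl⟩ := Nat.exists_eq_succ_of_ne_zero (show n ≠ 0 by omega)
  have h1 := card_pow_le_of_primeMass (F := F) (D := D) (N := N)
    (by linarith [le_ciSup hbdd N]) (by omega)
  set q : ℝ := (Fintype.card F : ℝ) with hqdef
  set k := (primesLE F D).card
  have hk : (1 : ℝ) ≤ ((N : ℝ) + 1) ^ k := one_le_pow₀ (by linarith [Nat.cast_nonneg (α := ℝ) N])
  rw [← mul_div_assoc, div_lt_one (by positivity), Nat.succ_eq_add_one, pow_succ q N] at hn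
  push_cast at hn
  nlinarith [mul_le_mul_of_nonneg_right h1 (show 0 ≤ q by linarith)]

end PrimeMass

section AsymptoticKatai

variable {F : Type*} [Field F] [Fintype F]

lemma inv_pow_mul_sqrt_le (d B : ℕ) {S : ℝ}
    (hS : S ≤ (Fintype.card F : ℝ) ^ d * (B + 1)) :
    ((Fintype.card F : ℝ) ^ d)⁻¹ * √S ≤ (3 / 4) ^ d * √(B + 1) := by
  have hq := two_le_card (F := F)
  have hq0 : (0 : ℝ) < (Fintype.card F : ℝ) ^ d := by positivity
  calc _ ≤ ((Fintype.card F : ℝ) ^ d)⁻¹ * √((Fintype.card F : ℝ) ^ d * (B + 1)) := by gcongr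
    _ = ((Fintype.card F : ℝ) ^ d)⁻¹ * √((Fintype.card F : ℝ) ^ d) * √(B + 1) := by
        rw [Real.sqrt_mul hq0.le, mul_assoc]
    _ ≤ _ := by
        gcongr
        rw [inv_mul_le_iff₀ hq0, Real.sqrt_le_left (by positivity), mul_pow]
        have h1 : (1 : ℝ) ≤ ((Fintype.card F : ℝ) * (9 / 16)) ^ d := one_le_pow₀ (by linarith)
        rw [mul_pow] at h1
        have h2 : ((3 / 4 : ℝ) ^ d) ^ 2 = (9 / 16) ^ d := by
          rw [← pow_mul, mul_comm, pow_mul]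
          norm_num
        rw [h2]
        nlinarith

/-- Kátai's orthogonality criterion, uniformly over a family of functions. -/
lemma exists_forall_norm_expect_le {ν : F[X] → ℂ} (hν : IsMultFn ν) (hνb : ∀ g, ‖ν g‖ ≤ 1)
    {ι : Type*} {f : ι → F[X] → ℂ} (hf : ∀ i g, ‖f i g‖ ≤ 1) (β : F[X] → F[X] → ℕ → ℝ)
    (hβ : ∀ i p p' n, ‖𝔼 g ∈ polyBall F n, f i (p * g) * conj (f i (p' * g))‖ ≤ β p p' n)
    (B : ℕ) (hB : ∀ d p, ∀ S : Finset F[X], (∀ p' ∈ S, p'.Monic ∧ Irreducible p' ∧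
      p'.natDegree = d ∧ ¬ Tendsto (β p p') atTop (nhds 0)) → S.card ≤ B) {ε : ℝ} (hε : 0 < ε) :
    ∃ N₀, ∀ N ≥ N₀, ∀ i, ‖𝔼 g ∈ polyBall F N, ν g * f i g‖ ≤ ε := by
  classical
  set C : ℝ := 2 + 3 * √(B + 1) with hC
  have hC0 : 0 ≤ C := by positivity
  obtain ⟨D, hD⟩ := exists_le_primeMass F (max 1 (((1 + C) / ε) ^ 2))
  set A := primeMass F D with hA
  have hA1 : 1 ≤ A := (le_max_left _ _).trans hD
  have hAε : 1 + C ≤ ε * √A := by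
    have h1 : (1 + C) / ε ≤ √A := Real.le_sqrt_of_sq_le ((le_max_right _ _).trans hD)
    rwa [div_le_iff₀' hε] at h1
  have hev : ∀ᶠ N : ℕ in atTop, ∀ d ∈ Finset.Icc 1 D, ∀ p ∈ primesLE F D,
      ∑ p' ∈ (primesLE F D).filter (fun p' => p'.natDegree = d ∧
        Tendsto (β p p') atTop (nhds 0)), β p p' (N - d) ≤ 1 := by
    rw [Filter.eventually_all_finset]
    intro d _
    rw [Filter.eventually_all_finset]
    intro p _
    have h1 := tendsto_finsetSum ((primesLE F D).filter (fun p' => p'.natDegree = d ∧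
        Tendsto (β p p') atTop (nhds 0))) (f := fun p' (N : ℕ) => β p p' (N - d)) (a := fun _ => 0)
        fun p' hp' => (Finset.mem_filter.mp hp').2.2.comp (tendsto_sub_atTop_nat d)
    rw [Finset.sum_const_zero] at h1
    exact h1.eventually (ge_mem_nhds one_pos)
  obtain ⟨N₀, hN₀⟩ := (hev.and (eventually_ge_atTop (2 * D))).exists_forall_of_atTop
  refine ⟨N₀, fun N hN i => ?_⟩
  obtain ⟨hN1, hN2⟩ := hN₀ N hN
  have hone : ∀ p p' n, ‖𝔼 g ∈ polyBall F n, f i (p * g) * conj (f i (p' * g))‖ ≤ 1 := by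
    intro p p' n
    refine (RCLike.norm_expect_le (K := ℂ)).trans
      (Finset.expect_le (isFinSub_polyBall n).nonempty fun g _ => ?_)
    rw [norm_mul, RCLike.norm_conj]
    exact mul_le_one₀ (hf _ _) (norm_nonneg _) (hf _ _)
  have hinner : ∀ d ∈ Finset.Icc 1 D, ∀ p ∈ primesLE F D,
      ∑ p' ∈ primesLE F D with p'.natDegree = d,
        ‖𝔼 g ∈ polyBall F (N - d), f i (p * g) * conj (f i (p' * g))‖ ≤ B + 1 := by
    intro d hd p hp
    rw [← Finset.sum_filter_not_add_sum_filter _ fun p' => Tendsto (β p p') atTop (nhds 0)]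
    refine add_le_add ?_ ?_
    · refine (Finset.sum_le_card_nsmul _ _ 1 fun p' _ => hone p p' _).trans ?_
      rw [nsmul_eq_mul, mul_one, Nat.cast_le]
      refine hB d p _ fun p' hp' => ?_
      rw [Finset.mem_filter, Finset.mem_filter, mem_primesLE] at hp'
      exact ⟨hp'.1.1.2.1, hp'.1.1.2.2, hp'.1.2, hp'.2⟩
    · rw [Finset.filter_filter]
      exact (Finset.sum_le_sum fun p' _ => hβ i p p' _).trans (hN1 d hd p hp)
  have hmain := primeMass_mul_norm_expect_le hν hνb (hf i) hN2
  have hsum : ∑ d ∈ Finset.Icc 1 D, ((Fintype.card F : ℝ) ^ d)⁻¹ *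
        √(∑ p ∈ primesLE F D with p.natDegree = d, ∑ p' ∈ primesLE F D with p'.natDegree = d,
          ‖𝔼 g ∈ polyBall F (N - d), f i (p * g) * conj (f i (p' * g))‖) ≤ 3 * √(B + 1) := by
    calc _ ≤ ∑ d ∈ Finset.Icc 1 D, (3 / 4 : ℝ) ^ d * √(B + 1) := by
          refine Finset.sum_le_sum fun d hd => inv_pow_mul_sqrt_le d B ?_
          refine (Finset.sum_le_card_nsmul _ _ _ fun p hp =>
            hinner d hd p (Finset.mem_filter.mp hp).1).trans ?_
          rw [nsmul_eq_mul]
          gcongr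
          exact_mod_cast card_primes_le D d
      _ ≤ _ := by
          rw [← Finset.sum_mul]
          gcongr
          have h1 : ∀ D : ℕ, ∑ d ∈ Finset.Icc 1 D, (3 / 4 : ℝ) ^ d = 3 - 3 * (3 / 4) ^ D := by
            intro D
            induction D with
            | zero => simp
            | succ D ih =>
              rw [Finset.sum_Icc_succ_top (by omega), ih]
              ring
          rw [h1]
          linarith [pow_pos (show (0 : ℝ) < 3 / 4 by norm_num) D]
  have hs1 : 1 ≤ √A := Real.one_le_sqrt.mpr hA1
  have hs2 : √A * √A = A := Real.mul_self_sqrt (by linarith)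
  refine le_of_mul_le_mul_left ?_ (show 0 < A by linarith)
  calc _ ≤ √A + C := by linarith
    _ ≤ √A * (1 + C) := by nlinarith
    _ ≤ √A * (ε * √A) := by gcongr
    _ = A * ε := by rw [mul_left_comm, hs2, mul_comm]

end AsymptoticKatai

lemma update_fin_one {U : Type*} (f : Fin 1 → U) (a : U) :
    Function.update f 0 a = fun _ => a := by
  ext i
  simp [Subsingleton.elim i 0]

section Shift

variable {F : Type*} [Field F] {U : Type*} [AddCommGroup U] {m n : ℕ}

lemma diffs_shift (k : Fin m → U) (v : U) (R : U → F) (u : U) :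
    diffs k (fun x => R (x + v)) u = diffs k R (u + v) := by
  unfold diffs
  induction List.ofFn k generalizing u with
  | nil => rfl
  | cons b l ih => simp only [List.foldr_cons, Δop, ih, add_right_comm]

lemma DegLT.shift {R : U → F} (h : DegLT n R) (v : U) : DegLT n (fun x => R (x + v)) :=
  fun k u => by rw [diffs_shift, h]

lemma leading_shift {R : U → F} (h : DegLT (m + 1) R) (v : U) :
    leading (fun x => R (x + v)) (h.shift v) = leading R h := by
  ext k
  rw [leading_apply _ _ 0, diffs_shift, leading_apply h]

lemma map_add_fin_one (T : MultilinearMap ℤ (fun _ : Fin 1 => U) F)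
    (a b : Fin 1 → U) : T (a + b) = T a + T b := by
  have h := T.map_update_add 0 0 (a 0) (b 0)
  have hc : ∀ c : Fin 1 → U, (fun _ => c 0) = c := fun c => by
    ext i
    rw [Subsingleton.elim i 0]
  simp only [update_fin_one, hc] at h
  rw [← h]
  congr 1
  ext i
  simp [Subsingleton.elim i 0]

end Shift

section Slice

variable {F : Type*} [Field F] {V H : Type*} [AddCommGroup V] [AddCommGroup H] {m n : ℕ}

/-- The restriction of a form on `V × H` to `V`. -/
def slice (T : MultilinearMap ℤ (fun _ : Fin m => V × H) F) :
    MultilinearMap ℤ (fun _ : Fin m => V) F :=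
  T.compLinearMap fun _ => (AddMonoidHom.inl V H).toIntLinearMap

lemma DegLT.slice {R : V × H → F} (h : DegLT n R) (y : H) : DegLT n (fun g => R (g, y)) := by
  have := (h.shift (0, y)).comp (AddMonoidHom.inl V H)
  simpa using this

lemma leading_slice {R : V × H → F} (h : DegLT (m + 1) R) (y : H) :
    leading (fun g => R (g, y)) (h.slice y) = slice (leading R h) := by
  have := leading_comp (h.shift (0, y)) (AddMonoidHom.inl V H)
  rw [leading_shift h] at this
  rw [_root_.slice, ← this]
  simp

end Slice

section Aperiodic

variable {F : Type*} [Field F] [Fintype F]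

lemma one_div_mul_sum_polyOf (n : ℕ) (f : F[X] → ℂ) :
    (1 / (Fintype.card F : ℂ) ^ n) * ∑ c : Fin n → F, f (polyOf c) = 𝔼 g ∈ polyBall F n, f g := by
  rw [sum_polyOf, Finset.expect_eq_sum_div_card, card_polyBall]
  push_cast
  ring

lemma IsAperiodicFn.tendsto_expect {ν : F[X] → ℂ} (h : IsAperiodicFn ν) {s : F[X]} (hs : s ≠ 0)
    (χ : F[X] → ℂ) (hχ : ∀ g k, χ (g + s * k) = χ g) :
    Tendsto (fun n => 𝔼 g ∈ polyBall F n, ν g * χ g) atTop (nhds 0) := by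
  have h1 := h s hs fun x => conj (χ x.out)
  refine h1.congr fun n => ?_
  rw [← one_div_mul_sum_polyOf]
  congr 1
  refine Finset.sum_congr rfl fun c _ => ?_
  rw [Complex.conj_conj]
  congr 1
  have h2 : Ideal.Quotient.mk (Ideal.span {s})
      (Ideal.Quotient.mk (Ideal.span {s}) (polyOf c)).out =
        Ideal.Quotient.mk (Ideal.span {s}) (polyOf c) := Quotient.out_eq _
  rw [Ideal.Quotient.eq, Ideal.mem_span_singleton] at h2
  obtain ⟨k, hk⟩ := h2
  rw [sub_eq_iff_eq_add'] at hk
  rw [hk, hχ]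

end Aperiodic

section Unbiased

variable {F : Type*} [Field F] [Fintype F] {ψ : AddChar F ℂ} {H : Type*} [AddCommGroup H]
  {𝓗 : Filtr H} {m : ℕ} {R : F[X] × H → F}

lemma expect_prod_filtr {U U' : Type*} [AddCommGroup U] [AddCommGroup U'] {M : Type*}
    [AddCommMonoid M] [Module ℚ≥0 M] (𝓤 : Filtr U) (𝓤' : Filtr U') (n : ℕ) (f : U × U' → M) :
    𝔼 u ∈ 𝓤.prod 𝓤' n, f u = 𝔼 g ∈ 𝓤 n, 𝔼 h ∈ 𝓤' n, f (g, h) :=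
  Finset.expect_product _ _ _

lemma tendsto_of_few_equivalent {ν : F[X] → ℂ} (hν : IsMultFn ν) (hνb : ∀ g, ‖ν g‖ ≤ 1)
    (hm : m ≠ 0) (hR : DegLT (m + 1) R) (B : ℕ)
    (hB : ∀ d p, ∀ S : Finset F[X], (∀ p' ∈ S, p'.Monic ∧ Irreducible p' ∧ p'.natDegree = d ∧
      Biased ψ (polyFiltr F) (scaled (slice (leading R hR)) (fun _ => p') -
        scaled (slice (leading R hR)) fun _ => p)) → S.card ≤ B) :
    Tendsto (fun n => 𝔼 u ∈ (polyFiltr F).prod 𝓗 n, ν u.1 * ψ (R u)) atTop (nhds 0) := by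
  set T := slice (leading R hR) with hT
  have hexp : (0 : ℝ) < ((2 ^ m : ℕ) : ℝ)⁻¹ := by positivity
  have hdeg : ∀ y p p', ∃ h : DegLT (m + 1) (fun g => R (p * g, y) - R (p' * g, y)),
      leading _ h = scaled T (fun _ => p) - scaled T fun _ => p' := by
    intro y p p'
    refine ⟨((hR.slice y).comp (AddMonoidHom.mulLeft p)).sub
      ((hR.slice y).comp (AddMonoidHom.mulLeft p')), ?_⟩
    refine (leading_sub ((hR.slice y).comp (AddMonoidHom.mulLeft p))
      ((hR.slice y).comp (AddMonoidHom.mulLeft p'))).trans ?_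
    rw [leading_comp (hR.slice y), leading_comp (hR.slice y), leading_slice]
    rfl
  have hkatai := fun ε (hε : 0 < ε) => exists_forall_norm_expect_le hν hνb
    (f := fun y g => ψ (R (g, y))) (fun y g => (AddChar.norm_apply ψ _).le)
    (fun p p' n => bias ψ (polyBall F n) (scaled T (fun _ => p) - scaled T fun _ => p') ^
      ((2 ^ m : ℕ) : ℝ)⁻¹) (by
      intro y p p' n
      obtain ⟨h, hlead⟩ := hdeg y p p'
      rw [← hlead]
      have h1 := norm_expect_pow_le_bias ψ (isFinSub_polyBall (F := F) n) hm h
      have h2 := Real.rpow_le_rpow (by positivity) h1 hexp.le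
      rw [Real.pow_rpow_inv_natCast (norm_nonneg _) (by positivity)] at h2
      refine le_trans (le_of_eq ?_) h2
      congr 1
      refine Finset.expect_congr rfl fun g _ => ?_
      rw [sub_eq_add_neg, AddChar.map_add_eq_mul, AddChar.map_neg_eq_conj])
    B (by
      intro d p S hS
      refine hB d p S fun p' hp' => ?_
      obtain ⟨h1, h2, h3, h4⟩ := hS p' hp'
      refine ⟨h1, h2, h3, ?_⟩
      by_contra hcon
      refine h4 ?_
      have h5 : ¬ Biased ψ (polyFiltr F) (scaled T (fun _ => p) - scaled T fun _ => p') :=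
        fun h => hcon (by simpa using h.neg)
      have h6 := (tendsto_bias_of_not_biased h5).rpow_const (p := ((2 ^ m : ℕ) : ℝ)⁻¹)
        (Or.inr hexp.le)
      rwa [Real.zero_rpow hexp.ne'] at h6) hε
  rw [tendsto_zero_iff_norm_tendsto_zero, Metric.tendsto_atTop]
  intro ε hε
  obtain ⟨N₀, hN₀⟩ := hkatai (ε / 2) (half_pos hε)
  refine ⟨N₀, fun n hn => ?_⟩
  rw [Real.dist_eq, sub_zero, abs_norm, expect_prod_filtr, Finset.expect_comm]
  refine lt_of_le_of_lt ((RCLike.norm_expect_le (K := ℂ)).trans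
    (Finset.expect_le (𝓗.isFinSub n).nonempty fun y _ => hN₀ n hn y)) (half_lt_self hε)

lemma char_eq_one_of_biased {T : MultilinearMap ℤ (fun _ : Fin 1 => F[X]) F}
    (hT : Biased ψ (polyFiltr F) T) (g : F[X]) : ψ (T fun _ => g) = 1 := by
  obtain ⟨δ, hδ, h⟩ := hT
  obtain ⟨n, hn⟩ : ∃ n, g ∈ polyFiltr F n :=
    ⟨g.natDegree + 1, mem_polyFiltr.mpr (Polynomial.degree_lt_iff_coeff_zero _ _ |>.mpr
      fun k hk => Polynomial.coeff_eq_zero_of_natDegree_lt hk)⟩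
  rcases (((polyFiltr F).isFinSub n).pi 1).expect_char (fun k => ψ (T k))
    (fun a b => by rw [map_add_fin_one, AddChar.map_add_eq_mul]) with h1 | h1
  · exact h1.1 _ (Fintype.mem_piFinset.mpr fun _ => hn)
  · have h2 := h n
    rw [bias, h1, norm_zero] at h2
    exact absurd h2 (not_le.mpr hδ)

lemma tendsto_of_torsion {ν : F[X] → ℂ} (hap : IsAperiodicFn ν) (hR : DegLT 2 R) {s : F[X]}
    (hs : s ≠ 0) (hb : Biased ψ (polyFiltr F) (scaled (slice (leading R hR)) fun _ => s)) :
    Tendsto (fun n => 𝔼 u ∈ (polyFiltr F).prod 𝓗 n, ν u.1 * ψ (R u)) atTop (nhds 0) := by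
  set T := slice (leading R hR) with hT
  have hadd : ∀ g y, R (g, y) = R (0, y) + T fun _ => g := by
    intro g y
    rw [hT, ← leading_slice hR y, leading_apply _ _ 0]
    simp [diffs, Δop]
  have hTadd : ∀ g k, T (fun _ => g + k) = T (fun _ => g) + T fun _ => k :=
    fun g k => map_add_fin_one T (fun _ => g) fun _ => k
  have h1 := hap.tendsto_expect hs (fun g => ψ (T fun _ => g)) (by
    intro g k
    rw [hTadd, AddChar.map_add_eq_mul]
    have := char_eq_one_of_biased hb k
    rw [scaled_apply] at this
    rw [show (fun _ : Fin 1 => s * k) = (fun _ => s) * (fun _ => k) from rfl, this, mul_one])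
  rw [tendsto_zero_iff_norm_tendsto_zero] at h1 ⊢
  refine squeeze_zero (fun _ => norm_nonneg _) (fun n => ?_) h1
  have h2 : 𝔼 u ∈ (polyFiltr F).prod 𝓗 n, ν u.1 * ψ (R u) =
      𝔼 y ∈ 𝓗 n, ψ (R (0, y)) * 𝔼 g ∈ polyBall F n, ν g * ψ (T fun _ => g) := by
    rw [expect_prod_filtr, Finset.expect_comm]
    refine Finset.expect_congr rfl fun y _ => ?_
    rw [Finset.mul_expect]
    refine Finset.expect_congr rfl fun g _ => ?_
    rw [hadd, AddChar.map_add_eq_mul]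
    ring
  rw [h2]
  refine (RCLike.norm_expect_le (K := ℂ)).trans
    (Finset.expect_le (𝓗.isFinSub n).nonempty fun y _ => ?_)
  rw [norm_mul, AddChar.norm_apply, one_mul]

/-- The case where the leading form is unbiased along the polynomial variable. -/
lemma tendsto_of_slice_not_biased {ν : F[X] → ℂ} (hν : IsMultFn ν) (hνb : ∀ g, ‖ν g‖ ≤ 1)
    (hap : IsAperiodicFn ν) (hm : m ≠ 0) (hR : DegLT (m + 1) R)
    (hb : ¬ Biased ψ (polyFiltr F) (slice (leading R hR))) :
    Tendsto (fun n => 𝔼 u ∈ (polyFiltr F).prod 𝓗 n, ν u.1 * ψ (R u)) atTop (nhds 0) := by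
  match m, hm, hR, hb with
  | 1, hm, hR, hb =>
    by_cases htors : ∃ s ≠ 0, Biased ψ (polyFiltr F) (scaled (slice (leading R hR)) fun _ => s)
    · obtain ⟨s, hs, hsb⟩ := htors
      exact tendsto_of_torsion hap hR hs hsb
    push Not at htors
    refine tendsto_of_few_equivalent hν hνb hm hR 1 fun d p S hS => ?_
    rw [← Finset.card_singleton p]
    refine Finset.card_le_card fun p' hp' => ?_
    rw [Finset.mem_singleton]
    by_contra hne
    refine htors (p' - p) (sub_ne_zero.mpr hne) ?_
    have h1 := (hS p' hp').2.2.2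
    set T := slice (leading R hR)
    have h2 := scaled_update_add T 0 0 (p' - p) p
    simp only [sub_add_cancel, update_fin_one] at h2
    rwa [h2, add_sub_cancel_right] at h1
  | m + 2, hm, hR, hb =>
    exact tendsto_of_few_equivalent hν hνb hm hR (m + 2) fun d p S hS =>
      card_le_of_equivalent (i := 0) (j := 1) (by simp) hb S p hS

end Unbiased

section Mixed

variable {F : Type*} [Field F] [Fintype F] {ψ : AddChar F ℂ} {H : Type*} [AddCommGroup H]
  {𝓗 : Filtr H} {m : ℕ} {R : F[X] × H → F}

lemma norm_expect_sq_le_double {ν : F[X] → ℂ} (hνb : ∀ g, ‖ν g‖ ≤ 1) (n : ℕ) :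
    ‖𝔼 u ∈ (polyFiltr F).prod 𝓗 n, ν u.1 * ψ (R u)‖ ^ 2 ≤
      ‖𝔼 u ∈ (polyFiltr F).prod (𝓗.prod 𝓗) n, ψ (R (u.1, u.2.1) - R (u.1, u.2.2))‖ := by
  have h1 : ∀ g, ((‖𝔼 y ∈ 𝓗 n, ψ (R (g, y))‖ ^ 2 : ℝ) : ℂ) =
      𝔼 y ∈ (𝓗.prod 𝓗) n, ψ (R (g, y.1) - R (g, y.2)) := by
    intro g
    have hc : conj (𝔼 y ∈ 𝓗 n, ψ (R (g, y))) = 𝔼 y ∈ 𝓗 n, ψ (-R (g, y)) := by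
      simp only [Finset.expect_eq_sum_div_card, map_div₀, map_sum, map_natCast,
        AddChar.map_neg_eq_conj]
    rw [← Complex.normSq_eq_norm_sq, ← Complex.mul_conj, hc, Finset.expect_mul_expect,
      expect_prod_filtr]
    simp only [sub_eq_add_neg, AddChar.map_add_eq_mul]
  rw [expect_prod_filtr, expect_prod_filtr]
  refine (norm_expect_sq_le _ _).trans ?_
  calc _ ≤ 𝔼 g ∈ polyFiltr F n, ‖𝔼 y ∈ 𝓗 n, ψ (R (g, y))‖ ^ 2 := by
        refine Finset.expect_le_expect fun g _ => ?_
        dsimp only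
        rw [← Finset.mul_expect, norm_mul]
        gcongr
        exact mul_le_of_le_one_left (norm_nonneg _) (hνb g)
    _ = ‖((𝔼 g ∈ polyFiltr F n, ‖𝔼 y ∈ 𝓗 n, ψ (R (g, y))‖ ^ 2 : ℝ) : ℂ)‖ := by
        rw [Complex.norm_real, Real.norm_of_nonneg]
        exact Finset.expect_nonneg fun g _ => by positivity
    _ = _ := by
        refine congrArg norm ((RCLike.ofReal_expect (K := ℂ) _ _).trans ?_)
        exact Finset.expect_congr rfl fun g _ => h1 g

/-- The case where the leading form is biased along the polynomial variable, but unbiased. -/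
lemma tendsto_of_slice_biased {ν : F[X] → ℂ} (hνb : ∀ g, ‖ν g‖ ≤ 1) (hm : m ≠ 0)
    (hR : DegLT (m + 1) R) (hb : Biased ψ (polyFiltr F) (slice (leading R hR)))
    (hb' : ¬ Biased ψ ((polyFiltr F).prod 𝓗) (leading R hR)) :
    Tendsto (fun n => 𝔼 u ∈ (polyFiltr F).prod 𝓗 n, ν u.1 * ψ (R u)) atTop (nhds 0) := by
  set a : F[X] × H × H →+ F[X] × H := (AddMonoidHom.id F[X]).prodMap (AddMonoidHom.fst H H)
  set b : F[X] × H × H →+ F[X] × H := (AddMonoidHom.id F[X]).prodMap (AddMonoidHom.snd H H)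
  have hd : DegLT (m + 1) (fun u => R (a u) - R (b u)) := (hR.comp a).sub (hR.comp b)
  have hlead : leading _ hd = (leading R hR).compLinearMap (fun _ => a.toIntLinearMap) -
      (leading R hR).compLinearMap (fun _ => b.toIntLinearMap) := by
    rw [← leading_comp, ← leading_comp]
    exact leading_sub _ _
  have hnb : ¬ Biased ψ ((polyFiltr F).prod (𝓗.prod 𝓗)) (leading _ hd) := by
    intro h
    refine hb' ?_
    set j : F[X] × H →+ F[X] × H × H := (AddMonoidHom.id F[X]).prodMap (AddMonoidHom.inl H H)
    have h1 := h.compLinearMap (𝓤' := (polyFiltr F).prod 𝓗) (fun _ => j.toIntLinearMap) 0 (by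
      rintro i n ⟨g, y⟩ hx
      simp only [Filtr.prod, Finset.mem_product, add_zero] at hx ⊢
      exact ⟨hx.1, hx.2, (𝓗.isFinSub n).zero_mem⟩)
    have h2 := hb.compLinearMap (𝓤' := (polyFiltr F).prod 𝓗)
      (fun _ => (AddMonoidHom.fst F[X] H).toIntLinearMap) 0 (by
      intro i n x hx
      simp only [Filtr.prod, Finset.mem_product, add_zero] at hx ⊢
      exact hx.1)
    have h3 := h1.add h2
    convert h3 using 1
    ext k
    rw [hlead]
    exact (sub_add_cancel _ _).symm
  have h1 := tendsto_expect_of_not_biased hm hd hnb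
  rw [tendsto_zero_iff_norm_tendsto_zero]
  have h2 : Tendsto (fun n => ‖𝔼 u ∈ (polyFiltr F).prod 𝓗 n, ν u.1 * ψ (R u)‖ ^ 2)
      atTop (nhds 0) :=
    squeeze_zero (fun _ => by positivity) (fun n => norm_expect_sq_le_double hνb n) h1
  simpa using h2.sqrt

end Mixed

section Reduction

variable {F : Type*} [Field F] {U : Type*} [AddCommGroup U] {m : ℕ}

lemma expect_piecewise {M : Type*} [AddCommMonoid M] [Module ℚ≥0 M] {K : Finset U}
    (hK : IsFinSub K) (S : Finset (Fin m)) {u : U} (hu : u ∈ K) (f : (Fin m → U) → M) :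
    𝔼 w ∈ Fintype.piFinset (fun _ : Fin m => K), f (S.piecewise (fun i => u + w i) fun i => -w i) =
      𝔼 k ∈ Fintype.piFinset (fun _ : Fin m => K), f k := by
  refine Finset.expect_nbij' (fun w => S.piecewise (fun i => u + w i) fun i => -w i)
    (fun k => S.piecewise (fun i => k i - u) fun i => -k i) ?_ ?_ ?_ ?_ (fun _ _ => rfl)
  · intro w hw
    rw [Fintype.mem_piFinset] at *
    intro i
    by_cases hi : i ∈ S
    · simpa [hi] using hK.add_mem hu (hw i)
    · simpa [hi] using hK.neg_mem (hw i)
  · intro w hw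
    rw [Fintype.mem_piFinset] at *
    intro i
    by_cases hi : i ∈ S
    · simpa [hi] using hK.sub_mem _ (hw i) _ hu
    · simpa [hi] using hK.neg_mem (hw i)
  · intro w _
    ext i
    by_cases hi : i ∈ S <;> simp [hi]
  · intro w _
    ext i
    by_cases hi : i ∈ S <;> simp [hi]

/-- The map `(u, w) ↦ (u + w i if i ∈ S, -w i otherwise)`. -/
def mixMap (S : Finset (Fin m)) : U × (Fin m → U) →+ (Fin m → U) :=
  AddMonoidHom.mk' (fun x => S.piecewise (fun i => x.1 + x.2 i) fun i => -x.2 i) fun x y => by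
    ext i
    by_cases hi : i ∈ S <;> simp [hi] <;> abel

lemma sum_mixMap (T : MultilinearMap ℤ (fun _ : Fin m => U) F) (u : U) (w : Fin m → U) :
    ∑ S, T (mixMap S (u, w)) = T fun _ => u := by
  have := T.map_add_univ (fun i => u + w i) fun i => -w i
  simp only [mixMap, AddMonoidHom.mk'_apply]
  rw [← this]
  congr 1
  ext i
  simp

lemma exists_int_mul_factorial_eq_one [Finite F] (hm : m < ringChar F) :
    ∃ c : ℤ, (c : F) * (m.factorial : F) = 1 := by
  have hp : (ringChar F).Prime := CharP.char_is_prime F (ringChar F)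
  have hco : m.factorial.Coprime (ringChar F) :=
    (hp.coprime_iff_not_dvd.mpr fun h => by
      have := (hp.dvd_factorial).mp h
      omega).symm
  have h1 := Nat.gcd_eq_gcd_ab m.factorial (ringChar F)
  rw [hco] at h1
  refine ⟨Nat.gcdA m.factorial (ringChar F), ?_⟩
  have h2 := congrArg (Int.cast : ℤ → F) h1
  push_cast at h2
  rw [ringChar.Nat.cast_ringChar, zero_mul, add_zero] at h2
  rw [mul_comm, ← h2]

end Reduction

section Induction

universe u

variable {F : Type u} [Field F] [Fintype F] {ψ : AddChar F ℂ} {ν : F[X] → ℂ}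

/-- The case where the leading form is biased reduces to lower degree. -/
lemma tendsto_of_biased {H : Type u} [AddCommGroup H] {𝓗 : Filtr H} {m : ℕ} {R : F[X] × H → F}
    (hνb : ∀ g, ‖ν g‖ ≤ 1) (hm : m < ringChar F)
    (ih : ∀ (H : Type u) [AddCommGroup H] (𝓗 : Filtr H) (R : F[X] × H → F), DegLT m R →
      Tendsto (fun n => 𝔼 u ∈ (polyFiltr F).prod 𝓗 n, ν u.1 * ψ (R u)) atTop (nhds 0))
    (hR : DegLT (m + 1) R) (hb : Biased ψ ((polyFiltr F).prod 𝓗) (leading R hR)) :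
    Tendsto (fun n => 𝔼 u ∈ (polyFiltr F).prod 𝓗 n, ν u.1 * ψ (R u)) atTop (nhds 0) := by
  obtain ⟨c, hc⟩ := exists_int_mul_factorial_eq_one (F := F) hm
  set T := c • leading R hR with hT
  set 𝓤 := (polyFiltr F).prod 𝓗 with h𝓤
  set 𝓗' := 𝓗.prod (𝓤.pi m) with h𝓗'
  set 𝓧 := (polyFiltr F).prod 𝓗' with h𝓧
  have hTb : Biased ψ 𝓤 T := AddSubgroup.zsmul_mem (biasedSubgroup ψ 𝓤) hb c
  let π : F[X] × H × (Fin m → F[X] × H) →+ (F[X] × H) × (Fin m → F[X] × H) :=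
    (AddEquiv.prodAssoc (M := F[X]) (N := H) (P := Fin m → F[X] × H)).symm.toAddMonoidHom
  have hπ : ∀ g y w, π (g, (y, w)) = ((g, y), w) := fun _ _ _ => rfl
  have hred : ∀ (𝒮 : Finset (Finset (Fin m))) (Q : F[X] × H × (Fin m → F[X] × H) → F), DegLT m Q →
      Tendsto (fun n => 𝔼 x ∈ 𝓧 n, ν x.1 * ψ (Q x + ∑ S ∈ 𝒮, T (mixMap S (π x))))
        atTop (nhds 0) := by
    intro 𝒮
    induction 𝒮 using Finset.induction_on with
    | empty =>
      intro Q hQ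
      simpa using ih _ 𝓗' Q hQ
    | insert S 𝒮 hS ih' =>
      intro Q hQ
      have h1 := tendsto_expect_of_biased 𝓧 hTb (fun x => mixMap S (π x)) (by
        intro n f
        rw [h𝓧, expect_prod_filtr]
        rw [← Finset.expect_const ((polyFiltr F).isFinSub n).nonempty (𝔼 k ∈ 𝓤.pi m n, f k)]
        refine Finset.expect_congr rfl fun g hg => ?_
        rw [h𝓗', expect_prod_filtr]
        rw [← Finset.expect_const (𝓗.isFinSub n).nonempty (𝔼 k ∈ 𝓤.pi m n, f k)]
        refine Finset.expect_congr rfl fun y hy => ?_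
        exact expect_piecewise (𝓤.isFinSub n) S (Finset.mk_mem_product hg hy) f)
        (fun x => ν x.1 * ψ (Q x + ∑ S ∈ 𝒮, T (mixMap S (π x)))) (fun x => by
          rw [norm_mul, AddChar.norm_apply, mul_one]
          exact hνb _) (fun k => by
          refine (ih' _ (hQ.add (degLT_sub_shift T ((mixMap S).comp π) k))).congr fun n => ?_
          refine Finset.expect_congr rfl fun x _ => ?_
          rw [mul_assoc, ← AddChar.map_add_eq_mul]
          congr 2
          simp only [AddMonoidHom.comp_apply]
          ring)
      refine h1.congr fun n => Finset.expect_congr rfl fun x _ => ?_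
      rw [mul_assoc, ← AddChar.map_add_eq_mul, Finset.sum_insert hS]
      congr 2
      ring
  have h1 := hred Finset.univ _
    ((degLT_sub_leading hR hc).comp ((AddMonoidHom.fst _ _).comp π))
  refine h1.congr fun n => ?_
  rw [h𝓧, h𝓤, expect_prod_filtr, expect_prod_filtr]
  refine Finset.expect_congr rfl fun g _ => ?_
  rw [h𝓗', expect_prod_filtr]
  refine Finset.expect_congr rfl fun y _ => ?_
  rw [← Finset.expect_const ((𝓤.pi m).isFinSub n).nonempty (ν (g, y).1 * ψ (R (g, y)))]
  refine Finset.expect_congr rfl fun w _ => ?_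
  simp only [hπ, sum_mixMap, AddMonoidHom.comp_apply, AddMonoidHom.coe_fst]
  rw [← hT, sub_add_cancel]

lemma tendsto_expect_mul_char (hν : IsMultFn ν) (hνb : ∀ g, ‖ν g‖ ≤ 1) (hap : IsAperiodicFn ν)
    (m : ℕ) (hm : m < ringChar F) (H : Type u) [AddCommGroup H] (𝓗 : Filtr H)
    (R : F[X] × H → F) (hR : DegLT (m + 1) R) :
    Tendsto (fun n => 𝔼 u ∈ (polyFiltr F).prod 𝓗 n, ν u.1 * ψ (R u)) atTop (nhds 0) := by
  induction m generalizing H with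
  | zero =>
    have h1 := (hap.tendsto_expect one_ne_zero 1 fun _ _ => rfl).mul_const (ψ (R 0))
    rw [zero_mul] at h1
    refine h1.congr fun n => ?_
    rw [expect_prod_filtr, Finset.expect_mul]
    refine Finset.expect_congr rfl fun g _ => ?_
    rw [← Finset.expect_const (𝓗.isFinSub n).nonempty (_ * ψ (R 0))]
    refine Finset.expect_congr rfl fun y _ => ?_
    have h2 := hR (fun _ => (g, y)) 0
    simp only [diffs, List.ofFn_succ, List.ofFn_zero, List.foldr_cons, List.foldr_nil, Δop, zero_add,
      sub_eq_zero] at h2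
    rw [h2, Pi.one_apply, mul_one]
  | succ m ih =>
    by_cases hb : Biased ψ ((polyFiltr F).prod 𝓗) (leading R hR)
    · exact tendsto_of_biased hνb hm (fun H _ 𝓗 R hR => ih (by omega) H 𝓗 R hR) hR hb
    by_cases hb' : Biased ψ (polyFiltr F) (slice (leading R hR))
    · exact tendsto_of_slice_biased hνb m.succ_ne_zero hR hb' hb
    · exact tendsto_of_slice_not_biased hν hνb hap m.succ_ne_zero hR hb'

end Induction

/-- The trivial filtration of the trivial group. -/
def trivialFiltr : Filtr PUnit where
  carrier _ := {0}
  isFinSub _ := ⟨by simp, by simp⟩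
  mono := monotone_const

theorem stmt0 {F : Type*} [Field F] [Fintype F]
    (ν : Polynomial F → ℂ) (hν : IsMultFn ν) (hνb : ∀ g, ‖ν g‖ ≤ 1)
    (hap : IsAperiodicFn ν)
    (m : ℕ) (hm : 0 < m) (hmp : m < ringChar F)
    (P : Polynomial F → F) (hP : DegLE P m)
    (α : F → ℂ) (hαadd : ∀ a b, α (a + b) = α a * α b)
    (hα1 : ∀ a, ‖α a‖ = 1) :
    Tendsto (fun n : ℕ => (1 / (Fintype.card F : ℂ) ^ n) *
        ∑ c : Fin n → F, ν (polyOf c) * α (P (polyOf c)))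
      atTop (nhds 0) := by
  have hα0 : α 0 = 1 := by
    have h1 := hαadd 0 0
    rw [add_zero] at h1
    have h2 : α 0 ≠ 0 := norm_ne_zero_iff.mp (by rw [hα1]; exact one_ne_zero)
    exact (mul_eq_left₀ h2).mp h1.symm
  let ψ : AddChar F ℂ := ⟨α, hα0, hαadd⟩
  have hP' : DegLT (m + 1) P := hP
  have h := tendsto_expect_mul_char (ψ := ψ) hν hνb hap m hmp PUnit trivialFiltr
    (fun u => P u.1) (hP'.comp (AddMonoidHom.fst F[X] PUnit))
  refine h.congr fun n => ?_
  rw [one_div_mul_sum_polyOf n fun g => ν g * α (P g), expect_prod_filtr]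
  exact Finset.expect_congr rfl fun g _ => Finset.expect_const (trivialFiltr.isFinSub n).nonempty _
end

section
/- (Katai's criterion for 𝔽_q[x].) Let ν : 𝔽_q[x] → ℂ be a 1-bounded multiplicative function, let f : 𝔽_q[x] → ℂ be 1-bounded, and let φ : ℕ → ℝ_{≥0} tend to infinity with φ(n) + φ(n)² ≤ n/2 for all sufficiently large n. For k ∈ ℕ let P_k = {g ∈ 𝔽_q[x] : g monic irreducible, k ≤ deg g ≤ k+1}. Suppose that for every ε > 0 there exists N such that for all n ≥ N and all integers k with φ(n) ≤ k ≤ φ(n) + φ(n)², one has ∑_{a,b ∈ P_k} | ∑_{g ∈ G_{min(n−deg a, n−deg b)}} f(ag)·conj(f(bg)) | ≤ ε·|P_k|²·q^{n−k}. Then (1/q^n)·∑_{g∈G_n} ν(g)·f(g) → 0 as n → ∞. -/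
open Polynomial Filter

/-- `P_k`: monic irreducible polynomials of degree `k` or `k+1` (as a subtype). -/
def Pset (F : Type*) [Field F] (k : ℕ) : Type _ :=
  {g : Polynomial F // g.Monic ∧ Irreducible g ∧ k ≤ g.natDegree ∧ g.natDegree ≤ k + 1}

namespace FqKatai

variable {F : Type*} [Field F]

theorem coeff_polyOf {n : ℕ} (c : Fin n → F) (j : ℕ) :
    (polyOf c).coeff j = if h : j < n then c ⟨j, h⟩ else 0 := by
  simp only [polyOf, finsetSum_coeff, coeff_C_mul, coeff_X_pow, mul_ite, mul_one, mul_zero]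
  split_ifs with h
  · rw [Finset.sum_eq_single ⟨j, h⟩]
    · simp
    · intro b _ hb
      rw [if_neg]
      rintro rfl
      exact hb rfl
    · simp
  · refine Finset.sum_eq_zero fun i _ => if_neg ?_
    have := i.2
    omega

theorem polyOf_injective (n : ℕ) : Function.Injective (polyOf : (Fin n → F) → F[X]) := by
  intro c c' h
  ext i
  have := congrArg (fun g => g.coeff i) h
  simpa [coeff_polyOf] using this

theorem isCoprime_of_monic_irreducible {a b : F[X]} (ha : a.Monic) (hb : b.Monic)
    (hai : Irreducible a) (hbi : Irreducible b) (hab : a ≠ b) : IsCoprime a b := by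
  rw [hai.coprime_iff_not_dvd]
  intro h
  exact hab (eq_of_monic_of_associated ha hb (hai.associated_of_dvd hbi h))

variable [Fintype F]

/-- The finite set `G_n` of polynomials of degree less than `n`. -/
noncomputable def polysLT (F : Type*) [Field F] [Fintype F] (n : ℕ) : Finset F[X] :=
  Finset.univ.map ⟨polyOf, polyOf_injective n⟩

theorem mem_polysLT {n : ℕ} {g : F[X]} : g ∈ polysLT F n ↔ g.degree < n := by
  simp only [polysLT, Finset.mem_map, Finset.mem_univ, true_and, Function.Embedding.coeFn_mk]
  constructor
  · rintro ⟨c, rfl⟩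
    rw [degree_lt_iff_coeff_zero]
    intro m hm
    rw [coeff_polyOf, dif_neg (by omega)]
  · intro h
    refine ⟨fun i => g.coeff i, ?_⟩
    ext j
    rw [coeff_polyOf]
    split_ifs with hj
    · rfl
    · exact (coeff_eq_zero_of_degree_lt (h.trans_le (by exact_mod_cast not_lt.mp hj))).symm

theorem mem_polysLT_min {m n : ℕ} {g : F[X]} :
    g ∈ polysLT F (min m n) ↔ g ∈ polysLT F m ∧ g ∈ polysLT F n := by
  simp only [mem_polysLT]
  rcases le_total m n with h | h
  · rw [min_eq_left h]
    exact ⟨fun hg => ⟨hg, hg.trans_le (by exact_mod_cast h)⟩, And.left⟩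
  · rw [min_eq_right h]
    exact ⟨fun hg => ⟨hg.trans_le (by exact_mod_cast h), hg⟩, And.right⟩

theorem card_polysLT (n : ℕ) : (polysLT F n).card = Fintype.card F ^ n := by
  simp [polysLT]

theorem sum_polysLT {M : Type*} [AddCommMonoid M] (n : ℕ) (u : F[X] → M) :
    ∑ g ∈ polysLT F n, u g = ∑ c : Fin n → F, u (polyOf c) := by
  simp only [polysLT, Finset.sum_map, Function.Embedding.coeFn_mk]

theorem mul_mem_polysLT {n : ℕ} {a h : F[X]} (ha : a ≠ 0) (hn : a.natDegree ≤ n) :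
    a * h ∈ polysLT F n ↔ h ∈ polysLT F (n - a.natDegree) := by
  rw [mem_polysLT, mem_polysLT]
  rcases eq_or_ne h 0 with rfl | hh
  · simp
  · rw [degree_mul, degree_eq_natDegree ha, degree_eq_natDegree hh, ← Nat.cast_add, Nat.cast_lt,
      Nat.cast_lt]
    omega

open Classical in
theorem sum_polysLT_dvd {M : Type*} [AddCommMonoid M] {n : ℕ} {a : F[X]} (ha : a ≠ 0)
    (hn : a.natDegree ≤ n) (u : F[X] → M) :
    ∑ g ∈ polysLT F n with a ∣ g, u g = ∑ h ∈ polysLT F (n - a.natDegree), u (a * h) := by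
  symm
  refine Finset.sum_bij (fun h _ => a * h) ?_ ?_ ?_ fun _ _ => rfl
  · intro h hh
    exact Finset.mem_filter.2 ⟨(mul_mem_polysLT ha hn).2 hh, dvd_mul_right _ _⟩
  · intro _ _ _ _ h
    exact mul_left_cancel₀ ha h
  · intro g hg
    obtain ⟨hg, h, rfl⟩ := Finset.mem_filter.1 hg
    exact ⟨h, (mul_mem_polysLT ha hn).1 hg, rfl⟩

open Classical in
theorem card_polysLT_dvd {n : ℕ} {a : F[X]} (ha : a ≠ 0) (hn : a.natDegree ≤ n) :
    ((polysLT F n).filter (a ∣ ·)).card = Fintype.card F ^ (n - a.natDegree) := by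
  rw [Finset.card_eq_sum_ones, sum_polysLT_dvd ha hn, ← Finset.card_eq_sum_ones, card_polysLT]

/-- The norm `q ^ deg g` of a polynomial, inverted. -/
noncomputable def invNorm (g : F[X]) : ℝ := ((Fintype.card F : ℝ) ^ g.natDegree)⁻¹

theorem two_le_card : (2 : ℝ) ≤ Fintype.card F := by
  exact_mod_cast (Fintype.one_lt_card : 1 < Fintype.card F)

theorem card_pos_real : (0 : ℝ) < Fintype.card F := by
  linarith [two_le_card (F := F)]

theorem invNorm_pos (g : F[X]) : 0 < invNorm g :=
  inv_pos.2 (pow_pos card_pos_real _)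

theorem invNorm_mul {a b : F[X]} (ha : a ≠ 0) (hb : b ≠ 0) :
    invNorm (a * b) = invNorm a * invNorm b := by
  rw [invNorm, natDegree_mul ha hb, pow_add, mul_inv, invNorm, invNorm]

theorem card_pow_sub {n : ℕ} {a : F[X]} (hn : a.natDegree ≤ n) :
    (Fintype.card F : ℝ) ^ (n - a.natDegree) = (Fintype.card F : ℝ) ^ n * invNorm a := by
  rw [pow_sub₀ _ card_pos_real.ne' hn, invNorm]

open Classical in
/-- The finite set of monic irreducible polynomials of degree `k` or `k + 1`. -/
noncomputable def primesAt (F : Type*) [Field F] [Fintype F] (k : ℕ) : Finset F[X] :=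
  (polysLT F (k + 2)).filter
    (fun g => g.Monic ∧ Irreducible g ∧ k ≤ g.natDegree ∧ g.natDegree ≤ k + 1)

theorem mem_primesAt {k : ℕ} {g : F[X]} : g ∈ primesAt F k ↔
    g.Monic ∧ Irreducible g ∧ k ≤ g.natDegree ∧ g.natDegree ≤ k + 1 := by
  simp only [primesAt, Finset.mem_filter, mem_polysLT, and_iff_right_iff_imp]
  rintro ⟨h, -, -, h'⟩
  rw [degree_eq_natDegree h.ne_zero, Nat.cast_lt]
  omega

theorem tsum_pset (k : ℕ) (u : F[X] → ℝ) :
    ∑' a : Pset F k, u a.1 = ∑ a ∈ primesAt F k, u a := by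
  rw [← Finset.tsum_subtype]
  let e : Pset F k ≃ {x // x ∈ primesAt F k} :=
    Equiv.subtypeEquivRight fun g => mem_primesAt.symm
  exact e.tsum_eq (fun a : {x // x ∈ primesAt F k} => u a.1)

theorem natCard_pset (k : ℕ) : Nat.card (Pset F k) = (primesAt F k).card := by
  rw [← Nat.card_eq_finsetCard]
  exact Nat.card_congr (Equiv.subtypeEquivRight fun g => mem_primesAt.symm)

/-- The elements of a degree `d` extension generating it are counted by the roots of the monic
irreducible polynomials of degree `d`. -/
theorem card_pow_le_of_finrank_eq (L : Type*) [Field L] [Fintype L] [Algebra F L] {d : ℕ}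
    (hfin : Module.finrank F L = d) (hd : 3 ≤ d) :
    (Fintype.card F : ℝ) ^ d ≤
      2 * d * ((primesAt F d).filter (fun g => g.natDegree = d)).card := by
  classical
  set q := Fintype.card F with hq
  have hcardF : Nat.card F = q := Nat.card_eq_fintype_card
  have hq2 : 2 ≤ q := Fintype.one_lt_card
  have hL : Fintype.card L = q ^ d := by
    rw [Module.card_eq_pow_finrank (K := F), hfin]
  set I := (primesAt F d).filter (fun g => g.natDegree = d) with hI
  have hXne (e : ℕ) (he : 1 ≤ e) : (X ^ q ^ e - X : L[X]) ≠ 0 :=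
    FiniteField.X_pow_card_sub_X_ne_zero L (Nat.one_lt_pow (by omega) hq2)
  have hcover : (Finset.univ : Finset L) ⊆
      I.biUnion (fun g => (g.map (algebraMap F L)).roots.toFinset) ∪
      (Finset.Icc 1 (d / 2)).biUnion (fun e => (X ^ q ^ e - X : L[X]).roots.toFinset) := by
    intro α _
    have hint : IsIntegral F α := Algebra.IsIntegral.isIntegral α
    have hirr := minpoly.irreducible hint
    have hdvd : (minpoly F α).natDegree ∣ d := hfin ▸ minpoly.degree_dvd hint
    have hpos := minpoly.natDegree_pos hint
    rw [Finset.mem_union, Finset.mem_biUnion, Finset.mem_biUnion]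
    by_cases h : (minpoly F α).natDegree = d
    · left
      refine ⟨minpoly F α, ?_, ?_⟩
      · rw [hI, Finset.mem_filter, mem_primesAt]
        exact ⟨⟨minpoly.monic hint, hirr, h.ge, by omega⟩, h⟩
      · rw [Multiset.mem_toFinset, mem_roots (map_ne_zero hirr.ne_zero), IsRoot, eval_map_algebraMap,
          minpoly.aeval]
    · right
      refine ⟨(minpoly F α).natDegree, ?_, ?_⟩
      · rw [Finset.mem_Icc]
        refine ⟨hpos, ?_⟩
        obtain ⟨c, hc⟩ := hdvd
        have hc2 : 2 ≤ c := by
          by_contra hlt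
          have : c = 0 ∨ c = 1 := by omega
          rcases this with rfl | rfl <;> simp at hc <;> omega
        rw [Nat.le_div_iff_mul_le two_pos]
        calc _ ≤ (minpoly F α).natDegree * c := Nat.mul_le_mul_left _ hc2
          _ = d := hc.symm
      · have h1 : minpoly F α ∣ X ^ (Nat.card F) ^ (minpoly F α).natDegree - X :=
          (hirr.natDegree_dvd_iff_dvd_X_pow_card_pow_sub_X).1 dvd_rfl
        have h2 := aeval_eq_zero_of_dvd_aeval_eq_zero h1 (minpoly.aeval F α)
        rw [Multiset.mem_toFinset, mem_roots (hXne _ hpos)]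
        rw [hcardF] at h2
        simpa [IsRoot] using h2
  have hcount : q ^ d ≤ I.card * d + q ^ (d / 2 + 1) := by
    rw [← hL, ← Finset.card_univ]
    refine (Finset.card_le_card hcover).trans ((Finset.card_union_le _ _).trans (add_le_add ?_ ?_))
    · refine Finset.card_biUnion_le_card_mul _ _ _ fun g hg => ?_
      refine (Multiset.toFinset_card_le _).trans ((card_roots' _).trans ?_)
      rw [natDegree_map]
      exact (Finset.mem_filter.1 hg).2.le
    · refine Finset.card_biUnion_le.trans ?_
      calc _ ≤ ∑ e ∈ Finset.Icc 1 (d / 2), q ^ e := by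
            refine Finset.sum_le_sum fun e he => ?_
            refine (Multiset.toFinset_card_le _).trans ((card_roots' _).trans ?_)
            rw [FiniteField.X_pow_card_sub_X_natDegree_eq L
              (Nat.one_lt_pow (by have := (Finset.mem_Icc.1 he).1; omega) hq2)]
        _ ≤ q ^ (d / 2 + 1) := (Nat.geomSum_lt hq2 fun e he => by
            have := (Finset.mem_Icc.1 he).2; omega).le
  have hhalf : 2 * q ^ (d / 2 + 1) ≤ q ^ d := by
    calc 2 * q ^ (d / 2 + 1) ≤ q * q ^ (d - 1) :=
          Nat.mul_le_mul hq2 (Nat.pow_le_pow_right (by omega) (by omega))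
      _ = q ^ d := by rw [← pow_succ']; congr 1; omega
  have : q ^ d ≤ 2 * d * I.card := by nlinarith
  exact_mod_cast this

theorem card_pow_le_card_irreducible {d : ℕ} (hd : 3 ≤ d) :
    (Fintype.card F : ℝ) ^ d ≤
      2 * d * ((primesAt F d).filter (fun g => g.natDegree = d)).card := by
  obtain ⟨p, hp⟩ := CharP.exists F
  have : Fact p.Prime := ⟨CharP.char_is_prime F p⟩
  have : NeZero d := ⟨by omega⟩
  have : Fintype (FiniteField.Extension F p d) := Fintype.ofFinite _
  exact card_pow_le_of_finrank_eq _ (FiniteField.finrank_extension F p d) hd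

/-- The sum of the inverse norms over a finite set of polynomials. -/
noncomputable def mass (T : Finset F[X]) : ℝ := ∑ p ∈ T, invNorm p

open Classical in
/-- The number of elements of `T` dividing `g`. -/
noncomputable def divCount (T : Finset F[X]) (g : F[X]) : ℝ := ∑ p ∈ T, if p ∣ g then 1 else 0

open Classical in
theorem sum_ite_dvd {n : ℕ} {a : F[X]} (ha : a ≠ 0) (hn : a.natDegree ≤ n) :
    ∑ g ∈ polysLT F n, (if a ∣ g then (1 : ℝ) else 0) = (Fintype.card F : ℝ) ^ n * invNorm a := by
  rw [Finset.sum_boole, card_polysLT_dvd ha hn, Nat.cast_pow, card_pow_sub hn]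

theorem sum_divCount {n : ℕ} {T : Finset F[X]} (hT : ∀ p ∈ T, p ≠ 0 ∧ p.natDegree ≤ n) :
    ∑ g ∈ polysLT F n, divCount T g = (Fintype.card F : ℝ) ^ n * mass T := by
  simp only [divCount, mass, Finset.mul_sum]
  rw [Finset.sum_comm]
  exact Finset.sum_congr rfl fun p hp => sum_ite_dvd (hT p hp).1 (hT p hp).2

theorem sum_divCount_sq_le {n : ℕ} {T : Finset F[X]}
    (hT : ∀ p ∈ T, p.Monic ∧ Irreducible p ∧ 2 * p.natDegree ≤ n) :
    ∑ g ∈ polysLT F n, divCount T g ^ 2 ≤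
      (Fintype.card F : ℝ) ^ n * (mass T ^ 2 + mass T) := by
  classical
  have hQ : (0 : ℝ) ≤ (Fintype.card F : ℝ) ^ n := by positivity
  have key : ∀ p ∈ T, ∀ p' ∈ T,
      ∑ g ∈ polysLT F n, (if p ∣ g then (1 : ℝ) else 0) * (if p' ∣ g then 1 else 0) ≤
        (Fintype.card F : ℝ) ^ n * (invNorm p * invNorm p' + if p = p' then invNorm p else 0) := by
    intro p hp p' hp'
    obtain ⟨hm, hi, hd⟩ := hT p hp
    obtain ⟨hm', hi', hd'⟩ := hT p' hp'
    split_ifs with h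
    · subst h
      simp only [← ite_and, mul_ite, mul_one, mul_zero, and_self]
      rw [sum_ite_dvd hm.ne_zero (by omega)]
      exact mul_le_mul_of_nonneg_left
        (le_add_of_nonneg_left (mul_nonneg (invNorm_pos p).le (invNorm_pos p).le)) hQ
    · have hc := isCoprime_of_monic_irreducible hm hm' hi hi' h
      rw [add_zero, ← invNorm_mul hm.ne_zero hm'.ne_zero,
        ← sum_ite_dvd (mul_ne_zero hm.ne_zero hm'.ne_zero)
          (by rw [natDegree_mul hm.ne_zero hm'.ne_zero]; omega)]
      refine Finset.sum_le_sum fun g _ => ?_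
      by_cases h1 : p ∣ g <;> by_cases h2 : p' ∣ g
      · simp [h1, h2, hc.mul_dvd h1 h2]
      all_goals simp only [h1, h2, if_true, if_false, mul_zero, zero_mul]; split_ifs <;> simp
  calc ∑ g ∈ polysLT F n, divCount T g ^ 2
      = ∑ p ∈ T, ∑ p' ∈ T, ∑ g ∈ polysLT F n,
          (if p ∣ g then (1 : ℝ) else 0) * (if p' ∣ g then 1 else 0) := by
        simp only [divCount, sq, Finset.sum_mul_sum]
        rw [Finset.sum_comm]
        exact Finset.sum_congr rfl fun p _ => Finset.sum_comm
    _ ≤ ∑ p ∈ T, ∑ p' ∈ T, (Fintype.card F : ℝ) ^ n *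
          (invNorm p * invNorm p' + if p = p' then invNorm p else 0) :=
        Finset.sum_le_sum fun p hp => Finset.sum_le_sum fun p' hp' => key p hp p' hp'
    _ = (Fintype.card F : ℝ) ^ n * (mass T ^ 2 + mass T) := by
        simp only [← Finset.mul_sum, Finset.sum_add_distrib]
        congr 2
        · rw [mass, sq, Finset.sum_mul]
        · refine Finset.sum_congr rfl fun p hp => ?_
          rw [Finset.sum_ite_eq, if_pos hp]

/-- The Turán–Kubilius inequality. -/
theorem sum_divCount_sub_mass_sq_le {n : ℕ} {T : Finset F[X]}
    (hT : ∀ p ∈ T, p.Monic ∧ Irreducible p ∧ 2 * p.natDegree ≤ n) :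
    ∑ g ∈ polysLT F n, (divCount T g - mass T) ^ 2 ≤ (Fintype.card F : ℝ) ^ n * mass T := by
  have h1 := sum_divCount (n := n) (T := T)
    fun p hp => ⟨(hT p hp).1.ne_zero, by have := (hT p hp).2.2; omega⟩
  have h2 := sum_divCount_sq_le hT
  have h3 : ∑ g ∈ polysLT F n, (divCount T g - mass T) ^ 2 =
      ∑ g ∈ polysLT F n, divCount T g ^ 2 - 2 * mass T * ∑ g ∈ polysLT F n, divCount T g
        + (Fintype.card F : ℝ) ^ n * mass T ^ 2 := by
    have : (Fintype.card F : ℝ) ^ n * mass T ^ 2 = ∑ g ∈ polysLT F n, mass T ^ 2 := by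
      rw [Finset.sum_const, card_polysLT, nsmul_eq_mul, Nat.cast_pow]
    rw [this, Finset.mul_sum, ← Finset.sum_sub_distrib, ← Finset.sum_add_distrib]
    exact Finset.sum_congr rfl fun g _ => by ring
  rw [h3, h1]
  linarith

theorem sum_abs_divCount_sub_mass_le {n : ℕ} {T : Finset F[X]}
    (hT : ∀ p ∈ T, p.Monic ∧ Irreducible p ∧ 2 * p.natDegree ≤ n) :
    ∑ g ∈ polysLT F n, |divCount T g - mass T| ≤
      (Fintype.card F : ℝ) ^ n * √(mass T) := by
  refine (Real.le_sqrt_of_sq_le (y := ((Fintype.card F : ℝ) ^ n) ^ 2 * mass T) ?_).trans_eq ?_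
  · refine sq_sum_le_card_mul_sum_sq.trans ?_
    simp only [sq_abs]
    rw [card_polysLT, Nat.cast_pow, sq, mul_assoc]
    exact mul_le_mul_of_nonneg_left (sum_divCount_sub_mass_sq_le hT) (by positivity)
  · rw [Real.sqrt_mul (by positivity), Real.sqrt_sq (by positivity)]

theorem sum_mul_divCount {n : ℕ} {T : Finset F[X]} (hT : ∀ p ∈ T, p ≠ 0 ∧ p.natDegree ≤ n)
    (u : F[X] → ℂ) :
    ∑ g ∈ polysLT F n, u g * (divCount T g : ℂ) =
      ∑ p ∈ T, ∑ h ∈ polysLT F (n - p.natDegree), u (p * h) := by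
  classical
  simp only [divCount, Complex.ofReal_sum, Finset.mul_sum]
  rw [Finset.sum_comm]
  refine Finset.sum_congr rfl fun p hp => ?_
  rw [← sum_polysLT_dvd (hT p hp).1 (hT p hp).2, Finset.sum_filter]
  refine Finset.sum_congr rfl fun g _ => ?_
  split_ifs <;> simp

theorem norm_sum_mul_sub_le {n : ℕ} {ν f : F[X] → ℂ} (hν : IsMultFn ν) (hνb : ∀ g, ‖ν g‖ ≤ 1)
    (hfb : ∀ g, ‖f g‖ ≤ 1) {p : F[X]} (hi : Irreducible p) (hd : 2 * p.natDegree ≤ n) :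
    ‖∑ h ∈ polysLT F (n - p.natDegree), ν (p * h) * f (p * h) -
      ∑ h ∈ polysLT F (n - p.natDegree), ν p * ν h * f (p * h)‖ ≤
      2 * ((Fintype.card F : ℝ) ^ n * (invNorm p * invNorm p)) := by
  classical
  rw [← Finset.sum_sub_distrib]
  calc _ ≤ ∑ h ∈ polysLT F (n - p.natDegree), 2 * (if p ∣ h then (1 : ℝ) else 0) := by
        refine norm_sum_le_of_le _ fun h _ => ?_
        split_ifs with hp
        · have h1 : ‖ν (p * h) * f (p * h)‖ ≤ 1 := by
            rw [norm_mul]; exact mul_le_one₀ (hνb _) (norm_nonneg _) (hfb _)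
          have h2 : ‖ν p * ν h * f (p * h)‖ ≤ 1 := by
            rw [norm_mul, norm_mul]
            exact mul_le_one₀ (mul_le_one₀ (hνb _) (norm_nonneg _) (hνb _)) (norm_nonneg _) (hfb _)
          linarith [norm_sub_le (ν (p * h) * f (p * h)) (ν p * ν h * f (p * h))]
        · rw [hν p h (hi.coprime_iff_not_dvd.2 hp)]
          simp
    _ = _ := by
        rw [← Finset.mul_sum, sum_ite_dvd hi.ne_zero (by omega), card_pow_sub (by omega)]
        ring

theorem norm_sum_primesAt_sq_le {n k : ℕ} (hk : k ≤ n) {ν f : F[X] → ℂ} (hνb : ∀ g, ‖ν g‖ ≤ 1) :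
    ‖∑ p ∈ primesAt F k, ∑ h ∈ polysLT F (n - p.natDegree), ν p * ν h * f (p * h)‖ ^ 2 ≤
      (Fintype.card F : ℝ) ^ (n - k) * ∑ a ∈ primesAt F k, ∑ b ∈ primesAt F k,
        ‖∑ h ∈ polysLT F (min (n - a.natDegree) (n - b.natDegree)),
          f (a * h) * (starRingEnd ℂ) (f (b * h))‖ := by
  classical
  set M := polysLT F (n - k) with hM
  set w : F[X] → F[X] → ℂ := fun h p =>
    if h ∈ polysLT F (n - p.natDegree) then ν p * f (p * h) else 0 with hw
  have hsub : ∀ m, m ≤ n - k → M.filter (fun h => h ∈ polysLT F m) = polysLT F m := by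
    intro m hm
    ext h
    simp only [hM, Finset.mem_filter, mem_polysLT, and_iff_right_iff_imp]
    exact fun hh => hh.trans_le (by exact_mod_cast hm)
  have h1 : ∑ p ∈ primesAt F k, ∑ h ∈ polysLT F (n - p.natDegree), ν p * ν h * f (p * h) =
      ∑ h ∈ M, ν h * ∑ p ∈ primesAt F k, w h p := by
    simp only [Finset.mul_sum]
    rw [Finset.sum_comm]
    refine Finset.sum_congr rfl fun p hp => ?_
    have := (mem_primesAt.1 hp).2.2.1
    rw [← hsub (n - p.natDegree) (by omega), Finset.sum_filter]
    refine Finset.sum_congr rfl fun h _ => ?_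
    simp only [hw]
    split_ifs
    · ring
    · simp
  have h2 : ((∑ h ∈ M, ‖∑ p ∈ primesAt F k, w h p‖ ^ 2 : ℝ) : ℂ) =
      ∑ a ∈ primesAt F k, ∑ b ∈ primesAt F k, ν a * (starRingEnd ℂ) (ν b) *
        ∑ h ∈ polysLT F (min (n - a.natDegree) (n - b.natDegree)),
          f (a * h) * (starRingEnd ℂ) (f (b * h)) := by
    push_cast
    simp only [← Complex.mul_conj', map_sum, Finset.sum_mul_sum]
    rw [Finset.sum_comm]
    refine Finset.sum_congr rfl fun a ha => ?_
    rw [Finset.sum_comm]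
    refine Finset.sum_congr rfl fun b hb => ?_
    have := (mem_primesAt.1 ha).2.2.1
    rw [← hsub (min (n - a.natDegree) (n - b.natDegree)) (by omega), Finset.sum_filter,
      Finset.mul_sum]
    refine Finset.sum_congr rfl fun h _ => ?_
    simp only [hw, mem_polysLT_min]
    by_cases c1 : h ∈ polysLT F (n - a.natDegree) <;>
      by_cases c2 : h ∈ polysLT F (n - b.natDegree) <;>
      simp only [c1, c2, if_true, if_false, and_self, and_true, and_false, map_mul, map_zero,
        mul_zero, zero_mul]
    ring
  have h3 : ∑ h ∈ M, ‖∑ p ∈ primesAt F k, w h p‖ ^ 2 ≤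
      ∑ a ∈ primesAt F k, ∑ b ∈ primesAt F k,
        ‖∑ h ∈ polysLT F (min (n - a.natDegree) (n - b.natDegree)),
          f (a * h) * (starRingEnd ℂ) (f (b * h))‖ := by
    have h0 : (0 : ℝ) ≤ ∑ h ∈ M, ‖∑ p ∈ primesAt F k, w h p‖ ^ 2 := by positivity
    rw [← abs_of_nonneg h0, ← Real.norm_eq_abs, ← Complex.norm_real, h2]
    refine norm_sum_le_of_le _ fun a _ => norm_sum_le_of_le _ fun b _ => ?_
    rw [norm_mul, norm_mul, RCLike.norm_conj]
    exact mul_le_of_le_one_left (norm_nonneg _) (mul_le_one₀ (hνb a) (norm_nonneg _) (hνb b))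
  rw [h1]
  have h4 : ‖∑ h ∈ M, ν h * ∑ p ∈ primesAt F k, w h p‖ ≤ ∑ h ∈ M, ‖∑ p ∈ primesAt F k, w h p‖ := by
    refine norm_sum_le_of_le _ fun h _ => ?_
    rw [norm_mul]
    exact mul_le_of_le_one_left (norm_nonneg _) (hνb h)
  calc _ ≤ (∑ h ∈ M, ‖∑ p ∈ primesAt F k, w h p‖) ^ 2 := by gcongr
    _ ≤ _ := sq_sum_le_card_mul_sum_sq
    _ ≤ _ := by
      rw [hM, card_polysLT, Nat.cast_pow]
      exact mul_le_mul_of_nonneg_left h3 (by positivity)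

theorem card_primesAt_mul_le (k : ℕ) :
    ((primesAt F k).card : ℝ) * ((Fintype.card F : ℝ) ^ k)⁻¹ ≤
      Fintype.card F * mass (primesAt F k) := by
  rw [mass, Finset.mul_sum, ← nsmul_eq_mul]
  refine Finset.card_nsmul_le_sum _ _ _ fun p hp => ?_
  have hq := card_pos_real (F := F)
  have hd := (mem_primesAt.1 hp).2.2.2
  rw [invNorm, ← div_eq_mul_inv, le_div_iff₀ (by positivity), inv_mul_le_iff₀ (by positivity),
    ← pow_succ]
  exact pow_le_pow_right₀ (by linarith [two_le_card (F := F)]) hd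

theorem norm_sum_primesAt_le {n k : ℕ} (hk : k ≤ n) {ν f : F[X] → ℂ} (hνb : ∀ g, ‖ν g‖ ≤ 1)
    {ε : ℝ} (hε : 0 ≤ ε)
    (h : ∑ a ∈ primesAt F k, ∑ b ∈ primesAt F k,
        ‖∑ h ∈ polysLT F (min (n - a.natDegree) (n - b.natDegree)),
          f (a * h) * (starRingEnd ℂ) (f (b * h))‖ ≤
      ε * ((primesAt F k).card : ℝ) ^ 2 * (Fintype.card F : ℝ) ^ (n - k)) :
    ‖∑ p ∈ primesAt F k, ∑ h ∈ polysLT F (n - p.natDegree), ν p * ν h * f (p * h)‖ ≤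
      (Fintype.card F : ℝ) ^ n * (√ε * (Fintype.card F * mass (primesAt F k))) := by
  have hq := card_pos_real (F := F)
  have h1 : ‖∑ p ∈ primesAt F k, ∑ h ∈ polysLT F (n - p.natDegree), ν p * ν h * f (p * h)‖ ≤
      (Fintype.card F : ℝ) ^ (n - k) * (√ε * (primesAt F k).card) := by
    refine le_of_sq_le_sq ((norm_sum_primesAt_sq_le hk hνb).trans ?_) (by positivity)
    rw [mul_pow, mul_pow, Real.sq_sqrt hε, sq ((Fintype.card F : ℝ) ^ (n - k)), mul_assoc]
    refine mul_le_mul_of_nonneg_left (h.trans_eq ?_) (by positivity)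
    ring
  refine h1.trans ?_
  rw [pow_sub₀ _ hq.ne' hk]
  calc _ = (Fintype.card F : ℝ) ^ n * (√ε * (((primesAt F k).card : ℝ) *
        ((Fintype.card F : ℝ) ^ k)⁻¹)) := by ring
    _ ≤ _ := mul_le_mul_of_nonneg_left (mul_le_mul_of_nonneg_left (card_primesAt_mul_le k)
        (Real.sqrt_nonneg _)) (by positivity)

/-- The finite form of Kátai's criterion. -/
theorem mass_mul_norm_sum_le {n k₀ : ℕ} {K : Finset ℕ}
    (hK : ∀ k ∈ K, k₀ ≤ k ∧ 2 * (k + 1) ≤ n)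
    (hdisj : (K : Set ℕ).PairwiseDisjoint (primesAt F))
    {ν f : F[X] → ℂ} (hν : IsMultFn ν) (hνb : ∀ g, ‖ν g‖ ≤ 1) (hfb : ∀ g, ‖f g‖ ≤ 1)
    {ε : ℝ} (hε : 0 ≤ ε)
    (h : ∀ k ∈ K, ∑ a ∈ primesAt F k, ∑ b ∈ primesAt F k,
        ‖∑ h ∈ polysLT F (min (n - a.natDegree) (n - b.natDegree)),
          f (a * h) * (starRingEnd ℂ) (f (b * h))‖ ≤
      ε * ((primesAt F k).card : ℝ) ^ 2 * (Fintype.card F : ℝ) ^ (n - k)) :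
    (∑ k ∈ K, mass (primesAt F k)) * ‖∑ g ∈ polysLT F n, ν g * f g‖ ≤
      (Fintype.card F : ℝ) ^ n * (√(∑ k ∈ K, mass (primesAt F k)) +
        (2 * (1 / 2) ^ k₀ + √ε * Fintype.card F) * ∑ k ∈ K, mass (primesAt F k)) := by
  classical
  have hq := card_pos_real (F := F)
  set T := K.biUnion (primesAt F) with hTdef
  set Q := (Fintype.card F : ℝ) ^ n with hQ
  have hmass : ∑ k ∈ K, mass (primesAt F k) = mass T := (Finset.sum_biUnion hdisj).symm
  have hT : ∀ p ∈ T, p.Monic ∧ Irreducible p ∧ 2 * p.natDegree ≤ n ∧ k₀ ≤ p.natDegree := by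
    intro p hp
    obtain ⟨k, hk, hp⟩ := Finset.mem_biUnion.1 hp
    obtain ⟨h1, h2, h3, h4⟩ := mem_primesAt.1 hp
    have := hK k hk
    exact ⟨h1, h2, by omega, by omega⟩
  have hmass0 : 0 ≤ mass T := Finset.sum_nonneg fun p _ => (invNorm_pos p).le
  have e1 : ‖∑ g ∈ polysLT F n, ν g * f g * ((divCount T g - mass T : ℝ) : ℂ)‖ ≤ Q * √(mass T) := by
    refine le_trans (norm_sum_le_of_le _ fun g _ => ?_)
      (sum_abs_divCount_sub_mass_le (n := n) fun p hp =>
        ⟨(hT p hp).1, (hT p hp).2.1, (hT p hp).2.2.1⟩)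
    rw [norm_mul, norm_mul, Complex.norm_real, Real.norm_eq_abs]
    exact mul_le_of_le_one_left (abs_nonneg _) (mul_le_one₀ (hνb g) (norm_nonneg _) (hfb g))
  have e2 := sum_mul_divCount (n := n) (T := T)
    (fun p hp => ⟨(hT p hp).1.ne_zero, by have := (hT p hp).2.2.1; omega⟩) (fun g => ν g * f g)
  have e3 : ‖∑ p ∈ T, ∑ h ∈ polysLT F (n - p.natDegree), ν (p * h) * f (p * h) -
      ∑ p ∈ T, ∑ h ∈ polysLT F (n - p.natDegree), ν p * ν h * f (p * h)‖ ≤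
      Q * (2 * (1 / 2) ^ k₀ * mass T) := by
    rw [← Finset.sum_sub_distrib]
    have : Q * (2 * (1 / 2) ^ k₀ * mass T) =
        ∑ p ∈ T, 2 * (Q * ((1 / 2) ^ k₀ * invNorm p)) := by
      simp only [mass, Finset.mul_sum]
      exact Finset.sum_congr rfl fun _ _ => by ring
    rw [this]
    refine norm_sum_le_of_le _ fun p hp => ?_
    refine (norm_sum_mul_sub_le hν hνb hfb (hT p hp).2.1 (hT p hp).2.2.1).trans ?_
    have hp0 := invNorm_pos p
    gcongr
    rw [invNorm, ← inv_pow]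
    calc _ ≤ ((1 : ℝ) / 2) ^ p.natDegree := by
          rw [one_div]; gcongr; exact two_le_card
      _ ≤ _ := pow_le_pow_of_le_one (by norm_num) (by norm_num) (hT p hp).2.2.2
  have e4 : ‖∑ p ∈ T, ∑ h ∈ polysLT F (n - p.natDegree), ν p * ν h * f (p * h)‖ ≤
      Q * (√ε * Fintype.card F * mass T) := by
    rw [hTdef, Finset.sum_biUnion hdisj, ← hTdef, ← hmass, Finset.mul_sum, Finset.mul_sum]
    refine norm_sum_le_of_le _ fun k hk => ?_
    have := hK k hk
    refine (norm_sum_primesAt_le (by omega) hνb hε (h k hk)).trans_eq ?_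
    ring
  have e5 : (mass T : ℂ) * ∑ g ∈ polysLT F n, ν g * f g =
      -(∑ g ∈ polysLT F n, ν g * f g * ((divCount T g - mass T : ℝ) : ℂ)) +
      ((∑ p ∈ T, ∑ h ∈ polysLT F (n - p.natDegree), ν (p * h) * f (p * h) -
        ∑ p ∈ T, ∑ h ∈ polysLT F (n - p.natDegree), ν p * ν h * f (p * h)) +
      ∑ p ∈ T, ∑ h ∈ polysLT F (n - p.natDegree), ν p * ν h * f (p * h)) := by
    rw [sub_add_cancel, ← e2, ← Finset.sum_neg_distrib, ← Finset.sum_add_distrib, Finset.mul_sum]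
    refine Finset.sum_congr rfl fun g _ => ?_
    push_cast
    ring
  rw [hmass]
  calc mass T * ‖∑ g ∈ polysLT F n, ν g * f g‖
      = ‖(mass T : ℂ) * ∑ g ∈ polysLT F n, ν g * f g‖ := by
        rw [norm_mul, Complex.norm_real, Real.norm_of_nonneg hmass0]
    _ ≤ Q * √(mass T) + (Q * (2 * (1 / 2) ^ k₀ * mass T) + Q * (√ε * Fintype.card F * mass T)) := by
        rw [e5]
        refine (norm_add_le _ _).trans (add_le_add ?_ ((norm_add_le _ _).trans (add_le_add e3 e4)))
        rwa [norm_neg]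
    _ = _ := by ring

theorem inv_le_mass_primesAt {k : ℕ} (hk : 3 ≤ k) : (2 * (k : ℝ))⁻¹ ≤ mass (primesAt F k) := by
  have hq := card_pos_real (F := F)
  have hk0 : (0 : ℝ) < k := by exact_mod_cast (by omega : 0 < k)
  calc (2 * (k : ℝ))⁻¹
      ≤ ((primesAt F k).filter (fun g => g.natDegree = k)).card *
          ((Fintype.card F : ℝ) ^ k)⁻¹ := by
        rw [← div_eq_mul_inv, le_div_iff₀ (by positivity), inv_mul_le_iff₀ (by positivity)]
        exact card_pow_le_card_irreducible hk
    _ = ∑ p ∈ (primesAt F k).filter (fun g => g.natDegree = k), invNorm p := by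
        rw [← nsmul_eq_mul, ← Finset.sum_const]
        refine Finset.sum_congr rfl fun p hp => ?_
        rw [invNorm, (Finset.mem_filter.1 hp).2]
    _ ≤ mass (primesAt F k) :=
        Finset.sum_le_sum_of_subset_of_nonneg (Finset.filter_subset _ _)
          fun p _ _ => (invNorm_pos p).le

/-- The even numbers in a range close to `[x, x ^ 2]`. -/
noncomputable def evenRange (x : ℝ) : Finset ℕ :=
  (Finset.Ico ⌈x / 2⌉₊ ⌊x ^ 2 / 2⌋₊).image fun i => 2 * (i + 1)

theorem mem_evenRange_bounds {x : ℝ} {k : ℕ} (hk : k ∈ evenRange x) :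
    x ≤ k ∧ (k : ℝ) ≤ x ^ 2 ∧ ⌈x / 2⌉₊ ≤ k := by
  obtain ⟨i, hi, rfl⟩ := Finset.mem_image.1 hk
  obtain ⟨h1, h2⟩ := Finset.mem_Ico.1 hi
  have h3 : x / 2 ≤ i := (Nat.le_ceil _).trans (by exact_mod_cast h1)
  have h4 : ((i + 1 : ℕ) : ℝ) ≤ x ^ 2 / 2 :=
    (Nat.cast_le.2 (Nat.succ_le_of_lt h2)).trans (Nat.floor_le (by positivity))
  push_cast at h4 ⊢
  exact ⟨by linarith, by linarith, by omega⟩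

theorem pairwiseDisjoint_primesAt (x : ℝ) :
    (evenRange x : Set ℕ).PairwiseDisjoint (primesAt F) := by
  intro k hk l hl hkl
  obtain ⟨i, -, rfl⟩ := Finset.mem_image.1 (Finset.mem_coe.1 hk)
  obtain ⟨j, -, rfl⟩ := Finset.mem_image.1 (Finset.mem_coe.1 hl)
  refine Finset.disjoint_left.2 fun p hp hp' => hkl ?_
  have h1 := (mem_primesAt.1 hp).2.2
  have h2 := (mem_primesAt.1 hp').2.2
  omega

theorem log_le_sum_mass {x : ℝ} (hx : 4 ≤ x) :
    (Real.log x - Real.log 2 - 1) / 4 ≤ ∑ k ∈ evenRange x, mass (primesAt F k) := by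
  set a := ⌈x / 2⌉₊ with ha
  set b := ⌊x ^ 2 / 2⌋₊ with hb
  have ha2 : (a : ℝ) ≤ x := by linarith [Nat.ceil_lt_add_one (by linarith : 0 ≤ x / 2)]
  have ha2' : 2 ≤ a := by
    have : x / 2 ≤ a := Nat.le_ceil _
    exact_mod_cast (by linarith : (2 : ℝ) ≤ a)
  have ha0 : (0 : ℝ) < a := by exact_mod_cast (by omega : 0 < a)
  have hbx : x ^ 2 / 2 < b + 1 := Nat.lt_floor_add_one _
  have hab : a ≤ b := by
    have : (a : ℝ) < b + 1 := by nlinarith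
    exact_mod_cast Nat.lt_succ_iff.1 (by exact_mod_cast this)
  have hsum : ∑ k ∈ evenRange x, mass (primesAt F k) =
      ∑ i ∈ Finset.Ico a b, mass (primesAt F (2 * (i + 1))) :=
    Finset.sum_image fun i _ j _ h => by simpa using h
  have hharm : ∑ i ∈ Finset.Ico a b, ((i + 1 : ℕ) : ℝ)⁻¹ = (harmonic b : ℝ) - harmonic a := by
    rw [Finset.sum_Ico_eq_sub _ hab]
    simp [harmonic]
  have h1 := log_add_one_le_harmonic b
  have h2 := harmonic_le_one_add_log a
  have h3 : Real.log (x ^ 2 / 2) ≤ Real.log ((b : ℝ) + 1) := Real.log_le_log (by positivity) hbx.le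
  have h4 : Real.log a ≤ Real.log x := Real.log_le_log ha0 ha2
  rw [Real.log_div (by positivity) two_ne_zero, Real.log_pow] at h3
  push_cast at h1 h3
  calc (Real.log x - Real.log 2 - 1) / 4
      ≤ ((harmonic b : ℝ) - harmonic a) / 4 := by linarith
    _ = ∑ i ∈ Finset.Ico a b, (2 * ((2 * (i + 1) : ℕ) : ℝ))⁻¹ := by
        rw [← hharm, Finset.sum_div]
        refine Finset.sum_congr rfl fun i _ => ?_
        push_cast
        rw [div_eq_mul_inv, ← mul_inv]
        congr 1
        ring
    _ ≤ _ := by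
        rw [hsum]
        refine Finset.sum_le_sum fun i hi => inv_le_mass_primesAt ?_
        have := (Finset.mem_Ico.1 hi).1
        omega

end FqKatai

open FqKatai

theorem stmt4 {F : Type*} [Field F] [Fintype F]
    (ν f : Polynomial F → ℂ) (hν : IsMultFn ν)
    (hνb : ∀ g, ‖ν g‖ ≤ 1) (hfb : ∀ g, ‖f g‖ ≤ 1)
    (φ : ℕ → ℝ) (hφ0 : ∀ n, 0 ≤ φ n) (hφ : Tendsto φ atTop atTop)
    (hφn : ∀ᶠ n : ℕ in atTop, φ n + φ n ^ 2 ≤ (n : ℝ) / 2)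
    (hyp : ∀ ε : ℝ, 0 < ε → ∃ N : ℕ, ∀ n ≥ N, ∀ k : ℕ,
      φ n ≤ (k : ℝ) → (k : ℝ) ≤ φ n + φ n ^ 2 →
      (∑' a : Pset F k, ∑' b : Pset F k,
        ‖∑ c : Fin (min (n - a.1.natDegree) (n - b.1.natDegree)) → F,
          f (a.1 * polyOf c) * (starRingEnd ℂ) (f (b.1 * polyOf c))‖) ≤
        ε * (Nat.card (Pset F k) : ℝ) ^ 2 * (Fintype.card F : ℝ) ^ ((n : ℤ) - (k : ℤ))) :
    Tendsto (fun n : ℕ => (1 / (Fintype.card F : ℂ) ^ n) *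
        ∑ c : Fin n → F, ν (polyOf c) * f (polyOf c)) atTop (nhds 0) := by
  have hq := card_pos_real (F := F)
  rw [Metric.tendsto_nhds]
  intro δ hδ
  set ε : ℝ := (δ / (4 * Fintype.card F)) ^ 2 with hεdef
  have hε : 0 < ε := by positivity
  have hsqrt : √ε * Fintype.card F = δ / 4 := by
    rw [hεdef, Real.sqrt_sq (by positivity)]
    field_simp
  obtain ⟨N, hN⟩ := hyp ε hε
  have hlog : ∀ᶠ n in atTop, (4 / δ) ^ 2 ≤ (Real.log (φ n) - Real.log 2 - 1) / 4 := by
    filter_upwards [(Real.tendsto_log_atTop.comp hφ).eventually_ge_atTop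
      (4 * (4 / δ) ^ 2 + Real.log 2 + 1)] with n hn
    simp only [Function.comp_apply] at hn
    linarith
  have hpow : ∀ᶠ n in atTop, 2 * ((1 : ℝ) / 2) ^ ⌈φ n / 2⌉₊ < δ / 4 := by
    have h1 : Tendsto (fun n => ⌈φ n / 2⌉₊) atTop atTop :=
      tendsto_nat_ceil_atTop.comp (hφ.atTop_div_const two_pos)
    have h2 := ((tendsto_pow_atTop_nhds_zero_of_lt_one (r := (1 : ℝ) / 2) (by norm_num)
      (by norm_num)).comp h1).const_mul 2
    rw [mul_zero] at h2
    exact h2.eventually_lt_const (by positivity)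
  filter_upwards [eventually_ge_atTop N, hφn, hφ.eventually_ge_atTop 4, hlog, hpow]
    with n hnN hφn hφ4 hlog hpow
  have hbounds : ∀ k ∈ evenRange (φ n), ⌈φ n / 2⌉₊ ≤ k ∧ 2 * (k + 1) ≤ n := by
    intro k hk
    obtain ⟨-, h2, h3⟩ := mem_evenRange_bounds hk
    refine ⟨h3, ?_⟩
    have : (2 * ((k : ℝ) + 1)) ≤ n := by linarith
    exact_mod_cast this
  have main := mass_mul_norm_sum_le (F := F) hbounds (pairwiseDisjoint_primesAt (φ n))
    hν hνb hfb hε.le (fun k hk => by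
      obtain ⟨h1, h2, -⟩ := mem_evenRange_bounds hk
      have hkn := hbounds k hk
      have h := hN n hnN k h1 (by linarith)
      rw [natCard_pset, ← Nat.cast_sub (by omega), zpow_natCast] at h
      simp only [sum_polysLT]
      refine le_of_eq_of_le ?_ h
      rw [← tsum_pset k (fun a => ∑ b ∈ primesAt F k, _)]
      exact tsum_congr fun a => (tsum_pset k _).symm)
  have hA := hlog.trans (log_le_sum_mass (F := F) hφ4)
  set A := ∑ k ∈ evenRange (φ n), mass (primesAt F k)
  have hA0 : 0 < A := lt_of_lt_of_le (by positivity) hA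
  have hAs : 4 / δ ≤ √A := Real.le_sqrt_of_sq_le hA
  have hAA : √A * √A = A := Real.mul_self_sqrt hA0.le
  have hsA : √A ≤ δ / 4 * A := by
    have h1 : 1 ≤ δ / 4 * √A := by
      calc 1 = δ / 4 * (4 / δ) := by field_simp
        _ ≤ _ := by gcongr
    calc √A = 1 * √A := (one_mul _).symm
      _ ≤ δ / 4 * √A * √A := by gcongr
      _ = δ / 4 * A := by rw [mul_assoc, hAA]
  have hQ : (0 : ℝ) < (Fintype.card F : ℝ) ^ n := by positivity
  rw [dist_zero_right, norm_mul, ← sum_polysLT n (fun g => ν g * f g), norm_div, norm_one, norm_pow,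
    Complex.norm_natCast, one_div_mul_eq_div, div_lt_iff₀ hQ]
  refine lt_of_mul_lt_mul_left (main.trans_lt ?_) hA0.le
  rw [hsqrt]
  calc _ ≤ (Fintype.card F : ℝ) ^ n * (δ / 4 * A + (δ / 4 + δ / 4) * A) := by gcongr
    _ < A * (δ * (Fintype.card F : ℝ) ^ n) := by nlinarith [mul_pos (mul_pos hQ hδ) hA0]
end

section
/- Let q be a prime power, m ≥ 1, let P : 𝔽_q[x] → 𝔽_q be a polynomial map of degree at most m, let α be an additive character of 𝔽_q, let ε > 0, and let n > k ≥ 0 be integers. Let T ⊆ G_{k+2} × G_{k+2} be a set of pairs such that for every (a,b) ∈ T, |E_{g ∈ G_{n−k}} α(P(ag) − P(bg))| ≥ ε/2. Then Re( E_{(a,b) ∈ G_{k+2}×G_{k+2}} E_{(g_1,…,g_m) ∈ G_{n−k}^m} α( d^mP(ag_1,…,ag_m) − d^mP(bg_1,…,bg_m) ) ) ≥ (|T|/q^{2k+4})·(ε/2)^{2^m}. -/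
open Polynomial Filter

/-- `d^mP(h_1,…,h_m) = Δ_{h_1}⋯Δ_{h_m}P(0)`. -/
def dDeriv {A M : Type*} [AddMonoid A] [AddGroup M] {m : ℕ}
    (P : A → M) (h : Fin m → A) : M :=
  (List.ofFn h).foldr Δop P 0

open scoped ComplexConjugate in
theorem char_sub_eq_mul_conj {M : Type*} [AddGroup M] {α : M → ℂ}
    (hadd : ∀ a b, α (a + b) = α a * α b) (hnorm : ∀ a, ‖α a‖ = 1) (x y : M) :
    α (x - y) = α x * conj (α y) := by
  have h : α (x - y) * α y = α x := by rw [← hadd, sub_add_cancel]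
  rw [← h, mul_assoc, Complex.mul_conj, Complex.normSq_eq_norm_sq, hnorm]
  simp

theorem polyOf_add {F : Type*} [Semiring F] {n : ℕ} (c d : Fin n → F) :
    polyOf (c + d) = polyOf c + polyOf d := by
  simp [polyOf, add_mul, Finset.sum_add_distrib]

theorem polyOf_zero {F : Type*} [Semiring F] {n : ℕ} : polyOf (0 : Fin n → F) = 0 := by
  simp [polyOf]

theorem foldr_Δop_comp {A B M : Type*} [Add A] [Add B] [Sub M] (P : B → M) (φ : A → B)
    (hφ : ∀ x y, φ (x + y) = φ x + φ y) (l : List A) (g : A) :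
    l.foldr Δop (fun x => P (φ x)) g = (l.map φ).foldr Δop P (φ g) := by
  induction l generalizing g with
  | nil => rfl
  | cons h l ih => simp [Δop, ih, hφ]

theorem foldr_Δop_sub {A M : Type*} [Add A] [AddCommGroup M] (P Q : A → M)
    (l : List A) (g : A) :
    l.foldr Δop (fun x => P x - Q x) g = l.foldr Δop P g - l.foldr Δop Q g := by
  induction l generalizing g with
  | nil => rfl
  | cons h l ih => simp only [List.foldr_cons, Δop, ih]; abel

theorem DegLE.foldr_Δop_eq_dDeriv {A M : Type*} [AddMonoid A] [AddGroup M] {P : A → M} {m : ℕ}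
    (hP : DegLE P m) (h : Fin m → A) (g : A) :
    (List.ofFn h).foldr Δop P g = dDeriv P h := by
  have := hP (Fin.cons g h) 0
  simpa [List.ofFn_succ, Δop, sub_eq_zero, dDeriv] using this

/-- The van der Corput identity for an exponential sum over a finite group. -/
theorem norm_sum_char_sq {V M : Type*} [AddCommGroup V] [Fintype V] [AddGroup M] {α : M → ℂ}
    (hadd : ∀ a b, α (a + b) = α a * α b) (hnorm : ∀ a, ‖α a‖ = 1) (Q : V → M) :
    ((‖∑ g, α (Q g)‖ ^ 2 : ℝ) : ℂ) = ∑ h, ∑ g, α (Δop h Q g) := by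
  rw [← Complex.normSq_eq_norm_sq, ← Complex.mul_conj, map_sum, Finset.sum_mul_sum,
    Finset.sum_comm]
  refine Eq.trans ?_ Finset.sum_comm
  refine Finset.sum_congr rfl fun g _ => ?_
  rw [← Equiv.sum_comp (Equiv.addLeft g)]
  exact Finset.sum_congr rfl fun h _ => (char_sub_eq_mul_conj hadd hnorm _ _).symm

/-- Iterated van der Corput inequality: an exponential sum is controlled by the average of its
iterated multiplicative derivatives. -/
theorem norm_avg_char_pow_le {V M : Type*} [AddCommGroup V] [Fintype V] [AddGroup M] {α : M → ℂ}
    (hadd : ∀ a b, α (a + b) = α a * α b) (hnorm : ∀ a, ‖α a‖ = 1) (m : ℕ) (Q : V → M) :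
    (‖∑ g, α (Q g)‖ / Fintype.card V) ^ 2 ^ (m + 1) ≤
      (∑ h : Fin (m + 1) → V, ∑ g, α ((List.ofFn h).foldr Δop Q g)).re /
        (Fintype.card V : ℝ) ^ (m + 2) := by
  have hN : (0 : ℝ) < Fintype.card V := by exact_mod_cast Fintype.card_pos
  induction m generalizing Q with
  | zero =>
    have hsum : ∑ h : Fin 1 → V, ∑ g, α ((List.ofFn h).foldr Δop Q g) =
        ∑ h, ∑ g, α (Δop h Q g) := by
      rw [← (Equiv.funUnique (Fin 1) V).symm.sum_comp]
      simp
    rw [zero_add, hsum, ← norm_sum_char_sq hadd hnorm, Complex.ofReal_re, div_pow]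
    norm_num
  | succ m ih =>
    have hsum : ∑ h : Fin (m + 2) → V, ∑ g, α ((List.ofFn h).foldr Δop Q g) =
        ∑ v, ∑ h : Fin (m + 1) → V, ∑ g, α ((List.ofFn h).foldr Δop (Δop v Q) g) := by
      rw [← (Fin.snocEquiv (fun _ : Fin (m + 2) => V)).sum_comp, Fintype.sum_prod_type]
      simp [Fin.snocEquiv, List.ofFn_succ', -List.ofFn_succ]
    have hsq : (‖∑ g, α (Q g)‖ / Fintype.card V) ^ 2 ≤
        ∑ v : V, (1 / Fintype.card V : ℝ) * (‖∑ g, α (Δop v Q g)‖ / Fintype.card V) := by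
      have hle : ‖∑ g, α (Q g)‖ ^ 2 ≤ ∑ v, ‖∑ g, α (Δop v Q g)‖ := by
        have := norm_sum_le Finset.univ (fun v => ∑ g, α (Δop v Q g))
        rw [← norm_sum_char_sq hadd hnorm, Complex.norm_real, Real.norm_of_nonneg (by positivity)]
          at this
        exact this
      rw [← Finset.mul_sum, ← Finset.sum_div, div_pow, div_mul_div_comm, one_mul, ← sq]
      gcongr
    rw [hsum, pow_succ' 2 (m + 1), pow_mul, Complex.re_sum, Finset.sum_div]
    calc _ ≤ (∑ v : V, (1 / Fintype.card V : ℝ) *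
            (‖∑ g, α (Δop v Q g)‖ / Fintype.card V)) ^ 2 ^ (m + 1) := by gcongr
      _ ≤ ∑ v : V, (1 / Fintype.card V : ℝ) *
            (‖∑ g, α (Δop v Q g)‖ / Fintype.card V) ^ 2 ^ (m + 1) :=
          by
          refine Real.pow_arith_mean_le_arith_mean_pow _ _ _ (fun _ _ => by positivity) ?_
            (fun _ _ => by positivity) _
          simp [hN.ne']
      _ ≤ _ := by
          refine Finset.sum_le_sum fun v _ => ?_
          refine (mul_le_mul_of_nonneg_left (ih (Δop v Q)) (by positivity)).trans_eq ?_
          rw [div_mul_div_comm, one_mul, ← pow_succ']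

/-- For a map of degree at most `m`, the average of its `m`-th derivative dominates the
exponential sum of the map. -/
theorem DegLE.norm_avg_char_pow_le {V M : Type*} [AddCommGroup V] [Fintype V] [AddGroup M]
    {α : M → ℂ} (hadd : ∀ a b, α (a + b) = α a * α b) (hnorm : ∀ a, ‖α a‖ = 1) {m : ℕ}
    (hm : 1 ≤ m) {Q : V → M} (hQ : DegLE Q m) :
    (‖∑ g, α (Q g)‖ / Fintype.card V) ^ 2 ^ m ≤
      (∑ h : Fin m → V, α (dDeriv Q h)).re / (Fintype.card V : ℝ) ^ m := by
  have hN : (0 : ℝ) < Fintype.card V := by exact_mod_cast Fintype.card_pos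
  obtain ⟨m, rfl⟩ := Nat.exists_eq_add_of_le' hm
  refine (_root_.norm_avg_char_pow_le hadd hnorm m Q).trans_eq ?_
  simp only [hQ.foldr_Δop_eq_dDeriv, Finset.sum_const, Finset.card_univ, nsmul_eq_mul,
    ← Finset.mul_sum]
  rw [pow_succ' _ (m + 1), ← Complex.ofReal_natCast, Complex.re_ofReal_mul,
    mul_div_mul_left _ _ hN.ne']

theorem foldr_Δop_dilate_sub {F : Type*} [Field F] (P : F[X] → F) (a b : F[X]) {n : ℕ}
    (l : List (Fin n → F)) (g : Fin n → F) :
    l.foldr Δop (fun c => P (a * polyOf c) - P (b * polyOf c)) g =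
      (l.map fun c => a * polyOf c).foldr Δop P (a * polyOf g) -
        (l.map fun c => b * polyOf c).foldr Δop P (b * polyOf g) := by
  rw [foldr_Δop_sub, foldr_Δop_comp P (fun c => a * polyOf c) (by simp [polyOf_add, mul_add]),
    foldr_Δop_comp P (fun c => b * polyOf c) (by simp [polyOf_add, mul_add])]

theorem DegLE.dilate_sub {F : Type*} [Field F] {P : F[X] → F} {m : ℕ} (hP : DegLE P m)
    (a b : F[X]) (n : ℕ) :
    DegLE (fun c : Fin n → F => P (a * polyOf c) - P (b * polyOf c)) m := by
  intro h g
  rw [foldr_Δop_dilate_sub, List.map_ofFn, List.map_ofFn, hP, hP, sub_zero]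

theorem dDeriv_dilate_sub {F : Type*} [Field F] (P : F[X] → F) (a b : F[X]) {m n : ℕ}
    (h : Fin m → Fin n → F) :
    dDeriv (fun c : Fin n → F => P (a * polyOf c) - P (b * polyOf c)) h =
      dDeriv P (fun i => a * polyOf (h i)) - dDeriv P (fun i => b * polyOf (h i)) := by
  rw [dDeriv, foldr_Δop_dilate_sub, List.map_ofFn, List.map_ofFn, polyOf_zero, mul_zero, mul_zero]
  rfl

theorem stmt6 {F : Type*} [Field F] [Fintype F]
    (m : ℕ) (hm : 1 ≤ m) (P : Polynomial F → F) (hP : DegLE P m)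
    (α : F → ℂ) (hαadd : ∀ a b, α (a + b) = α a * α b)
    (hα1 : ∀ a, ‖α a‖ = 1)
    (ε : ℝ) (hε : 0 < ε) (n k : ℕ) (hkn : k < n)
    (T : Finset ((Fin (k + 2) → F) × (Fin (k + 2) → F)))
    (hT : ∀ ab ∈ T,
      ε / 2 ≤ ‖(1 / (Fintype.card F : ℂ) ^ (n - k)) *
        ∑ c : Fin (n - k) → F,
          α (P (polyOf ab.1 * polyOf c) - P (polyOf ab.2 * polyOf c))‖) :
    ((T.card : ℝ) / (Fintype.card F : ℝ) ^ (2 * k + 4)) * (ε / 2) ^ (2 ^ m) ≤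
      ((1 / (Fintype.card F : ℂ) ^ (2 * (k + 2) + m * (n - k))) *
        ∑ a : Fin (k + 2) → F, ∑ b : Fin (k + 2) → F, ∑ g : Fin m → (Fin (n - k) → F),
          α (dDeriv P (fun i => polyOf a * polyOf (g i)) -
             dDeriv P (fun i => polyOf b * polyOf (g i)))).re := by
  have hq : (0 : ℝ) < Fintype.card F := by exact_mod_cast Fintype.card_pos
  set S : (Fin (k + 2) → F) × (Fin (k + 2) → F) → ℝ := fun ab =>
    (∑ g : Fin m → (Fin (n - k) → F),
      α (dDeriv P (fun i => polyOf ab.1 * polyOf (g i)) -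
        dDeriv P (fun i => polyOf ab.2 * polyOf (g i)))).re /
      (Fintype.card F : ℝ) ^ (m * (n - k)) with hS
  have hbound : ∀ ab : (Fin (k + 2) → F) × (Fin (k + 2) → F),
      ‖(1 / (Fintype.card F : ℂ) ^ (n - k)) * ∑ c : Fin (n - k) → F,
        α (P (polyOf ab.1 * polyOf c) - P (polyOf ab.2 * polyOf c))‖ ^ 2 ^ m ≤ S ab := by
    intro ab
    have := (hP.dilate_sub (polyOf ab.1) (polyOf ab.2) (n - k)).norm_avg_char_pow_le hαadd hα1 hm
    simp only [dDeriv_dilate_sub, Fintype.card_pi_const, Nat.cast_pow, ← pow_mul] at this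
    rw [norm_mul, norm_div, norm_pow, Complex.norm_natCast, norm_one, one_div_mul_eq_div, hS,
      mul_comm m]
    exact this
  have hmain : (T.card : ℝ) * (ε / 2) ^ 2 ^ m ≤ ∑ ab, S ab := by
    calc (T.card : ℝ) * (ε / 2) ^ 2 ^ m = ∑ ab ∈ T, (ε / 2) ^ 2 ^ m := by simp
      _ ≤ ∑ ab ∈ T, S ab := by
          refine Finset.sum_le_sum fun ab hab => le_trans ?_ (hbound ab)
          gcongr
          exact hT ab hab
      _ ≤ ∑ ab, S ab := Finset.sum_le_sum_of_subset_of_nonneg (Finset.subset_univ T)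
          fun ab _ _ => le_trans (by positivity) (hbound ab)
  have hscalar : (1 / (Fintype.card F : ℂ) ^ (2 * (k + 2) + m * (n - k))) =
      ((1 / (Fintype.card F : ℝ) ^ (2 * (k + 2) + m * (n - k)) : ℝ) : ℂ) := by
    push_cast; rfl
  have hsum : (∑ ab, S ab) / (Fintype.card F : ℝ) ^ (2 * k + 4) =
      ((1 / (Fintype.card F : ℂ) ^ (2 * (k + 2) + m * (n - k))) *
        ∑ a : Fin (k + 2) → F, ∑ b : Fin (k + 2) → F, ∑ g : Fin m → (Fin (n - k) → F),
          α (dDeriv P (fun i => polyOf a * polyOf (g i)) -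
             dDeriv P (fun i => polyOf b * polyOf (g i)))).re := by
    rw [hscalar, Complex.re_ofReal_mul, hS, ← Finset.sum_div, div_div, one_div_mul_eq_div,
      ← pow_add, Fintype.sum_prod_type, Complex.re_sum]
    simp only [Complex.re_sum]
    congr 2
    ring
  rw [← hsum, div_mul_eq_mul_div]
  gcongr
end

section
/- Let G be a finite abelian group, q a prime power, m ≥ 1, and let F : G → 𝔽_q satisfy Δ_{h_0}Δ_{h_1}⋯Δ_{h_m}F ≡ 0 for all h_0,…,h_m ∈ G, where Δ_hF(x) := F(x+h) − F(x). Then for every additive character α of 𝔽_q, |E_{x ∈ G} α(F(x))|^{2^m} ≤ Re( E_{(h_1,…,h_m) ∈ G^m} α( Δ_{h_1}⋯Δ_{h_m}F(0) ) ). -/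
open Filter

section GowersCauchySchwarz

variable {G : Type*} [AddCommGroup G] [Fintype G] {Fq : Type*} [Field Fq]

/-- Summing over the innermost direction of an iterated difference first. -/
theorem sum_foldr_Δop_succ (m : ℕ) (F : G → Fq) (φ : (G → Fq) → ℂ) :
    ∑ h : Fin (m + 1) → G, φ ((List.ofFn h).foldr Δop F) =
      ∑ k : G, ∑ h : Fin m → G, φ ((List.ofFn h).foldr Δop (Δop k F)) := by
  rw [← (Fin.snocEquiv fun _ : Fin (m + 1) => G).sum_comp, Fintype.sum_prod_type]
  refine Finset.sum_congr rfl fun k _ => Finset.sum_congr rfl fun h _ => ?_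
  rw [List.ofFn_succ']
  simp [Fin.snocEquiv]

/-- The squared norm of a character average is the average of the character over first
differences. -/
theorem sq_norm_average_eq_average_Δop (F : G → Fq) (α : Fq → ℂ)
    (hαadd : ∀ a b, α (a + b) = α a * α b) (hα1 : ∀ a, ‖α a‖ = 1) :
    ((‖(Fintype.card G : ℂ)⁻¹ * ∑ x : G, α (F x)‖ ^ 2 : ℝ) : ℂ) =
      (Fintype.card G : ℂ)⁻¹ * ∑ k : G, (Fintype.card G : ℂ)⁻¹ * ∑ x : G, α (Δop k F x) := by
  have hsub : ∀ a b, α (a - b) = α a * starRingEnd ℂ (α b) := fun a b => by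
    have hb : α b * starRingEnd ℂ (α b) = 1 := by simp [Complex.mul_conj', hα1]
    have h := hαadd (a - b) b
    rw [sub_add_cancel] at h
    rw [h, mul_assoc, hb, mul_one]
  have hsum : ∑ k : G, ∑ x : G, α (Δop k F x) =
      (∑ x : G, α (F x)) * starRingEnd ℂ (∑ x : G, α (F x)) := by
    rw [Finset.sum_comm, map_sum, Finset.mul_sum]
    refine Finset.sum_congr rfl fun x _ => ?_
    simp only [Δop, hsub]
    rw [← Finset.sum_mul, ← Equiv.sum_comp (Equiv.addLeft x) fun y => α (F y)]
    rfl
  rw [← Finset.mul_sum, hsum]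
  push_cast
  rw [← Complex.mul_conj']
  simp only [map_mul, map_inv₀, Complex.conj_natCast]
  ring

/-- Jensen's inequality for uniform averages and natural powers. -/
theorem pow_average_le_average_pow {ι : Type*} [Fintype ι] [Nonempty ι] (z : ι → ℝ)
    (hz : ∀ k, 0 ≤ z k) (n : ℕ) :
    ((Fintype.card ι : ℝ)⁻¹ * ∑ k : ι, z k) ^ n ≤
      (Fintype.card ι : ℝ)⁻¹ * ∑ k : ι, z k ^ n := by
  rw [Finset.mul_sum, Finset.mul_sum]
  exact Real.pow_arith_mean_le_arith_mean_pow Finset.univ (fun _ => (Fintype.card ι : ℝ)⁻¹) z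
    (fun _ _ => by positivity) (by simp) (fun k _ => hz k) n

/-- A character average is bounded by the Gowers uniformity norm. -/
theorem norm_average_pow_le_average_foldr_Δop (α : Fq → ℂ)
    (hαadd : ∀ a b, α (a + b) = α a * α b) (hα1 : ∀ a, ‖α a‖ = 1) (m : ℕ) (F : G → Fq) :
    ‖(Fintype.card G : ℂ)⁻¹ * ∑ x : G, α (F x)‖ ^ 2 ^ (m + 1) ≤
      ((Fintype.card G : ℂ)⁻¹ ^ (m + 1) * ∑ h : Fin (m + 1) → G,
        (Fintype.card G : ℂ)⁻¹ * ∑ x : G, α ((List.ofFn h).foldr Δop F x)).re := by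
  induction m generalizing F with
  | zero =>
    rw [sum_foldr_Δop_succ 0 F fun P => (Fintype.card G : ℂ)⁻¹ * ∑ x : G, α (P x)]
    have h := congrArg Complex.re (sq_norm_average_eq_average_Δop F α hαadd hα1)
    rw [Complex.ofReal_re] at h
    simpa using h.le
  | succ m ih =>
    rw [sum_foldr_Δop_succ (m + 1) F fun P => (Fintype.card G : ℂ)⁻¹ * ∑ x : G, α (P x),
      pow_succ' 2 (m + 1), pow_mul]
    have hsq : ‖(Fintype.card G : ℂ)⁻¹ * ∑ x : G, α (F x)‖ ^ 2 ≤
        (Fintype.card G : ℝ)⁻¹ *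
          ∑ k : G, ‖(Fintype.card G : ℂ)⁻¹ * ∑ x : G, α (Δop k F x)‖ := by
      have h := congrArg norm (sq_norm_average_eq_average_Δop F α hαadd hα1)
      rw [Complex.norm_real, Real.norm_of_nonneg (by positivity)] at h
      rw [h, norm_mul, norm_inv, Complex.norm_natCast]
      gcongr
      exact norm_sum_le _ _
    calc _ ≤ _ := pow_le_pow_left₀ (by positivity) hsq _
      _ ≤ _ := pow_average_le_average_pow _ (fun _ => norm_nonneg _) _
      _ ≤ _ := mul_le_mul_of_nonneg_left (Finset.sum_le_sum fun k _ => ih (Δop k F))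
        (by positivity)
      _ = _ := by
        rw [← Complex.re_sum, ← Complex.re_ofReal_mul, ← Finset.mul_sum, ← mul_assoc,
          pow_succ' _ (m + 1)]
        push_cast
        rfl

end GowersCauchySchwarz

theorem stmt7 {G : Type*} [AddCommGroup G] [Fintype G]
    {Fq : Type*} [Field Fq] [Fintype Fq]
    (m : ℕ) (hm : 1 ≤ m) (F : G → Fq)
    (hF : ∀ h : Fin (m + 1) → G, ∀ x : G, (List.ofFn h).foldr Δop F x = 0)
    (α : Fq → ℂ) (hαadd : ∀ a b, α (a + b) = α a * α b)
    (hα1 : ∀ a, ‖α a‖ = 1) :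
    ‖(1 / (Fintype.card G : ℂ)) * ∑ x : G, α (F x)‖ ^ (2 ^ m) ≤
      ((1 / (Fintype.card G : ℂ) ^ m) *
        ∑ h : Fin m → G, α ((List.ofFn h).foldr Δop F 0)).re := by
  have hconst : ∀ (h : Fin m → G) (x : G),
      (List.ofFn h).foldr Δop F x = (List.ofFn h).foldr Δop F 0 := fun h x => by
    have hx := hF (Fin.cons x h) 0
    simp only [List.ofFn_succ, Fin.cons_zero, Fin.cons_succ, List.foldr_cons] at hx
    simpa [Δop] using sub_eq_zero.mp hx
  obtain ⟨m, rfl⟩ := Nat.exists_eq_add_of_le' hm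
  have h := norm_average_pow_le_average_foldr_Δop α hαadd hα1 m F
  simpa only [hconst, Finset.sum_const, Finset.card_univ, nsmul_eq_mul, ne_eq, Nat.cast_eq_zero,
    Fintype.card_ne_zero, not_false_eq_true, inv_mul_cancel_left₀, one_div, inv_pow] using h
end
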